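/- Let g ≥ 2 be an integer. If integers k ≥ 1, digits 1 ≤ d₁, d₂, d₃, d₄ ≤ g − 1 and exponents 1 ≤ ℓ ≤ m ≤ n ≤ t with t ≥ 2 satisfy N_k = d₁(gˡ−1)/(g−1) · d₂(gᵐ−1)/(g−1) · d₃(gⁿ−1)/(g−1) · d₄(gᵗ−1)/(g−1), then ℓ < 7.8·10¹⁴ · (log t) · (log g)². -/

import Mathlib

/-- The Narayana sequence: N₀ = 0, N₁ = N₂ = 1, Nₙ = Nₙ₋₁ + Nₙ₋₃. -/
def narayana : ℕ → ℕ
  | 0 => 0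
  | 1 => 1
  | 2 => 1
  | n + 3 => narayana (n + 2) + narayana n


section
open Finset

lemma det_norm_le {𝕜 : Type*} [NormedField 𝕜] {ι : Type*} [Fintype ι] [DecidableEq ι]
    (A : Matrix ι ι 𝕜) (c : ι → ℝ) (h : ∀ i j, ‖A i j‖ ≤ c i) :
    ‖A.det‖ ≤ (Fintype.card ι).factorial * ∏ i, c i := by
  rw [← Matrix.det_transpose, Matrix.det_apply]
  refine (norm_sum_le _ _).trans ?_
  have : ∀ σ ∈ (univ : Finset (Equiv.Perm ι)),
      ‖Equiv.Perm.sign σ • ∏ i, A.transpose (σ i) i‖ ≤ ∏ i, c i := by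
    intro σ _
    have h1 : ‖Equiv.Perm.sign σ • ∏ i, A.transpose (σ i) i‖ = ∏ i, ‖A i (σ i)‖ := by
      rcases Int.units_eq_one_or (Equiv.Perm.sign σ) with h | h <;> simp [h, norm_prod]
    rw [h1]
    exact prod_le_prod (fun i _ => norm_nonneg _) (fun i _ => h _ _)
  refine (sum_le_sum this).trans ?_
  simp [Finset.card_univ, Fintype.card_perm]

lemma wt_sum_ge {ι : Type*} [Fintype ι] (J n : ℕ) (hc : Fintype.card ι = J * n) (w : ι → ℕ)
    (hw : ∀ h ≤ n, (univ.filter (fun r => w r < h)).card ≤ J * h) :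
    J * (n * (n - 1) / 2) ≤ ∑ r, w r := by
  have h1 : ∀ r, ∑ h ∈ range n, (if h + 1 ≤ w r then 1 else 0) ≤ w r := by
    intro r
    rw [← Finset.sum_filter, ← Finset.card_eq_sum_ones]
    calc _ ≤ (range (w r)).card := by
          apply card_le_card
          intro x; simp
      _ = w r := by simp
  calc J * (n * (n - 1) / 2) = ∑ h ∈ range n, J * h := by
        rw [← Finset.sum_range_id, mul_sum]
      _ ≤ ∑ h ∈ range n, ∑ r, (if h + 1 ≤ w r then 1 else 0) := by
        rw [← Finset.sum_range_reflect]
        apply sum_le_sum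
        intro h hh
        have hh' := mem_range.1 hh
        rw [← Finset.sum_filter, ← Finset.card_eq_sum_ones]
        have h2 := hw (h+1) (by omega)
        have h3 := Finset.card_filter_add_card_filter_not (s := (univ : Finset ι)) (fun r => w r < h + 1)
        rw [card_univ, hc] at h3
        have h4 : (univ.filter (fun r => ¬ w r < h + 1)) = univ.filter (fun r => h + 1 ≤ w r) := by
          ext; simp
        rw [h4] at h3
        have h5 : J * (n - 1 - h) + J * (h + 1) = J * n := by
          rw [← mul_add]; congr 1; omega
        omega
      _ = ∑ r, ∑ h ∈ range n, (if h + 1 ≤ w r then 1 else 0) := sum_comm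
      _ ≤ _ := sum_le_sum (fun r _ => h1 r)

/-- analytic estimate -/
lemma lemmaA {ι κ 𝒯 : Type*} [Fintype ι] [DecidableEq ι] [Fintype 𝒯] 
    (J n : ℕ) (hc : Fintype.card ι = J * n)
    (M : Matrix ι ι ℝ) (a : ι → 𝒯 → ℝ) (key : ι → 𝒯 → κ) (φ : κ → ι → ℝ) (wt : κ → ℕ)
    (err : ι → ι → ℝ) (q : ℝ) (hq : 0 < q) (hq1 : q ≤ 1)
    (hM : ∀ r s, M r s = ∑ τ, a r τ * φ (key r τ) s + err r s)
    (mm : ι → 𝒯 → ℝ) (m : ι → ℝ) (hmm0 : ∀ r τ, 0 ≤ mm r τ)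
    (hb : ∀ r τ s, |a r τ| * |φ (key r τ) s| ≤ q ^ (wt (key r τ)) * mm r τ)
    (hs : ∀ r, ∑ τ, mm r τ ≤ m r)
    (he : ∀ r s, |err r s| ≤ q ^ n * m r)
    (hcount : ∀ (h : ℕ) (S : Finset κ), (∀ k ∈ S, wt k < h) → S.card ≤ J * h) :
    |M.det| ≤ (Fintype.card ι).factorial * (q ^ (J * (n * (n - 1) / 2)) * ∏ r, (2 * m r)) := by
  classical
  have hm0 : ∀ r, 0 ≤ m r := fun r => (sum_nonneg (fun τ _ => hmm0 r τ)).trans (hs r)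
  let R : ι → Option 𝒯 → ι → ℝ := fun r o => match o with
    | none => err r
    | some τ => fun s => a r τ * φ (key r τ) s
  let wt' : ι → Option 𝒯 → ℕ := fun r o => match o with
    | none => n
    | some τ => wt (key r τ)
  let m' : ι → Option 𝒯 → ℝ := fun r o => match o with
    | none => m r
    | some τ => mm r τ
  have hm'0 : ∀ r o, 0 ≤ m' r o := by
    intro r o; cases o
    · exact hm0 r
    · exact hmm0 r _
  have hMR : M = fun r => ∑ o, R r o := by
    funext r s
    rw [hM, Finset.sum_apply, Fintype.sum_option, add_comm]
  have hexp : M.det = ∑ f : ι → Option 𝒯, Matrix.det (Matrix.of fun r => R r (f r)) := by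
    rw [hMR]
    exact MultilinearMap.map_sum (Matrix.detRowAlternating (R := ℝ) (n := ι)).toMultilinearMap (fun r o => R r o)
  rw [hexp]
  have hterm : ∀ f : ι → Option 𝒯, |Matrix.det (Matrix.of fun r => R r (f r))| ≤
      (Fintype.card ι).factorial * (q ^ (J * (n * (n - 1) / 2)) * ∏ r, m' r (f r)) := by
    intro f
    by_cases hinj : ∀ r r' τ τ', f r = some τ → f r' = some τ' → key r τ = key r' τ' → r = r'
    · have h1 := det_norm_le (Matrix.of fun r => R r (f r)) (fun r => q ^ (wt' r (f r)) * m' r (f r)) (by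
        intro r s
        simp only [Matrix.of_apply, Real.norm_eq_abs]
        rcases hfr : f r with _ | τ
        · exact he r s
        · simp only [R]
          rw [abs_mul]
          exact hb r τ s)
      rw [Real.norm_eq_abs] at h1
      refine h1.trans ?_
      rw [prod_mul_distrib, prod_pow_eq_pow_sum]
      refine mul_le_mul_of_nonneg_left (mul_le_mul_of_nonneg_right ?_ (prod_nonneg fun r _ => hm'0 _ _)) (by positivity)
      · apply pow_le_pow_of_le_one hq.le hq1
        apply wt_sum_ge J n hc
        intro h hh
        by_cases hκ : Nonempty κ
        · obtain ⟨k0⟩ := hκ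
          let g : ι → κ := fun r => match f r with
            | none => k0
            | some τ => key r τ
          rw [← Finset.card_image_of_injOn (f := g)]
          · apply hcount
            intro k hk
            simp only [mem_image, mem_filter, mem_univ, true_and] at hk
            obtain ⟨r, hr, rfl⟩ := hk
            rcases hfr : f r with _ | τ
            · rw [hfr] at hr; simp only [wt'] at hr; omega
            · rw [hfr] at hr; simp only [wt'] at hr; simpa [g, hfr] using hr
          · intro r hr r' hr' hg
            simp only [coe_filter, mem_univ, true_and, Set.mem_ofPred_eq] at hr hr'
            rcases hfr : f r with _ | τ
            · rw [hfr] at hr; simp only [wt'] at hr; omega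
            rcases hfr' : f r' with _ | τ'
            · rw [hfr'] at hr'; simp only [wt'] at hr'; omega
            simp only [g, hfr, hfr'] at hg
            exact hinj r r' τ τ' hfr hfr' hg
        · have : (univ.filter (fun r => wt' r (f r) < h)) = ∅ := by
            ext r
            simp only [mem_filter, mem_univ, true_and, notMem_empty, iff_false]
            rcases hfr : f r with _ | τ
            · simp only [wt']; omega
            · exact (hκ ⟨key r τ⟩).elim
          rw [this]; simp
    · push Not at hinj
      obtain ⟨r, r', τ, τ', h1, h2, h3, h4⟩ := hinj
      let v : ι → ℝ := fun r => match f r with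
        | none => 1
        | some τ => a r τ
      let A : Matrix ι ι ℝ := fun r => match f r with
        | none => err r
        | some τ => φ (key r τ)
      have hA : (Matrix.of fun r => R r (f r)) = Matrix.of fun r s => v r * A r s := by
        ext r s
        simp only [Matrix.of_apply]
        rcases hfr : f r with _ | τ <;> simp [R, v, A, hfr]
      rw [hA, Matrix.det_mul_column, Matrix.det_zero_of_row_eq h4 (by simp [A, h1, h2, h3])]
      simp only [mul_zero, abs_zero]
      have : 0 ≤ ∏ r, m' r (f r) := prod_nonneg fun r _ => hm'0 _ _
      positivity
  calc _ ≤ ∑ f : ι → Option 𝒯, |Matrix.det (Matrix.of fun r => R r (f r))| := abs_sum_le_sum_abs _ _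
    _ ≤ ∑ f : ι → Option 𝒯, (Fintype.card ι).factorial * (q ^ (J * (n * (n - 1) / 2)) * ∏ r, m' r (f r)) :=
        sum_le_sum fun f _ => hterm f
    _ = (Fintype.card ι).factorial * (q ^ (J * (n * (n - 1) / 2)) * ∏ r, ∑ o, m' r o) := by
        rw [← mul_sum, ← mul_sum, Finset.prod_univ_sum, Fintype.piFinset_univ]
    _ ≤ _ := by
        gcongr with r
        · exact fun r _ => sum_nonneg fun o _ => hm'0 r o
        rw [Fintype.sum_option]
        have := hs r
        simp only [m']
        linarith
end

section
open Finset Polynomial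

lemma normform_even (a b c : ℤ)
    (h : Even (a^3+a^2*b+a^2*c-3*a*b*c-2*a*c^2+b^3+b^2*c+c^3)) : Even a ∧ Even b ∧ Even c := by
  rcases Int.even_or_odd a with ha | ha <;> rcases Int.even_or_odd b with hb | hb <;>
    rcases Int.even_or_odd c with hc | hc <;>
    simp_all [Int.even_add, Int.even_sub, Int.even_mul, Int.even_pow, ← Int.not_even_iff_odd, parity_simps]
  all_goals revert h; decide

lemma normform_zero (n : ℕ) : ∀ (a b c : ℤ), a.natAbs + b.natAbs + c.natAbs ≤ n →
    a^3+a^2*b+a^2*c-3*a*b*c-2*a*c^2+b^3+b^2*c+c^3 = 0 → a = 0 ∧ b = 0 ∧ c = 0 := by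
  induction n using Nat.strong_induction_on with
  | _ n ih =>
    intro a b c hn h
    obtain ⟨⟨a', ha⟩, ⟨b', hb⟩, ⟨c', hc⟩⟩ := normform_even a b c (by rw [h]; exact Even.zero)
    by_cases h0 : n = 0
    · omega
    by_cases h1 : a = 0 ∧ b = 0 ∧ c = 0
    · exact h1
    have := ih (a'.natAbs + b'.natAbs + c'.natAbs) (by omega) a' b' c' le_rfl (by
      subst ha hb hc
      have : 8 * (a'^3+a'^2*b'+a'^2*c'-3*a'*b'*c'-2*a'*c'^2+b'^3+b'^2*c'+c'^3) = 0 := by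
        rw [← h]; ring
      omega)
    omega

lemma exists_alpha : ∃ α : ℝ, 1.465 < α ∧ α < 1.466 ∧ α ^ 3 = α ^ 2 + 1 := by
  have h := intermediate_value_Ioo (a := (1.465:ℝ)) (b := 1.466) (by norm_num)
    (f := fun x => x^3 - x^2 - 1) (by fun_prop)
  have h0 : (0:ℝ) ∈ Set.Ioo ((fun x : ℝ => x^3 - x^2 - 1) 1.465) ((fun x : ℝ => x^3 - x^2 - 1) 1.466) := by
    constructor <;> norm_num
  obtain ⟨x, hx, hx2⟩ := h h0
  exact ⟨x, hx.1, hx.2, by simp only at hx2; linarith⟩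

noncomputable def αr : ℝ := Classical.choose exists_alpha
lemma αr_gt : 1.465 < αr := (Classical.choose_spec exists_alpha).1
lemma αr_lt : αr < 1.466 := (Classical.choose_spec exists_alpha).2.1
lemma αr_eq : αr ^ 3 = αr ^ 2 + 1 := (Classical.choose_spec exists_alpha).2.2
lemma αr_pos : 0 < αr := by linarith [αr_gt]

noncomputable def βc : ℂ := ⟨(1 - αr) / 2, √(αr ^ 2 - αr - ((1 - αr) / 2) ^ 2)⟩

lemma βc_im_sq : βc.im * βc.im = αr ^ 2 - αr - ((1 - αr) / 2) ^ 2 := by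
  have : 0 ≤ αr ^ 2 - αr - ((1 - αr) / 2) ^ 2 := by nlinarith [αr_gt, αr_lt]
  exact Real.mul_self_sqrt this
lemma βc_re : βc.re = (1 - αr) / 2 := rfl

lemma βc_sq : βc ^ 2 = (1 - αr) * βc - (αr ^ 2 - αr) := by
  have h := βc_im_sq
  apply Complex.ext
  · simp [pow_two, βc_re, -Complex.ofReal_pow]
    rw [h]; ring
  · simp [pow_two, βc_re]; ring

lemma βc_eq : βc ^ 3 = βc ^ 2 + 1 := by
  have h := βc_sq
  have h2 : (αr : ℂ) ^ 3 = αr ^ 2 + 1 := by exact_mod_cast αr_eq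
  linear_combination (βc - αr) * h + h2

lemma βc_normSq : ‖βc‖ ^ 2 = αr ^ 2 - αr := by
  rw [Complex.sq_norm, Complex.normSq_apply, βc_im_sq, βc_re]; ring

lemma βc_norm_lt : ‖βc‖ < 1 := by
  have := βc_normSq
  nlinarith [norm_nonneg βc, αr_gt, αr_lt]

lemma βc_norm3 : ‖3 * βc - 2‖ ≤ 4.5 := by
  have : ‖3 * βc - 2‖ ^ 2 ≤ 4.5 ^ 2 := by
    rw [Complex.sq_norm, Complex.normSq_apply]
    simp
    have h := βc_im_sq
    rw [βc_re]
    nlinarith [αr_gt, αr_lt]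
  exact le_of_sq_le_sq this (by norm_num)

lemma norm_identity (a b c : ℝ) : (a + b * αr + c * αr ^ 2) * ‖(a + b * βc + c * βc ^ 2 : ℂ)‖ ^ 2 =
    a^3+a^2*b+a^2*c-3*a*b*c-2*a*c^2+b^3+b^2*c+c^3 := by
  have h : ‖(a + b * βc + c * βc ^ 2 : ℂ)‖ ^ 2 = a ^ 2 + b ^ 2 * (αr ^ 2 - αr) + c ^ 2 * (αr ^ 2 - αr) ^ 2
      + a * b * (1 - αr) + a * c * (1 - αr ^ 2) + b * c * (αr ^ 2 - αr) * (1 - αr) := by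
    rw [Complex.sq_norm, Complex.normSq_apply]
    simp [pow_two, βc_re]
    have h := βc_im_sq
    rw [h]
    have h3 : βc.im ^ 2 = αr ^ 2 - αr - ((1 - αr) / 2) ^ 2 := by rw [← h]; ring
    ring_nf
    ring_nf at h3
    rw [h3]
    ring_nf
  rw [h]
  have := αr_eq
  grind

lemma poly_reduce (f : ℤ[X]) : ∃ a b c : ℤ, aeval αr f = a + b * αr + c * αr ^ 2 ∧
    aeval βc f = a + b * βc + c * βc ^ 2 := by
  induction f using Polynomial.induction_on' with
  | add p q hp hq =>
    obtain ⟨a, b, c, h1, h2⟩ := hp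
    obtain ⟨a', b', c', h1', h2'⟩ := hq
    refine ⟨a + a', b + b', c + c', ?_, ?_⟩
    · rw [map_add, h1, h1']; push_cast; ring
    · rw [map_add, h2, h2']; push_cast; ring
  | monomial n z =>
    induction n with
    | zero => exact ⟨z, 0, 0, by simp, by simp⟩
    | succ n ih =>
      obtain ⟨a, b, c, h1, h2⟩ := ih
      rw [aeval_monomial] at h1 h2
      refine ⟨c, a, b + c, ?_, ?_⟩
      · rw [aeval_monomial, pow_succ, ← mul_assoc, h1]; push_cast; linear_combination (c:ℝ) * αr_eq
      · rw [aeval_monomial, pow_succ, ← mul_assoc, h2]; push_cast; linear_combination (c:ℂ) * βc_eq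

lemma lemmaN (f : ℤ[X]) (h : aeval αr f ≠ 0) : 1 ≤ |aeval αr f| * ‖aeval βc f‖ ^ 2 := by
  obtain ⟨a, b, c, h1, h2⟩ := poly_reduce f
  have h3 := norm_identity a b c
  have h4 : |aeval αr f| * ‖aeval βc f‖ ^ 2 = |aeval αr f * ‖aeval βc f‖ ^ 2| := by
    rw [abs_mul, abs_of_nonneg (sq_nonneg ‖_‖)]
  rw [h4, h1, h2]
  push_cast at h3
  rw [h3]
  have h5 : a^3+a^2*b+a^2*c-3*a*b*c-2*a*c^2+b^3+b^2*c+c^3 ≠ 0 := by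
    intro h0
    obtain ⟨rfl, rfl, rfl⟩ := normform_zero _ a b c le_rfl h0
    apply h; rw [h1]; simp
  have h6 := Int.one_le_abs h5
  exact_mod_cast h6

lemma lemmaN0 (f : ℤ[X]) (h : aeval αr f = 0) : aeval βc f = 0 := by
  obtain ⟨a, b, c, h1, h2⟩ := poly_reduce f
  have h3 := norm_identity a b c
  push_cast at h3
  rw [← h1, h, zero_mul] at h3
  have h5 : a^3+a^2*b+a^2*c-3*a*b*c-2*a*c^2+b^3+b^2*c+c^3 = 0 := by exact_mod_cast h3.symm
  obtain ⟨rfl, rfl, rfl⟩ := normform_zero _ a b c le_rfl h5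
  rw [h2]; simp

lemma alpha_indep (a c g : ℕ) (hg : 2 ≤ g) (h : αr ^ a = g ^ c) : a = 0 ∧ c = 0 := by
  have h1 := lemmaN0 (X ^ a - C ((g:ℤ) ^ c)) (by simp [h])
  have h2 : βc ^ a = g ^ c := by
    simp at h1; linear_combination h1
  have h3 : ‖βc‖ ^ a = g ^ c := by
    rw [← norm_pow, h2]; simp
  have hg1 : (1:ℝ) ≤ (g:ℝ) ^ c := one_le_pow₀ (by exact_mod_cast (by omega : 1 ≤ g))
  have ha : a = 0 := by
    by_contra ha
    have := pow_lt_one₀ (norm_nonneg _) βc_norm_lt ha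
    linarith
  refine ⟨ha, ?_⟩
  subst ha
  by_contra hc
  have : (1:ℝ) < (g:ℝ) ^ c := one_lt_pow₀ (by exact_mod_cast (by omega : 1 < g)) hc
  simp at h; linarith
end

section
open Finset 

lemma lemmaR {ι τ F : Type*} [Fintype ι] [DecidableEq ι] [Field F] (M : ι → τ → F)
    (h : LinearIndependent F M) : ∃ e : ι → τ, Matrix.det (Matrix.of fun i j => M i (e j)) ≠ 0 := by
  classical
  set c : τ → (ι → F) := fun t i => M i t
  have hW : Submodule.span F (Set.range c) = ⊤ := by
    by_contra hne
    obtain ⟨f, hf0, hf⟩ := Submodule.exists_le_ker_of_lt_top _ (lt_top_iff_ne_top.2 hne)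
    rw [Fintype.linearIndependent_iff] at h
    have hz := h (fun i => f (Pi.single i 1)) (by
      funext t
      have h1 : f (c t) = 0 := hf (Submodule.subset_span ⟨t, rfl⟩)
      rw [LinearMap.pi_apply_eq_sum_univ f (c t)] at h1
      simp only [Finset.sum_apply, Pi.smul_apply, Pi.zero_apply]
      rw [← h1]
      apply sum_congr rfl
      intro i _
      simp only [smul_eq_mul, c]
      rw [mul_comm]
      congr 2
      funext j
      simp [Pi.single_apply, eq_comm])
    apply hf0
    apply LinearMap.pi_ext'
    intro i
    apply LinearMap.ext_ring
    simpa using hz i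
  obtain ⟨b, hb1, hb2, hb3⟩ := exists_linearIndependent F (Set.range c)
  rw [hW] at hb2
  let B := Module.Basis.mk hb3 (by rw [Subtype.range_coe]; exact hb2.ge)
  let eq := (Pi.basisFun F ι).indexEquiv B
  have hch : ∀ i : ι, ∃ t, c t = (eq i : ι → F) := fun i => hb1 (eq i).2
  choose e he using hch
  refine ⟨e, ?_⟩
  have hli : LinearIndependent F (fun i => c (e i)) := by
    have : (fun i => c (e i)) = (fun x : b => (x : ι → F)) ∘ eq := by
      funext i; exact he i
    rw [this]
    exact hb3.comp _ eq.injective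
  have h2 : LinearIndependent F (Matrix.of fun i j => M i (e j)).col := hli
  rw [Matrix.linearIndependent_cols_iff_isUnit, Matrix.isUnit_iff_isUnit_det] at h2
  exact h2.ne_zero

/-- exponential tail -/
lemma exp_tail (x ρ : ℝ) (hρ : 1 ≤ ρ) (n : ℕ) :
    |Real.exp x - ∑ q ∈ range n, x ^ q / q.factorial| ≤ (1/ρ) ^ n * Real.exp (ρ * |x|) := by
  have h1 : |Real.exp x - ∑ q ∈ range n, x ^ q / q.factorial| ≤
      Real.exp |x| - ∑ q ∈ range n, |x| ^ q / q.factorial := by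
    have := Complex.norm_exp_sub_sum_le_exp_norm_sub_sum (x : ℂ) n
    have h2 : Complex.exp x - ∑ m ∈ range n, (x:ℂ) ^ m / m.factorial =
      ((Real.exp x - ∑ q ∈ range n, x ^ q / q.factorial : ℝ) : ℂ) := by push_cast; rfl
    rw [h2, Complex.norm_real, Complex.norm_real, Real.norm_eq_abs, Real.norm_eq_abs] at this
    exact this
  refine h1.trans ?_
  -- compare with series
  have hs1 := NormedSpace.expSeries_div_hasSum_exp (𝔸 := ℝ) |x|
  have hs2 := NormedSpace.expSeries_div_hasSum_exp (𝔸 := ℝ) (ρ * |x|)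
  rw [← Real.exp_eq_exp_ℝ] at hs1 hs2
  have ht1 := (hasSum_nat_add_iff' n).2 hs1
  have ht2 := (hasSum_nat_add_iff' n).2 hs2
  have hρ0 : 0 < ρ := by linarith
  have hle := hasSum_le (f := fun k => |x| ^ (k + n) / ((k + n).factorial : ℝ))
    (g := fun k => (1/ρ)^n * ((ρ * |x|) ^ (k + n) / ((k + n).factorial : ℝ))) (by
      intro k
      rw [mul_div_assoc', mul_pow, one_div, inv_pow]
      gcongr
      rw [← mul_assoc]
      apply le_mul_of_one_le_left (by positivity)
      rw [pow_add, mul_comm (ρ ^ k), ← mul_assoc, inv_mul_cancel₀ (by positivity), one_mul]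
      exact one_le_pow₀ hρ) ht1 (ht2.mul_left ((1/ρ)^n))
  refine hle.trans ?_
  gcongr
  have : 0 ≤ ∑ i ∈ range n, (ρ * |x|) ^ i / (i.factorial : ℝ) := sum_nonneg fun i _ => by positivity
  linarith
end

section
open Finset Polynomial

/-- homogenization-type map for total degree -/
noncomputable def phiT : ℝ[X][X] →+* ℝ[X][X][X] :=
  eval₂RingHom (S := ℝ[X][X][X]) (eval₂RingHom (S := ℝ[X][X][X]) ((C.comp C).comp C) (C (C X) * X)) (C X * X)

lemma phiT_C_C (a : ℝ) : phiT (C (C a)) = C (C (C a)) := by simp [phiT]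
lemma phiT_C_X : phiT (C X) = C (C X) * X := by simp [phiT]
lemma phiT_X : phiT X = C X * X := by simp [phiT]

noncomputable def td (F : ℝ[X][X]) : ℕ := (phiT F).natDegree

lemma mono_eq (i j : ℕ) (a : ℝ) : (monomial j (monomial i a) : ℝ[X][X]) = C (C a) * C X ^ i * X ^ j := by
  rw [← C_mul_X_pow_eq_monomial, ← C_mul_X_pow_eq_monomial]; simp

lemma phiT_mono (i j : ℕ) (a : ℝ) : phiT (monomial j (monomial i a)) =
    monomial (i + j) (monomial j (monomial i a)) := by
  rw [mono_eq, map_mul, map_mul, map_pow, map_pow, phiT_C_C, phiT_C_X, phiT_X,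
    ← C_mul_X_pow_eq_monomial (n := i + j)]
  simp only [map_mul, map_pow]; ring

lemma bi_induction {p : ℝ[X][X] → Prop} (hadd : ∀ F G, p F → p G → p (F + G))
    (hm : ∀ i j a, p (monomial j (monomial i a))) (F : ℝ[X][X]) : p F := by
  induction F using Polynomial.induction_on' with
  | add F G hF hG => exact hadd _ _ hF hG
  | monomial j q =>
    induction q using Polynomial.induction_on' with
    | add F G hF hG => rw [map_add]; exact hadd _ _ hF hG
    | monomial i a => exact hm i j a

lemma coeff_phiT (F : ℝ[X][X]) (N i j : ℕ) :
    (((phiT F).coeff N).coeff j).coeff i = if N = i + j then (F.coeff j).coeff i else 0 := by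
  induction F using bi_induction with
  | hadd F G hF hG => 
    simp only [map_add, coeff_add, hF, hG]; split_ifs <;> simp
  | hm i' j' a =>
    rw [phiT_mono]
    simp only [coeff_monomial]
    by_cases h1 : i' = i
    · by_cases h2 : j' = j
      · subst h1 h2
        simp only [if_true, coeff_monomial, eq_comm (a := N)]
        split_ifs <;> simp
      · split_ifs <;> simp [coeff_monomial, h2]
    · split_ifs <;> simp only [coeff_monomial, coeff_zero] <;> split_ifs <;> simp [coeff_monomial, h1]

lemma phiT_inj : Function.Injective phiT := by
  rw [injective_iff_map_eq_zero]
  intro F h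
  ext j i
  have := coeff_phiT F (i + j) i j
  simpa [h] using this.symm

lemma td_coeff {F : ℝ[X][X]} {i j : ℕ} (h : (F.coeff j).coeff i ≠ 0) : i + j ≤ td F := by
  apply le_natDegree_of_ne_zero
  intro h0
  have := coeff_phiT F (i + j) i j
  rw [h0] at this
  simp at this
  exact h this.symm

lemma td_natDegree (F : ℝ[X][X]) (j : ℕ) (h : F.coeff j ≠ 0) : (F.coeff j).natDegree + j ≤ td F :=
  td_coeff (by simpa using h)

lemma td_le {F : ℝ[X][X]} {e : ℕ} (h : ∀ i j, (F.coeff j).coeff i ≠ 0 → i + j ≤ e) : td F ≤ e := by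
  rw [td, natDegree_le_iff_coeff_eq_zero]
  intro N hN
  ext j i
  rw [coeff_phiT]
  split_ifs with h1
  · by_contra h2
    have := h i j h2
    omega
  · simp

lemma td_mul {F G : ℝ[X][X]} (hF : F ≠ 0) (hG : G ≠ 0) : td (F * G) = td F + td G := by
  rw [td, map_mul, natDegree_mul] <;> first | rfl | (rw [Ne, map_eq_zero_iff _ phiT_inj]; assumption)

lemma td_pos_of_irreducible {F : ℝ[X][X]} (hF : Irreducible F) : 1 ≤ td F := by
  by_contra h
  have h0 : td F = 0 := by omega
  apply hF.not_isUnit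
  have hF' : F = C (C ((F.coeff 0).coeff 0)) := by
    ext j i
    by_cases hj : j = 0 <;> by_cases hi : i = 0
    · subst hj hi; simp
    all_goals
      have : (F.coeff j).coeff i = 0 := by
        by_contra h1
        have := td_coeff h1
        omega
      rw [this]
      simp [coeff_C, hi, hj]
  rw [hF']
  have : (F.coeff 0).coeff 0 ≠ 0 := by
    intro h2; rw [h2] at hF'; simp at hF'; exact hF.ne_zero hF'
  exact ((isUnit_iff_ne_zero.2 this).map C).map C

/-- translation -/
noncomputable def trl (a b : ℝ) : ℝ[X][X] →+* ℝ[X][X] :=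
  eval₂RingHom (S := ℝ[X][X]) (eval₂RingHom (S := ℝ[X][X]) (C.comp C) (C X + C (C a))) (X + C (C b))

lemma trans_mono (a b : ℝ) (i j : ℕ) (z : ℝ) : trl a b (monomial j (monomial i z)) =
    C (C z) * (C X + C (C a)) ^ i * (X + C (C b)) ^ j := by
  have h1 : trl a b (C (C z)) = C (C z) := by simp [trl]
  have h2 : trl a b (C X) = C X + C (C a) := by simp [trl]
  have h3 : trl a b X = X + C (C b) := by simp [trl]
  rw [mono_eq, map_mul, map_mul, map_pow, map_pow, h1, h2, h3]

lemma evalEval_trans (a b x y : ℝ) (F : ℝ[X][X]) :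
    evalEval x y (trl a b F) = evalEval (x + a) (y + b) F := by
  induction F using bi_induction with
  | hadd F G hF hG => simp only [map_add, evalEval_add, hF, hG]
  | hm i j z =>
    rw [trans_mono, mono_eq]
    simp [evalEval_mul, evalEval_pow, evalEval_add, evalEval_C]

lemma td_trans (a b : ℝ) (F : ℝ[X][X]) : td (trl a b F) ≤ td F := by
  have h1 : trl a b F = ∑ j ∈ F.support, ∑ i ∈ (F.coeff j).support,
      trl a b (monomial j (monomial i ((F.coeff j).coeff i))) := by
    conv_lhs => rw [F.as_sum_support]
    rw [map_sum]
    apply sum_congr rfl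
    intro j _
    conv_lhs => rw [(F.coeff j).as_sum_support]
    rw [map_sum, map_sum]
  rw [td, h1, map_sum]
  apply natDegree_sum_le_of_forall_le
  intro j hj
  rw [map_sum]
  apply natDegree_sum_le_of_forall_le
  intro i hi
  have hij : i + j ≤ td F := td_coeff (by simpa using hi)
  refine le_trans ?_ hij
  rw [trans_mono]
  simp only [map_mul, map_pow, map_add, phiT_C_C, phiT_C_X, phiT_X]
  refine natDegree_mul_le_of_le (natDegree_mul_le_of_le (m := 0) (n := i) (by simp) ?_) ?_ |>.trans (by omega : 0 + i + j ≤ i + j)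
  · refine (natDegree_pow_le_of_le (m := 1) i ?_).trans (by simp)
    compute_degree
  · refine (natDegree_pow_le_of_le (m := 1) j ?_).trans (by simp)
    compute_degree

lemma natDegree_trans_le (a b : ℝ) (F : ℝ[X][X]) : (trl a b F).natDegree ≤ F.natDegree := by
  have : trl a b F = ((F.map (eval₂RingHom C (X + C a))).comp (X + C (C b))) := by
    simp only [trl, coe_eval₂RingHom, comp, eval₂_map]
    congr 1
    apply ringHom_ext <;> simp
  rw [this]
  refine natDegree_comp_le.trans ?_
  rw [natDegree_X_add_C, mul_one]
  exact natDegree_map_le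

/-- degree of determinants -/
lemma det_natDegree {R ι : Type*} [CommRing R] [Fintype ι] [DecidableEq ι] (M : Matrix ι ι R[X])
    (cc rr : ι → ℕ) (h : ∀ r c, M r c ≠ 0 → (M r c).natDegree + cc c ≤ rr r) :
    M.det.natDegree ≤ ∑ r, rr r - ∑ c, cc c := by
  rw [← Matrix.det_transpose, Matrix.det_apply]
  apply natDegree_sum_le_of_forall_le
  intro σ _
  refine (natDegree_smul_le _ _).trans ?_
  by_cases h0 : ∀ i, M i (σ i) ≠ 0
  · have h1 : (∏ i, M.transpose (σ i) i).natDegree ≤ ∑ i, (M i (σ i)).natDegree := natDegree_prod_le _ _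
    have h2 : ∑ i, ((M i (σ i)).natDegree + cc (σ i)) ≤ ∑ i, rr i := sum_le_sum fun i _ => h i _ (h0 i)
    rw [sum_add_distrib, Equiv.sum_comp σ cc] at h2
    omega
  · push Not at h0
    obtain ⟨i, hi⟩ := h0
    rw [prod_eq_zero (mem_univ i) (by simpa using hi)]
    simp
end

section
open Finset Polynomial

def colNum (f : ℕ) : Fin f ⊕ Fin f → ℕ
  | .inl j => j
  | .inr j => f + j

lemma sum_colNum {R : Type*} [AddCommMonoid R] (f : ℕ) (h : ℕ → R) :
    ∑ c, h (colNum f c) = ∑ j ∈ range (2 * f), h j := by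
  rw [Fintype.sum_sum_type, two_mul, sum_range_add]
  simp only [colNum]
  rw [Finset.sum_range, Finset.sum_range]

lemma syl_aux {R : Type*} [CommRing R] {f : ℕ} (H : R[X]) (u : Fin f → R) :
    H * ∑ i, C (u i) * X ^ (i:ℕ) = ∑ i, C (u i) * (H * X ^ (i:ℕ)) := by
  rw [mul_sum]; exact sum_congr rfl fun i _ => by ring

lemma syl_aux2 {R : Type*} [CommRing R] {f : ℕ} (u : Fin f → R) (i : Fin f) :
    (∑ i, C (u i) * X ^ (i:ℕ)).coeff (i:ℕ) = u i := by
  simp only [finsetSum_coeff, coeff_C_mul, coeff_X_pow]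
  rw [sum_eq_single i] <;> simp +contextual [Fin.ext_iff, eq_comm]

lemma bez_num (f e : ℕ) (hf : 1 ≤ f) : f * e + ∑ x ∈ range f, x + (f * e + ∑ x ∈ range f, x) ≤
    e ^ 2 + ∑ j ∈ range (2 * f), j := by
  have h1 := Finset.sum_range_id_mul_two f
  have h2 := Finset.sum_range_id_mul_two (2 * f)
  obtain ⟨f', rfl⟩ : ∃ f', f = f' + 1 := ⟨f - 1, by omega⟩
  have e1 : 2 * (f' + 1) - 1 = 2 * f' + 1 := by omega
  rw [e1] at h2
  simp only [Nat.add_sub_cancel] at h1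
  zify at *
  nlinarith [sq_nonneg ((e:ℤ) - (f' + 1 : ℤ))]

set_option maxHeartbeats 1000000 in
lemma bezout {F G : ℝ[X][X]} {e : ℕ} (hF : Irreducible F) (hFe : td F ≤ e) (hGe : td G ≤ e)
    (hdeg : G.natDegree ≤ F.natDegree) (hFG : ¬ F ∣ G) (Z : Finset (ℝ × ℝ))
    (hZF : ∀ z ∈ Z, evalEval z.1 z.2 F = 0) (hZG : ∀ z ∈ Z, evalEval z.1 z.2 G = 0)
    (hinj : Set.InjOn Prod.fst (Z : Set (ℝ × ℝ))) : Z.card ≤ e ^ 2 := by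
  classical
  rw [← card_image_of_injOn hinj]
  have he : 1 ≤ e := (td_pos_of_irreducible hF).trans hFe
  set f := F.natDegree with hf
  have key : ∀ p : ℝ[X], p ≠ 0 → p.natDegree ≤ e ^ 2 → (∀ z ∈ Z, p.eval z.1 = 0) →
      (Z.image Prod.fst).card ≤ e ^ 2 := by
    intro p hp hd hz
    refine le_trans ?_ hd
    refine card_le_degree_of_subset_roots ?_
    intro x hx
    simp only [mem_val, mem_image] at hx
    obtain ⟨z, hz1, rfl⟩ := hx
    rw [mem_roots hp]
    exact hz z hz1
  by_cases hf0 : f = 0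
  · have hFC : F = C (F.coeff 0) := eq_C_of_natDegree_eq_zero hf0
    have h0 : F.coeff 0 ≠ 0 := by
      intro h; rw [h] at hFC; simp at hFC; exact hF.ne_zero hFC
    apply key (F.coeff 0) h0
    · have := td_natDegree F 0 h0
      nlinarith
    · intro z hz
      have := hZF z hz
      rw [hFC, evalEval_C] at this
      exact this
  have hf1 : 1 ≤ f := by omega
  -- Sylvester matrix
  let rp : Fin f ⊕ Fin f → ℝ[X][X] := Sum.elim (fun i => F * X ^ (i:ℕ)) (fun i => G * X ^ (i:ℕ))
  let M : Matrix (Fin f ⊕ Fin f) (Fin f ⊕ Fin f) ℝ[X] := Matrix.of fun r c => (rp r).coeff (colNum f c)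
  have hrpdeg : ∀ r, (rp r).natDegree < 2 * f := by
    rintro (i | i)
    · have : (rp (Sum.inl i)).natDegree ≤ f + i := by
        simp only [rp, Sum.elim_inl]
        exact natDegree_mul_le_of_le le_rfl (natDegree_X_pow_le _)
      omega
    · have : (rp (Sum.inr i)).natDegree ≤ f + i := by
        simp only [rp, Sum.elim_inr]
        exact natDegree_mul_le_of_le hdeg (natDegree_X_pow_le _)
      omega
  have hrp : ∀ r, rp r = ∑ c, C (M r c) * X ^ (colNum f c) := by
    intro r
    exact (as_sum_range_C_mul_X_pow' _ (hrpdeg r)).trans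
      (sum_colNum f (fun j => C ((rp r).coeff j) * X ^ j)).symm
  have hdet0 : M.det ≠ 0 := by
    intro h0
    obtain ⟨v, hv0, hv⟩ := Matrix.exists_vecMul_eq_zero_iff.2 h0
    have hsum : ∑ r, C (v r) * rp r = 0 := by
      have : ∑ r, C (v r) * rp r = ∑ c, C ((Matrix.vecMul v M) c) * X ^ (colNum f c) := by
        simp_rw [hrp, mul_sum, Matrix.vecMul, dotProduct, map_sum, sum_mul]
        rw [sum_comm]
        apply sum_congr rfl; intro c _
        apply sum_congr rfl; intro r _
        rw [map_mul]; ring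
      rw [this, hv]; simp
    rw [Fintype.sum_sum_type] at hsum
    simp only [rp, Sum.elim_inl, Sum.elim_inr] at hsum
    obtain ⟨A, hA⟩ : ∃ A : ℝ[X][X], A = ∑ i : Fin f, C (v (Sum.inl i)) * X ^ (i:ℕ) := ⟨_, rfl⟩
    obtain ⟨B, hB⟩ : ∃ B : ℝ[X][X], B = ∑ i : Fin f, C (v (Sum.inr i)) * X ^ (i:ℕ) := ⟨_, rfl⟩
    have hAB : F * A + G * B = 0 := by
      refine Eq.trans ?_ hsum
      rw [hA, hB, syl_aux, syl_aux]
    have hcA : ∀ i : Fin f, A.coeff i = v (Sum.inl i) := by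
      intro i
      rw [hA]; exact syl_aux2 (fun i => v (Sum.inl i)) i
    have hcB : ∀ i : Fin f, B.coeff i = v (Sum.inr i) := by
      intro i
      rw [hB]; exact syl_aux2 (fun i => v (Sum.inr i)) i
    have hBdeg : B.natDegree < f := by
      have : B.natDegree ≤ f - 1 := by
        rw [hB]
        apply natDegree_sum_le_of_forall_le
        intro i _
        refine (natDegree_C_mul_X_pow_le _ _).trans (by omega)
      omega
    have hdvd : F ∣ G * B := ⟨-A, by linear_combination hAB⟩
    have hB0 : B = 0 := by
      rcases hF.prime.dvd_or_dvd hdvd with h | h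
      · exact (hFG h).elim
      · by_contra hne
        have := natDegree_le_of_dvd h hne
        omega
    have hA0 : A = 0 := by
      rw [hB0, mul_zero, add_zero] at hAB
      exact (mul_eq_zero.1 hAB).resolve_left hF.ne_zero
    apply hv0
    funext r
    rcases r with i | i
    · rw [← hcA, hA0]; simp
    · rw [← hcB, hB0]; simp
  apply key M.det hdet0
  · let rr : Fin f ⊕ Fin f → ℕ := Sum.elim (fun i => e + i) (fun i => e + i)
    refine (det_natDegree M (colNum f) rr ?_).trans ?_
    · have aux : ∀ (H : ℝ[X][X]) (i n : ℕ), td H ≤ e → (H * X ^ i).coeff n ≠ 0 →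
          ((H * X ^ i).coeff n).natDegree + n ≤ e + i := by
        intro H i n hH h
        rw [coeff_mul_X_pow'] at h ⊢
        split_ifs at h ⊢ with hin
        · have := td_natDegree H (n - i) h
          omega
        · simp at h
      rintro (i | i) c h
      · exact aux F i _ hFe h
      · exact aux G i _ hGe h
    · rw [sum_colNum f (fun j => j), Fintype.sum_sum_type]
      simp only [rr, Sum.elim_inl, Sum.elim_inr]
      rw [← Finset.sum_range (fun i => e + i), sum_add_distrib, sum_const, card_range, smul_eq_mul]
      rw [Nat.sub_le_iff_le_add]
      exact bez_num f e hf1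
  · intro z hz
    have h1 : (M.map (evalRingHom z.1)).det = 0 := by
      rw [← Matrix.exists_mulVec_eq_zero_iff]
      refine ⟨fun c => z.2 ^ (colNum f c), ?_, ?_⟩
      · intro h
        have := congrFun h (Sum.inl ⟨0, hf1⟩)
        simp [colNum] at this
      · funext r
        have h2 : evalEval z.1 z.2 (rp r) = 0 := by
          rcases r with i | i
          · simp only [rp, Sum.elim_inl, evalEval_mul, hZF z hz, zero_mul]
          · simp only [rp, Sum.elim_inr, evalEval_mul, hZG z hz, zero_mul]
        rw [hrp r] at h2
        simp only [evalEval_finsetSum, evalEval_mul, evalEval_C, evalEval_pow, evalEval_X] at h2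
        simpa [Matrix.mulVec, dotProduct] using h2
    have h3 := RingHom.map_det (evalRingHom z.1) M
    rw [RingHom.mapMatrix_apply, h1] at h3
    exact h3
end

section
open Finset Polynomial
open scoped Pointwise Combinatorics.Additive

lemma factor_pigeon {ι : Type*} [DecidableEq ι] (S : Finset ι) (p : ι → ℝ × ℝ) (d : ℕ) (Δ : ℝ[X][X]) (hΔ : Δ ≠ 0)
    (htd : td Δ < d) (hS : S.Nonempty) (hv : ∀ s ∈ S, evalEval (p s).1 (p s).2 Δ = 0) :
    ∃ F : ℝ[X][X], Irreducible F ∧ ∃ Z ⊆ S, (∀ s ∈ Z, evalEval (p s).1 (p s).2 F = 0) ∧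
      S.card * td F ≤ Z.card * d := by
  classical
  by_contra hcon
  push Not at hcon
  have key : ∀ G : ℝ[X][X], G ≠ 0 → 
      (S.filter (fun s => evalEval (p s).1 (p s).2 G = 0)).card * d ≤ S.card * td G := by
    intro G
    induction G using UniqueFactorizationMonoid.induction_on_prime with
    | h₁ => intro h; exact (h rfl).elim
    | h₂ G hG =>
      intro _
      have : (S.filter (fun s => evalEval (p s).1 (p s).2 G = 0)) = ∅ := by
        apply filter_eq_empty_iff.2
        intro s _ h0
        have := hG.map (evalEvalRingHom (p s).1 (p s).2)
        rw [coe_evalEvalRingHom, h0] at this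
        exact not_isUnit_zero this
      rw [this]; simp
    | h₃ G P hG hP ih =>
      intro h
      have h1 := ih hG
      have h2 := hcon P hP.irreducible (S.filter (fun s => evalEval (p s).1 (p s).2 P = 0))
        (filter_subset _ _) (fun s hs => (mem_filter.1 hs).2)
      rw [td_mul hP.ne_zero hG]
      have h3 : (S.filter (fun s => evalEval (p s).1 (p s).2 (P * G) = 0)).card ≤
        (S.filter (fun s => evalEval (p s).1 (p s).2 P = 0)).card +
        (S.filter (fun s => evalEval (p s).1 (p s).2 G = 0)).card := by
        refine le_trans (card_le_card ?_) (card_union_le _ _)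
        intro s hs
        simp only [mem_filter, evalEval_mul, mul_eq_zero, mem_union] at hs ⊢
        tauto
      nlinarith
  have h1 := key Δ hΔ
  rw [filter_true_of_mem hv] at h1
  have := Nat.le_of_mul_le_mul_left h1 (card_pos.2 hS)
  omega

lemma line_of_dvd {F : ℝ[X][X]} (hF : Irreducible F) (a b : ℝ) (ha : a ≠ 0)
    (hd : F ∣ trl a b F) (x0 y0 : ℝ) (h0 : evalEval x0 y0 F = 0) :
    ∃ ρ σ : ℝ, ∀ x y : ℝ, evalEval x y F = 0 → y = ρ * x + σ := by
  have hstep : ∀ x y, evalEval x y F = 0 → evalEval (x + a) (y + b) F = 0 := by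
    intro x y h
    rw [← evalEval_trans]
    obtain ⟨G, hG⟩ := hd
    rw [hG, evalEval_mul, h, zero_mul]
  have hall : ∀ m : ℕ, evalEval (x0 + m * a) (y0 + m * b) F = 0 := by
    intro m
    induction m with
    | zero => simpa using h0
    | succ m ih => 
      have := hstep _ _ ih
      push_cast
      rw [show x0 + ((m:ℝ) + 1) * a = x0 + m * a + a by ring, show y0 + ((m:ℝ) + 1) * b = y0 + m * b + b by ring]
      exact this
  set ℓ : ℝ[X] := C (b / a) * (X - C x0) + C y0 with hℓ
  have hroot : F.eval ℓ = 0 := by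
    apply eq_zero_of_infinite_isRoot
    apply Set.infinite_of_injective_forall_mem (f := fun m : ℕ => x0 + m * a)
    · intro m m' h
      have : (m:ℝ) * a = m' * a := by simpa using h
      exact_mod_cast mul_right_cancel₀ ha this
    · intro m
      have h1 := hall m
      have h2 : y0 + m * b = ℓ.eval (x0 + m * a) := by
        simp [hℓ]; field_simp; ring
      rw [h2] at h1
      show IsRoot _ _
      rw [IsRoot.def, ← h1, evalEval]
      have h3 := Polynomial.hom_eval₂ F (RingHom.id _) (evalRingHom (x0 + m * a)) ℓ
      simp only [RingHom.comp_id, eval₂_id, coe_evalRingHom] at h3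
      rw [h3]
      have h4 := Polynomial.hom_eval₂ F (RingHom.id _) (evalRingHom (x0 + m * a)) (C (ℓ.eval (x0 + m * a)))
      simp only [RingHom.comp_id, eval₂_id, coe_evalRingHom] at h4
      rw [h4]; simp
  have hdvd : (X - C ℓ) ∣ F := dvd_iff_isRoot.2 hroot
  have hass : Associated (X - C ℓ) F := (prime_X_sub_C ℓ).irreducible.associated_of_dvd hF hdvd
  refine ⟨b / a, y0 - b / a * x0, fun x y h => ?_⟩
  obtain ⟨G, hG⟩ := hass.symm.dvd
  have : evalEval x y (X - C ℓ) = 0 := by rw [hG, evalEval_mul, h, zero_mul]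
  simp [hℓ, evalEval_sub, evalEval_C] at this
  linarith

lemma energy_bound (Z Γ : Finset (ℕ × ℕ × ℕ)) (B : ℕ)
    (h : ∀ γ ∈ Γ, ∀ γ' ∈ Γ, γ ≠ γ' → ((Z ×ˢ Z).filter (fun x => x.1 + γ = x.2 + γ')).card ≤ B) :
    E[Z, Γ] ≤ Γ.card * Z.card + Γ.card ^ 2 * B := by
  classical
  have h1 : E[Z, Γ] = ∑ g ∈ Γ ×ˢ Γ, ((Z ×ˢ Z).filter (fun x => x.1 + g.1 = x.2 + g.2)).card := by
    simp only [addEnergy, card_filter]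
    rw [sum_product_right]
  rw [h1]
  calc _ ≤ ∑ g ∈ Γ ×ˢ Γ, ((if g.1 = g.2 then Z.card else 0) + B) := by
        apply sum_le_sum
        intro g hg
        rw [mem_product] at hg
        split_ifs with he
        · rw [he]
          have : ((Z ×ˢ Z).filter (fun x => x.1 + g.2 = x.2 + g.2)).card ≤ Z.card := by
            apply card_le_card_of_injOn Prod.fst
            · intro x hx; simp at hx; exact hx.1.1
            · intro x hx y hy hxy
              simp at hx hy
              ext1
              · exact hxy
              · rw [← hx.2, ← hy.2]; exact hxy
          omega
        · have := h g.1 hg.1 g.2 hg.2 he; omega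
    _ = _ := by
        rw [sum_add_distrib, sum_product]
        simp [card_product]
        left; ring

/-- zero estimate: reduces to a line -/
lemma line_lemma (p : (ℕ × ℕ × ℕ) →+ ℝ × ℝ) (S1 S2 S3 G1 G2 G3 d : ℕ)
    (hinj : Set.InjOn (fun s => (p s).1) ((range S1 ×ˢ range S2 ×ˢ range S3 : Finset _) : Set (ℕ × ℕ × ℕ)))
    (hG1 : G1 ≤ S1) (hG2 : G2 ≤ S2) (hG3 : G3 ≤ S3) (hGp : 0 < G1 * G2 * G3)
    (Δ : ℝ[X][X]) (hΔ : Δ ≠ 0) (htd : td Δ < d)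
    (hv : ∀ s ∈ range S1 ×ˢ range S2 ×ˢ range S3, evalEval (p s).1 (p s).2 Δ = 0)
    (hnum : ∀ z e : ℕ, 1 ≤ e → S1 * S2 * S3 * e ≤ z * d →
      (S1 + G1) * (S2 + G2) * (S3 + G3) * (z + G1 * G2 * G3 * e ^ 2) < z ^ 2 * (G1 * G2 * G3)) :
    ∃ ρ σ : ℝ, ∃ Z ⊆ range S1 ×ˢ range S2 ×ˢ range S3, (∀ s ∈ Z, (p s).2 = ρ * (p s).1 + σ) ∧
      S1 * S2 * S3 ≤ Z.card * d := by
  classical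
  set S := range S1 ×ˢ range S2 ×ˢ range S3 with hS
  have hcS : S.card = S1 * S2 * S3 := by simp [hS, card_product, mul_assoc]
  have hne : S.Nonempty := by
    rw [← card_pos, hcS]
    calc 0 < G1 * G2 * G3 := hGp
      _ ≤ _ := by gcongr
  obtain ⟨F, hF, Z, hZS, hZ, hZc⟩ := factor_pigeon S p d Δ hΔ htd hne hv
  have he := td_pos_of_irreducible hF
  set e := td F
  rw [hcS] at hZc
  set Γ := range G1 ×ˢ range G2 ×ˢ range G3 with hΓ
  have hcΓ : Γ.card = G1 * G2 * G3 := by simp [hΓ, card_product, mul_assoc]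
  have hΓS : Γ ⊆ S := by
    rw [hΓ, hS]
    gcongr
  by_cases hall : ∀ γ ∈ Γ, ∀ γ' ∈ Γ, γ ≠ γ' → ((Z ×ˢ Z).filter (fun x => x.1 + γ = x.2 + γ')).card ≤ e ^ 2
  · exfalso
    have h1 := energy_bound Z Γ (e ^ 2) hall
    have h2 := le_card_add_mul_addEnergy Z Γ
    have h3 : (Z + Γ).card ≤ (S1 + G1) * (S2 + G2) * (S3 + G3) := by
      calc (Z + Γ).card ≤ (range (S1 + G1) ×ˢ range (S2 + G2) ×ˢ range (S3 + G3)).card := by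
            apply card_le_card
            intro w hw
            obtain ⟨z, hz, γ, hγ, rfl⟩ := mem_add.1 hw
            have := hZS hz
            simp only [hS, hΓ, mem_product, mem_range, Prod.fst_add, Prod.snd_add] at *
            omega
        _ = _ := by simp [card_product, mul_assoc]
    have h4 := hnum Z.card e he hZc
    rw [hcΓ] at h1 h2
    have h5 : Z.card ^ 2 * (G1 * G2 * G3) ^ 2 ≤ (S1 + G1) * (S2 + G2) * (S3 + G3) *
        (G1 * G2 * G3 * Z.card + (G1 * G2 * G3) ^ 2 * e ^ 2) := h2.trans (Nat.mul_le_mul h3 h1)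
    generalize G1 * G2 * G3 = γ at *
    generalize (S1 + G1) * (S2 + G2) * (S3 + G3) = N at *
    have h6 := Nat.mul_lt_mul_of_pos_right h4 hGp
    have e1 : N * (γ * Z.card + γ ^ 2 * e ^ 2) = N * (Z.card + γ * e ^ 2) * γ := by ring
    have e2 : Z.card ^ 2 * γ ^ 2 = Z.card ^ 2 * γ * γ := by ring
    omega
  · push Not at hall
    obtain ⟨γ, hγ, γ', hγ', hne', hcard⟩ := hall
    set a := (p γ).1 - (p γ').1 with ha
    set b := (p γ).2 - (p γ').2 with hb
    have ha0 : a ≠ 0 := by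
      intro h
      apply hne'
      apply hinj (hΓS hγ) (hΓS hγ')
      simp only; linarith
    have hpx : ∀ x : (ℕ × ℕ × ℕ) × (ℕ × ℕ × ℕ), x.1 + γ = x.2 + γ' → (p x.1).1 + a = (p x.2).1 ∧ (p x.1).2 + b = (p x.2).2 := by
      intro x hx
      have := congrArg p hx
      rw [map_add, map_add] at this
      have h1 := congrArg Prod.fst this
      have h2 := congrArg Prod.snd this
      simp only [Prod.fst_add, Prod.snd_add] at h1 h2
      constructor <;> linarith
    have hdvd : F ∣ trl a b F := by
      by_contra hnd
      set W := ((Z ×ˢ Z).filter (fun x => x.1 + γ = x.2 + γ')) with hW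
      have hWinj : Set.InjOn (fun x : (ℕ × ℕ × ℕ) × (ℕ × ℕ × ℕ) => (p x.1).1) (W : Set _) := by
        intro x hx y hy hxy
        simp only [hW, coe_filter, mem_product, Set.mem_ofPred_eq] at hx hy
        have h1 : x.1 = y.1 := hinj (hZS hx.1.1) (hZS hy.1.1) hxy
        ext1
        · exact h1
        · have := hx.2; rw [h1, hy.2] at this
          exact (add_right_cancel this).symm
      have hb := bezout hF le_rfl (td_trans a b F) (natDegree_trans_le a b F) hnd
        (W.image (fun x => p x.1)) (by
          intro z hz
          obtain ⟨x, hx, rfl⟩ := mem_image.1 hz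
          simp only [hW, mem_filter, mem_product] at hx
          exact hZ _ hx.1.1) (by
          intro z hz
          obtain ⟨x, hx, rfl⟩ := mem_image.1 hz
          simp only [hW, mem_filter, mem_product] at hx
          rw [evalEval_trans, (hpx x hx.2).1, (hpx x hx.2).2]
          exact hZ _ hx.1.2) (by
          intro z hz z' hz' hzz
          simp only [coe_image, Set.mem_image] at hz hz'
          obtain ⟨x, hx, rfl⟩ := hz
          obtain ⟨y, hy, rfl⟩ := hz'
          rw [hWinj hx hy hzz])
      rw [card_image_of_injOn] at hb
      · exact absurd hb (not_le.2 hcard)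
      · intro x hx y hy hxy
        exact hWinj hx hy (congrArg Prod.fst hxy)
    have hZne : Z.Nonempty := by
      rw [nonempty_iff_ne_empty]
      rintro rfl
      simp at hcard
    obtain ⟨z, hz⟩ := hZne
    obtain ⟨ρ, σ, hl⟩ := line_of_dvd hF a b ha0 hdvd _ _ (hZ z hz)
    refine ⟨ρ, σ, Z, hZS, fun s hs => hl _ _ (hZ s hs), ?_⟩
    calc S1 * S2 * S3 = S1 * S2 * S3 * 1 := by ring
      _ ≤ S1 * S2 * S3 * e := by gcongr
      _ ≤ _ := hZc
end

section
open Finset Polynomial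

lemma coeff_prod_sum {R ι : Type*} [CommRing R] (s : Finset ι) (M : ι → R[X]) (f : ι → ℕ)
    (h : ∀ r ∈ s, (M r).natDegree ≤ f r) :
    (∏ r ∈ s, M r).coeff (∑ r ∈ s, f r) = ∏ r ∈ s, (M r).coeff (f r) := by
  classical
  induction s using Finset.induction_on with
  | empty => simp
  | insert a s ha ih =>
    rw [prod_insert ha, sum_insert ha, prod_insert ha, 
      coeff_mul_add_eq_of_natDegree_le (h a (mem_insert_self _ _)), ih (fun r hr => h r (mem_insert_of_mem hr))]
    refine (natDegree_prod_le _ _).trans (sum_le_sum fun r hr => h r (mem_insert_of_mem hr))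

lemma coeff_det_sum {R ι : Type*} [CommRing R] [Fintype ι] [DecidableEq ι] (M : Matrix ι ι R[X]) (f : ι → ℕ)
    (h : ∀ r c, (M r c).natDegree ≤ f r) :
    M.det.coeff (∑ r, f r) = (Matrix.of fun r c => (M r c).coeff (f r)).det := by
  rw [← Matrix.det_transpose, Matrix.det_apply, ← Matrix.det_transpose (Matrix.of _), Matrix.det_apply,
    finsetSum_coeff]
  apply sum_congr rfl
  intro σ _
  rw [coeff_smul]
  congr 1
  exact coeff_prod_sum univ (fun i => M i (σ i)) f (fun r _ => h r _)

lemma trl_eq_taylor (a b : ℝ) (F : ℝ[X][X]) :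
    trl a b F = taylor (C b) (F.map (taylorAlgHom a : ℝ[X] →+* ℝ[X])) := by
  rw [taylor_apply]
  simp only [trl, coe_eval₂RingHom, comp, eval₂_map]
  congr 1
  apply ringHom_ext <;> simp

lemma map_taylor_natDegree (a : ℝ) (F : ℝ[X][X]) :
    (F.map (taylorAlgHom a : ℝ[X] →+* ℝ[X])).natDegree = F.natDegree := by
  apply natDegree_map_eq_of_injective
  exact taylor_injective a

lemma trl_coeff (a b : ℝ) (F : ℝ[X][X]) : 
    (trl a b F).coeff F.natDegree = taylor a F.leadingCoeff := by
  have h := coeff_taylor_natDegree (C b) (F.map (taylorAlgHom a : ℝ[X] →+* ℝ[X]))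
  rw [map_taylor_natDegree] at h
  rw [trl_eq_taylor, h, leadingCoeff, map_taylor_natDegree, coeff_map]
  rfl

lemma gv (C : Finset ℕ) (K : ℕ) (hC : ∀ c ∈ C, c < K) {τ : Type*} (H : Finset τ) (η : τ → ℝ)
    (hinj : Set.InjOn η (H : Set τ)) (hK : K ≤ H.card) :
    ∃ e : C → H, (Matrix.of fun c r : C => η (e r) ^ (c:ℕ)).det ≠ 0 := by
  classical
  apply lemmaR (fun (c : C) (h : H) => η h ^ (c:ℕ))
  rw [Fintype.linearIndependent_iff]
  intro a ha
  set P : ℝ[X] := ∑ c : C, Polynomial.C (a c) * X ^ (c:ℕ) with hP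
  have hP0 : P = 0 := by
    by_contra hne
    have hsub : H.image η ⊆ P.roots.toFinset := by
      intro x hx
      obtain ⟨h, hh, rfl⟩ := mem_image.1 hx
      rw [Multiset.mem_toFinset, mem_roots hne, IsRoot.def, hP, eval_finsetSum]
      have := congrFun ha ⟨h, hh⟩
      simpa using this
    have h1 := card_le_card hsub
    rw [card_image_of_injOn hinj] at h1
    have h2 := (Multiset.toFinset_card_le P.roots).trans (card_roots' P)
    have h3 : P.natDegree ≤ K - 1 := by
      rw [hP]
      apply natDegree_sum_le_of_forall_le
      intro c _
      exact (natDegree_C_mul_X_pow_le _ _).trans (by have := hC c c.2; omega)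
    have hK0 : K = 0 := by omega
    apply hne
    rw [hP]
    apply sum_eq_zero
    intro c _
    have := hC c c.2; omega
  intro c
  have := congrArg (fun Q => Q.coeff (c:ℕ)) hP0
  simp only [hP, finsetSum_coeff, coeff_C_mul, coeff_X_pow, coeff_zero] at this
  rw [sum_eq_single c] at this
  · simpa using this
  · intro b _ hb
    have : (c:ℕ) ≠ b := fun h => hb (Subtype.ext h.symm)
    simp [this]
  · simp

lemma elim_lemma (p : (ℕ × ℕ × ℕ) →+ ℝ × ℝ) (θ : ℕ × ℕ × ℕ → ℝ) (hθ0 : ∀ s, θ s ≠ 0)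
    (hθ : ∀ s s', θ (s + s') = θ s * θ s') (K D : ℕ) (q : ℕ → ℝ[X][X])
    (hq : ∃ c < K, q c ≠ 0) (htd : ∀ c < K, td (q c) ≤ D) (S H : Finset (ℕ × ℕ × ℕ))
    (hH : Set.InjOn θ (H : Set (ℕ × ℕ × ℕ))) (hK : K ≤ H.card)
    (hv : ∀ s ∈ S, ∀ h ∈ H, ∑ c ∈ range K, evalEval (p (s + h)).1 (p (s + h)).2 (q c) * θ (s + h) ^ c = 0) :
    ∃ Δ : ℝ[X][X], Δ ≠ 0 ∧ td Δ ≤ D * K ∧ (∀ s ∈ S, evalEval (p s).1 (p s).2 Δ = 0) ∧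
      ((∀ c < K, (q c).natDegree = 0) → Δ.natDegree = 0) := by
  classical
  set Cc := (range K).filter (fun c => q c ≠ 0) with hCc
  have hCK : ∀ c ∈ Cc, c < K := fun c hc => mem_range.1 (mem_filter.1 hc).1
  have hC0 : ∀ c : Cc, q c ≠ 0 := fun c => (mem_filter.1 c.2).2
  obtain ⟨e, he⟩ := gv Cc K hCK H θ hH hK
  let M : Matrix Cc Cc ℝ[X][X] := Matrix.of fun c r =>
    C (C (θ (e r) ^ (c:ℕ))) * trl (p (e r)).1 (p (e r)).2 (q c)
  have hMdeg : ∀ r c, (M r c).natDegree ≤ (q r).natDegree := by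
    intro r c
    exact (natDegree_C_mul_le _ _).trans (natDegree_trans_le _ _ _)
  have hcoef : ∀ r c, (M r c).coeff (q r).natDegree =
      C (θ (e c) ^ (r:ℕ)) * taylor (p (e c)).1 (q r).leadingCoeff := by
    intro r c
    show (C (C (θ (e c) ^ (r:ℕ))) * trl _ _ (q r)).coeff _ = _
    rw [coeff_C_mul, trl_coeff]
  refine ⟨M.det, ?_, ?_, ?_, ?_⟩
  · intro h0
    have h1 := coeff_det_sum M (fun r => (q r).natDegree) hMdeg
    rw [h0, coeff_zero] at h1
    have h2 := coeff_det_sum (Matrix.of fun r c => (M r c).coeff (q r).natDegree)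
      (fun r => (q r).leadingCoeff.natDegree) (by
        intro r c
        rw [Matrix.of_apply, hcoef]
        refine (natDegree_C_mul_le _ _).trans ?_
        rw [natDegree_taylor])
    rw [← h1, coeff_zero] at h2
    have h3 : (Matrix.of fun r c => ((Matrix.of fun r c => (M r c).coeff (q r).natDegree) r c).coeff
        (q r).leadingCoeff.natDegree) = Matrix.of fun (r c : Cc) => (q r).leadingCoeff.leadingCoeff *
          (Matrix.of fun c r : Cc => θ (e r) ^ (c:ℕ)) r c := by
      ext r c
      simp only [Matrix.of_apply]
      rw [hcoef, coeff_C_mul, coeff_taylor_natDegree, mul_comm]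
    rw [h3, Matrix.det_mul_column] at h2
    rcases mul_eq_zero.1 h2.symm with h4 | h4
    · obtain ⟨r, _, hr⟩ := prod_eq_zero_iff.1 h4
      rw [leadingCoeff_eq_zero, leadingCoeff_eq_zero] at hr
      exact hC0 r hr
    · exact he h4
  · have h3 := RingHom.map_det (S := ℝ[X][X][X]) phiT M
    refine (congrArg natDegree h3).le.trans ?_
    refine (det_natDegree _ (fun _ => 0) (fun _ => D) ?_).trans ?_
    · intro r c _
      simp only [RingHom.mapMatrix_apply, Matrix.map_apply, M, Matrix.of_apply, map_mul, phiT_C_C, add_zero]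
      exact (natDegree_C_mul_le _ _).trans ((td_trans _ _ _).trans (htd r (hCK r r.2)))
    · simp only [sum_const, card_univ, smul_eq_mul, mul_zero, tsub_zero, Fintype.card_coe]
      rw [mul_comm]
      gcongr
      calc Cc.card ≤ (range K).card := card_filter_le _ _
        _ = K := card_range K
  · intro s hs
    have h3 := RingHom.map_det (evalEvalRingHom (p s).1 (p s).2) M
    rw [coe_evalEvalRingHom] at h3
    rw [h3]
    rw [← Matrix.exists_vecMul_eq_zero_iff]
    refine ⟨fun c => θ s ^ (c:ℕ), ?_, ?_⟩
    · intro h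
      obtain ⟨c, hc, hqc⟩ := hq
      have := congrFun h ⟨c, mem_filter.2 ⟨mem_range.2 hc, hqc⟩⟩
      simp [hθ0 s] at this
    · funext r
      have h4 := hv s hs (e r) (e r).2
      simp only [Matrix.vecMul, dotProduct, RingHom.mapMatrix_apply, Matrix.map_apply, Pi.zero_apply, M,
        Matrix.of_apply, coe_evalEvalRingHom, evalEval_mul, evalEval_trans, evalEval_C, eval_C]
      rw [Finset.sum_coe_sort Cc (fun c => θ s ^ c * (θ (e r) ^ c *
        evalEval ((p s).1 + (p (e r)).1) ((p s).2 + (p (e r)).2) (q c)))]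
      rw [← h4, hCc, sum_filter]
      apply sum_congr rfl
      intro c _
      rw [map_add, hθ, mul_pow, Prod.fst_add, Prod.snd_add]
      split_ifs with h5
      · ring
      · push Not at h5
        rw [h5]; simp
  · intro h
    refine Nat.le_zero.1 ((det_natDegree M (fun _ => 0) (fun _ => 0) ?_).trans (by simp))
    intro r c _
    have := hMdeg r c
    rw [h r (hCK r r.2)] at this
    omega
end

section
open Finset

lemma binom_ext (i D : ℕ) (hi : i ≤ D) (x y : ℝ) :
    (x + y) ^ i = ∑ u ∈ range (D + 1), (i.choose u : ℝ) * x ^ u * y ^ (i - u) := by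
  rw [add_pow]
  have hsub : range (i + 1) ⊆ range (D + 1) := by intro a; simp; omega
  rw [← sum_subset hsub]
  · apply sum_congr rfl; intro u _; ring
  · intro u _ hu
    simp at hu
    rw [Nat.choose_eq_zero_of_lt (by omega)]; simp

lemma analytic {ι : Type*} [Fintype ι] [DecidableEq ι] (J n D K : ℕ) (hc : Fintype.card ι = J * n)
    (ri rj rc : ι → ℕ) (hD : ∀ r, ri r + rj r ≤ D) (hK : ∀ r, rc r ≤ K)
    (A B ρ w0 : ℝ) (hJ : (∀ r, ri r + rj r < J) ∨ (B = 0 ∧ 1 ≤ J ∧ J = 1 ∧ ∀ r, rj r = 0))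
    (x y z θ δ : ι → ℝ) (hx : ∀ s, x s = A * z s + B * y s)
    (hθ : ∀ s, θ s = Real.exp (ρ * z s + w0 + δ s))
    (E : ℝ) (hE : 1 ≤ E) (Zb Yb maj Wt : ℝ) (hz : ∀ s, |z s| ≤ Zb) (hy : ∀ s, |y s| ≤ Yb)
    (hmaj1 : 1 ≤ maj) (hmajY : Yb ≤ maj) (hmaj : |A| * (E * Zb) + |B| * Yb ≤ maj)
    (hWt : E * |ρ| * Zb + |w0| ≤ Wt) (hδ : ∀ s, 2 * (K * |δ s|) ≤ (1 / E) ^ n) :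
    |(Matrix.of fun r s => x s ^ ri r * y s ^ rj r * θ s ^ rc r : Matrix ι ι ℝ).det| ≤
      (Fintype.card ι).factorial * ((1 / E) ^ (J * (n * (n - 1) / 2)) *
        (4 * (maj ^ D * Real.exp (K * Wt))) ^ (Fintype.card ι)) := by
  by_cases hemp : Nonempty ι
  swap
  · have : IsEmpty ι := not_nonempty_iff.1 hemp
    have h0 : Fintype.card ι = 0 := Fintype.card_eq_zero
    rw [h0] at hc
    rw [Matrix.det_isEmpty, h0]
    simp
    rcases mul_eq_zero.1 hc.symm with h | h <;> simp [h]
  obtain ⟨s0⟩ := hemp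
  have hE0 : 0 < E := by linarith
  have hZ0 : 0 ≤ Zb := (abs_nonneg _).trans (hz s0)
  have hY0 : 0 ≤ Yb := (abs_nonneg _).trans (hy s0)
  have hm0 : 0 ≤ maj := by linarith
  have hxm : ∀ s, |x s| ≤ maj := by
    intro s
    rw [hx]
    calc |A * z s + B * y s| ≤ |A * z s| + |B * y s| := abs_add_le _ _
      _ = |A| * |z s| + |B| * |y s| := by rw [abs_mul, abs_mul]
      _ ≤ |A| * (E * Zb) + |B| * Yb := by
        gcongr
        · calc |z s| ≤ 1 * Zb := by rw [one_mul]; exact hz s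
            _ ≤ E * Zb := by gcongr
        · exact hy s
      _ ≤ maj := hmaj
  have hexpW : ∀ r, Real.exp (rc r * |w0|) * Real.exp (E * (rc r * |ρ| * Zb)) ≤ Real.exp (K * Wt) := by
    intro r
    rw [← Real.exp_add]
    apply Real.exp_le_exp.2
    have h1 : (rc r : ℝ) ≤ K := by exact_mod_cast hK r
    calc (rc r : ℝ) * |w0| + E * (rc r * |ρ| * Zb) = rc r * (E * |ρ| * Zb + |w0|) := by ring
      _ ≤ K * (E * |ρ| * Zb + |w0|) := by gcongr
      _ ≤ K * Wt := by gcongr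
  have hmain := lemmaA (ι := ι) (κ := ℕ × Fin J) (𝒯 := Fin (D + 1) × Fin n) J n hc
    (Matrix.of fun r s => x s ^ ri r * y s ^ rj r * θ s ^ rc r)
    (fun r τ => ((ri r).choose τ.1 : ℝ) * A ^ (τ.1:ℕ) * B ^ (ri r - τ.1) *
      (Real.exp (rc r * w0) * ((rc r * ρ) ^ (τ.2:ℕ) / (τ.2:ℕ).factorial)))
    (fun r τ => (τ.1 + τ.2, ⟨(ri r - τ.1 + rj r) % J, Nat.mod_lt _ (by
      rcases hJ with h | h
      · have := h r; omega
      · omega)⟩))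
    (fun k s => z s ^ k.1 * y s ^ (k.2:ℕ)) (fun k => k.1)
    (fun r s => x s ^ ri r * y s ^ rj r * (θ s ^ rc r - Real.exp (rc r * w0) *
      ∑ q ∈ range n, (rc r * ρ * z s) ^ q / q.factorial))
    (1 / E) (by positivity) (by rw [div_le_one hE0]; exact hE)
    (by
      intro r s
      simp only [Matrix.of_apply]
      have h1 : ∀ τ : Fin (D + 1) × Fin n, ((ri r).choose τ.1 : ℝ) * A ^ (τ.1:ℕ) * B ^ (ri r - τ.1) *
          (Real.exp (rc r * w0) * ((rc r * ρ) ^ (τ.2:ℕ) / (τ.2:ℕ).factorial)) *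
          (z s ^ (τ.1 + τ.2 : ℕ) * y s ^ ((ri r - τ.1 + rj r) % J)) =
          (((ri r).choose τ.1 : ℝ) * (A * z s) ^ (τ.1:ℕ) * (B * y s) ^ (ri r - τ.1)) * (y s ^ rj r *
          Real.exp (rc r * w0) * ((rc r * ρ * z s) ^ (τ.2:ℕ) / (τ.2:ℕ).factorial)) := by
        intro τ
        have h2 : ((ri r).choose τ.1 : ℝ) * B ^ (ri r - τ.1) * y s ^ ((ri r - τ.1 + rj r) % J) =
            ((ri r).choose τ.1 : ℝ) * B ^ (ri r - τ.1) * y s ^ (ri r - τ.1 + rj r) := by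
          rcases hJ with h | ⟨hB, _, hJ1, hj⟩
          · rw [Nat.mod_eq_of_lt]; have := h r; omega
          · by_cases hu : ri r - τ.1 = 0
            · simp [hu, hj r]
            · rw [hB, zero_pow hu]; simp
        rw [mul_pow, mul_pow, mul_pow _ (z s), pow_add]
        calc _ = ((ri r).choose τ.1 * B ^ (ri r - τ.1) * y s ^ ((ri r - τ.1 + rj r) % J)) *
              (A ^ (τ.1:ℕ) * (Real.exp (rc r * w0) * ((rc r * ρ) ^ (τ.2:ℕ) / (τ.2:ℕ).factorial)) *
              (z s ^ (τ.1:ℕ) * z s ^ (τ.2 : ℕ))) := by ring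
          _ = _ := by rw [h2, pow_add]; ring
      rw [Finset.sum_congr rfl (fun τ _ => h1 τ), Fintype.sum_prod_type]
      simp only
      simp_rw [← mul_sum, ← sum_mul]
      rw [Fin.sum_univ_eq_sum_range (fun u => ((ri r).choose u : ℝ) * (A * z s) ^ u * (B * y s) ^ (ri r - u)),
        ← binom_ext (ri r) D (by have := hD r; omega), ← hx,
        Fin.sum_univ_eq_sum_range (fun q => (rc r * ρ * z s) ^ q / (q.factorial : ℝ))]
      ring)
    (fun r τ => (((ri r).choose τ.1 : ℝ) * (|A| * (E * Zb)) ^ (τ.1:ℕ) * (|B| * Yb) ^ (ri r - τ.1)) *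
      (Yb ^ rj r * Real.exp (rc r * |w0|) * ((rc r * |ρ| * (E * Zb)) ^ (τ.2:ℕ) / (τ.2:ℕ).factorial)))
    (fun r => 2 * (maj ^ D * Real.exp (K * Wt)))
    (fun r τ => by positivity)
    (by
      intro r τ s
      simp only
      by_cases hB : ri r - τ.1 ≠ 0 ∧ B = 0
      · rw [hB.2, zero_pow hB.1]; simp
        positivity
      have h2 : y s ^ ((ri r - τ.1 + rj r) % J) = y s ^ (ri r - τ.1 + rj r) := by
          rcases hJ with h | ⟨hB', _, hJ1, hj⟩
          · rw [Nat.mod_eq_of_lt]; have := h r; omega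
          · have hu : ri r - τ.1 = 0 := by tauto
            simp [hu, hj r]
      rw [h2]
      simp only [abs_mul, abs_pow, abs_div, Nat.abs_cast, Real.abs_exp]
      have e1 : Real.exp (rc r * w0) ≤ Real.exp (rc r * |w0|) := by
        apply Real.exp_le_exp.2; gcongr; exact le_abs_self _
      have e2 := hz s
      have e3 := hy s
      calc _ ≤ ((ri r).choose τ.1 : ℝ) * |A| ^ (τ.1:ℕ) * |B| ^ (ri r - τ.1) *
          (Real.exp (rc r * |w0|) * ((rc r * |ρ|) ^ (τ.2:ℕ) / (τ.2:ℕ).factorial)) *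
          (Zb ^ (τ.1 + τ.2 : ℕ) * Yb ^ (ri r - τ.1 + rj r)) := by gcongr
        _ = _ := by
          rw [one_div, inv_pow, eq_inv_mul_iff_mul_eq₀ (by positivity)]
          simp only [mul_pow, pow_add]
          ring)
    (by
      intro r
      rw [Fintype.sum_prod_type]
      simp only
      simp_rw [← mul_sum, ← sum_mul]
      rw [Fin.sum_univ_eq_sum_range (fun u => ((ri r).choose u : ℝ) * (|A| * (E * Zb)) ^ u * (|B| * Yb) ^ (ri r - u)),
        ← binom_ext (ri r) D (by have := hD r; omega),
        Fin.sum_univ_eq_sum_range (fun q => (rc r * |ρ| * (E * Zb)) ^ q / (q.factorial : ℝ))]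
      have h1 := Real.sum_le_exp_of_nonneg (x := rc r * |ρ| * (E * Zb)) (by positivity) n
      have h3 : (|A| * (E * Zb) + |B| * Yb) ^ ri r * Yb ^ rj r ≤ maj ^ D := by
        calc _ ≤ maj ^ ri r * maj ^ rj r := by gcongr
          _ = maj ^ (ri r + rj r) := by rw [pow_add]
          _ ≤ maj ^ D := pow_le_pow_right₀ hmaj1 (hD r)
      calc _ = ((|A| * (E * Zb) + |B| * Yb) ^ ri r * Yb ^ rj r) * (Real.exp (rc r * |w0|) *
            ∑ q ∈ range n, (rc r * |ρ| * (E * Zb)) ^ q / (q.factorial : ℝ)) := by ring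
        _ ≤ maj ^ D * (Real.exp (rc r * |w0|) * Real.exp (rc r * |ρ| * (E * Zb))) := by gcongr
        _ ≤ maj ^ D * Real.exp (K * Wt) := by
          gcongr
          refine le_trans (le_of_eq ?_) (hexpW r)
          congr 2; ring
        _ ≤ _ := by
          have : 0 ≤ maj ^ D * Real.exp (K * Wt) := by positivity
          linarith)
    (by
      intro r s
      simp only [abs_mul, abs_pow]
      have hxy : |x s| ^ ri r * |y s| ^ rj r ≤ maj ^ D := by
        calc _ ≤ maj ^ ri r * maj ^ rj r := by
              gcongr
              · exact hxm s
              · exact (hy s).trans hmajY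
          _ = maj ^ (ri r + rj r) := by rw [pow_add]
          _ ≤ maj ^ D := pow_le_pow_right₀ hmaj1 (hD r)
      have hrK : (rc r : ℝ) ≤ K := by exact_mod_cast hK r
      have hq1 : (1 / E) ^ n ≤ 1 := pow_le_one₀ (by positivity) (by rw [div_le_one hE0]; exact hE)
      have hrd : 2 * |rc r * δ s| ≤ (1 / E) ^ n := by
        rw [abs_mul, Nat.abs_cast]
        refine le_trans ?_ (hδ s)
        gcongr
      have h1 : θ s ^ rc r = Real.exp (rc r * w0) * Real.exp (rc r * ρ * z s) * Real.exp (rc r * δ s) := by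
        rw [hθ, ← Real.exp_nat_mul, ← Real.exp_add, ← Real.exp_add]; congr 1; ring
      have h2 : θ s ^ rc r - Real.exp (rc r * w0) * ∑ q ∈ range n, (rc r * ρ * z s) ^ q / q.factorial
          = Real.exp (rc r * w0) * (Real.exp (rc r * ρ * z s) * (Real.exp (rc r * δ s) - 1) +
          (Real.exp (rc r * ρ * z s) - ∑ q ∈ range n, (rc r * ρ * z s) ^ q / q.factorial)) := by
        rw [h1]; ring
      have h3 := exp_tail (rc r * ρ * z s) E hE n
      have h4 : |Real.exp (rc r * δ s) - 1| ≤ (1 / E) ^ n := 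
        (Real.abs_exp_sub_one_le (by linarith)).trans hrd
      have e1 : Real.exp (rc r * w0) ≤ Real.exp (rc r * |w0|) := by
        apply Real.exp_le_exp.2; gcongr; exact le_abs_self _
      have hzz : |rc r * ρ * z s| ≤ rc r * |ρ| * Zb := by
        rw [abs_mul, abs_mul, Nat.abs_cast]; gcongr; exact hz s
      have e2 : Real.exp (E * |rc r * ρ * z s|) ≤ Real.exp (E * (rc r * |ρ| * Zb)) := by
        apply Real.exp_le_exp.2; gcongr
      have e3 : Real.exp (rc r * ρ * z s) ≤ Real.exp (E * (rc r * |ρ| * Zb)) := by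
        apply Real.exp_le_exp.2
        calc _ ≤ 1 * (rc r * |ρ| * Zb) := by rw [one_mul]; exact (le_abs_self _).trans hzz
          _ ≤ _ := by gcongr
      have h5 : |θ s ^ rc r - Real.exp (rc r * w0) * ∑ q ∈ range n, (rc r * ρ * z s) ^ q / q.factorial| ≤
          2 * ((1 / E) ^ n * Real.exp (K * Wt)) := by
        rw [h2, abs_mul, Real.abs_exp]
        calc _ ≤ Real.exp (rc r * |w0|) * (Real.exp (E * (rc r * |ρ| * Zb)) * (1 / E) ^ n +
              (1 / E) ^ n * Real.exp (E * (rc r * |ρ| * Zb))) := by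
              gcongr
              refine (abs_add_le _ _).trans ?_
              rw [abs_mul, Real.abs_exp]
              gcongr
              refine h3.trans ?_
              gcongr
          _ = 2 * ((1 / E) ^ n * (Real.exp (rc r * |w0|) * Real.exp (E * (rc r * |ρ| * Zb)))) := by ring
          _ ≤ _ := by
            gcongr
            exact hexpW r
      calc _ ≤ maj ^ D * (2 * ((1 / E) ^ n * Real.exp (K * Wt))) := by gcongr
        _ = _ := by ring)
    (by
      intro h S hS
      calc S.card ≤ (range h ×ˢ (univ : Finset (Fin J))).card := by
            apply card_le_card
            intro k hk
            simp [hS k hk]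
        _ = J * h := by simp [card_product, mul_comm])
  refine hmain.trans (le_of_eq ?_)
  rw [prod_const, card_univ]
  ring
end

section
open Finset Polynomial

noncomputable def theta (g : ℕ) (υ : ℝ) (s : ℕ × ℕ × ℕ) : ℝ := αr ^ s.1 * (g:ℝ) ^ s.2.1 * υ ^ s.2.2

lemma theta_add (g : ℕ) (υ : ℝ) (s s' : ℕ × ℕ × ℕ) : theta g υ (s + s') = theta g υ s * theta g υ s' := by
  simp only [theta, Prod.fst_add, Prod.snd_add, pow_add]; ring

lemma theta_pos (g : ℕ) (hg : 2 ≤ g) (υ : ℝ) (hυ : 0 < υ) (s : ℕ × ℕ × ℕ) : 0 < theta g υ s := by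
  have := αr_pos
  have : (0:ℝ) < g := by exact_mod_cast (by omega : 0 < g)
  unfold theta; positivity

lemma arith {ι : Type*} [Fintype ι] [DecidableEq ι] (g u1 u2 : ℕ) (hg : 2 ≤ g) (hu1 : 1 ≤ u1) (hu2 : 1 ≤ u2)
    (υ : ℝ) (hυ : υ * u1 = (3 * αr - 2) * u2) (K S2 S3 : ℕ) (A : ℝ) (hA : 1 ≤ A)
    (a : ι → ι → ℤ) (ha : ∀ r j, |(a r j : ℝ)| ≤ A) (c : ι → ℕ) (hc : ∀ r, c r ≤ K)
    (pt : ι → ℕ × ℕ × ℕ) (h2 : ∀ j, (pt j).2.1 ≤ S2) (h3 : ∀ j, (pt j).2.2 ≤ S3)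
    (hdet : (Matrix.of fun r j => (a r j : ℝ) * theta g υ (pt j) ^ c r : Matrix ι ι ℝ).det ≠ 0) :
    1 ≤ |(Matrix.of fun r j => (a r j : ℝ) * theta g υ (pt j) ^ c r : Matrix ι ι ℝ).det| *
      ((Fintype.card ι).factorial ^ 2 * ((u1:ℝ) ^ (3 * (K * S3)) * A ^ 2 * (g:ℝ) ^ (2 * (K * S2)) *
        (4.5 * u2) ^ (2 * (K * S3))) ^ Fintype.card ι) := by
  set L := Fintype.card ι
  have hu1' : (1:ℝ) ≤ u1 := by exact_mod_cast hu1
  have hu2' : (1:ℝ) ≤ u2 := by exact_mod_cast hu2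
  have hg' : (1:ℝ) ≤ g := by exact_mod_cast (by omega : 1 ≤ g)
  let Mz : Matrix ι ι ℤ[X] := Matrix.of fun r j =>
    C (a r j) * (C (g:ℤ)) ^ (c r * (pt j).2.1) * (C (u2:ℤ)) ^ (c r * (pt j).2.2) *
      (C (u1:ℤ)) ^ ((K - c r) * (pt j).2.2) * X ^ (c r * (pt j).1) * (3 * X - 2) ^ (c r * (pt j).2.2)
  set M : Matrix ι ι ℝ := Matrix.of fun r j => (a r j : ℝ) * theta g υ (pt j) ^ c r with hM
  have hα : aeval αr Mz.det = (∏ j, (u1:ℝ) ^ (K * (pt j).2.2)) * M.det := by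
    have h0 := AlgHom.map_det (aeval αr) Mz
    rw [h0, ← Matrix.det_mul_row]
    congr 1
    ext r j
    simp only [Mz, hM, AlgHom.mapMatrix_apply, Matrix.map_apply, Matrix.of_apply, map_mul, map_pow, aeval_C,
      aeval_X, map_sub, theta, mul_pow, map_natCast, map_intCast, map_ofNat, eq_intCast]
    have e1 : (u1:ℝ) ^ (K * (pt j).2.2) = (u1:ℝ) ^ ((K - c r) * (pt j).2.2) * (u1:ℝ) ^ (c r * (pt j).2.2) := by
      rw [← pow_add, ← add_mul, Nat.sub_add_cancel (hc r)]
    have e2 : (u1:ℝ) ^ (c r * (pt j).2.2) * (υ ^ (pt j).2.2) ^ c r = (3 * αr - 2) ^ (c r * (pt j).2.2) * (u2:ℝ) ^ (c r * (pt j).2.2) := by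
      rw [← pow_mul, mul_comm (pt j).2.2, ← mul_pow, ← mul_pow, mul_comm _ υ, hυ]
    rw [e1]
    push_cast
    calc _ = (a r j : ℝ) * ((αr ^ (pt j).1) ^ c r * ((g:ℝ) ^ (pt j).2.1) ^ c r) * (u1:ℝ) ^ ((K - c r) * (pt j).2.2) *
          ((3 * αr - 2) ^ (c r * (pt j).2.2) * (u2:ℝ) ^ (c r * (pt j).2.2)) := by
            rw [← pow_mul, ← pow_mul, mul_comm (pt j).1, mul_comm (pt j).2.1]; ring
      _ = _ := by rw [← e2]; ring
  have hprodpos : 0 < ∏ j, (u1:ℝ) ^ (K * (pt j).2.2) := prod_pos fun j _ => by positivity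
  have hne : aeval αr Mz.det ≠ 0 := by
    rw [hα]; exact mul_ne_zero hprodpos.ne' hdet
  have h1 := lemmaN Mz.det hne
  have hprod : ∏ j, (u1:ℝ) ^ (K * (pt j).2.2) ≤ ((u1:ℝ) ^ (K * S3)) ^ L := by
    calc _ ≤ ∏ j : ι, (u1:ℝ) ^ (K * S3) := by
          apply prod_le_prod
          · intro j _; positivity
          · intro j _; exact pow_le_pow_right₀ hu1' (Nat.mul_le_mul_left _ (h3 j))
      _ = _ := by rw [prod_const, card_univ]
  have hβ : ‖aeval βc Mz.det‖ ≤ L.factorial * (A * (g:ℝ) ^ (K * S2) * (4.5 * u2) ^ (K * S3) * (u1:ℝ) ^ (K * S3)) ^ L := by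
    have h0 := AlgHom.map_det (aeval βc) Mz
    rw [h0]
    refine (det_norm_le _ (fun _ => A * (g:ℝ) ^ (K * S2) * (4.5 * u2) ^ (K * S3) * (u1:ℝ) ^ (K * S3)) ?_).trans ?_
    · intro r j
      simp only [Mz, AlgHom.mapMatrix_apply, Matrix.map_apply, Matrix.of_apply, map_mul, map_pow, aeval_C,
        aeval_X, map_sub, map_natCast, map_intCast, map_ofNat, eq_intCast, norm_mul, norm_pow]
      have n1 : ‖((a r j : ℤ) : ℂ)‖ ≤ A := by
        rw [Complex.norm_intCast]; exact ha r j
      have n2 : ‖βc‖ ^ (c r * (pt j).1) ≤ 1 := pow_le_one₀ (norm_nonneg _) βc_norm_lt.le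
      have n3 : ‖3 * βc - 2‖ ^ (c r * (pt j).2.2) ≤ 4.5 ^ (c r * (pt j).2.2) := by
        gcongr; exact βc_norm3
      have c2 : c r * (pt j).2.2 ≤ K * S3 := Nat.mul_le_mul (hc r) (h3 j)
      have c1 : c r * (pt j).2.1 ≤ K * S2 := Nat.mul_le_mul (hc r) (h2 j)
      have c3 : (K - c r) * (pt j).2.2 ≤ K * S3 := Nat.mul_le_mul (Nat.sub_le _ _) (h3 j)
      push_cast
      rw [Complex.norm_natCast, Complex.norm_natCast, Complex.norm_natCast]
      calc _ ≤ A * (g:ℝ) ^ (c r * (pt j).2.1) * (u2:ℝ) ^ (c r * (pt j).2.2) * (u1:ℝ) ^ ((K - c r) * (pt j).2.2) * 1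
            * 4.5 ^ (c r * (pt j).2.2) := by gcongr
        _ = A * (g:ℝ) ^ (c r * (pt j).2.1) * (4.5 * u2:ℝ) ^ (c r * (pt j).2.2) * (u1:ℝ) ^ ((K - c r) * (pt j).2.2) := by
            rw [mul_pow]; ring
        _ ≤ _ := by
            gcongr
            linarith
    · rw [prod_const, card_univ]
  rw [hα, abs_mul, abs_of_pos hprodpos] at h1
  refine h1.trans ?_
  calc _ ≤ ((u1:ℝ) ^ (K * S3)) ^ L * |M.det| * (L.factorial * (A * (g:ℝ) ^ (K * S2) * (4.5 * u2) ^ (K * S3) * (u1:ℝ) ^ (K * S3)) ^ L) ^ 2 := by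
        gcongr
    _ = _ := by
        have e1 : (u1:ℝ) ^ (3 * (K * S3)) = ((u1:ℝ) ^ (K * S3)) ^ 3 := by rw [← pow_mul]; congr 1; ring
        have e2 : (g:ℝ) ^ (2 * (K * S2)) = ((g:ℝ) ^ (K * S2)) ^ 2 := by rw [← pow_mul]; congr 1; ring
        have e3 : (4.5 * u2:ℝ) ^ (2 * (K * S3)) = ((4.5 * u2:ℝ) ^ (K * S3)) ^ 2 := by rw [← pow_mul]; congr 1; ring
        rw [e1, e2, e3]
        simp only [mul_pow, ← pow_mul]
        ring
end

section
open Finset Polynomial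

lemma trl_ne (a b : ℝ) (F : ℝ[X][X]) (h : F ≠ 0) : trl a b F ≠ 0 := by
  intro h0
  have h1 := trl_coeff a b F
  rw [h0, coeff_zero] at h1
  have h2 : taylor a F.leadingCoeff = taylor a 0 := by rw [← h1]; simp
  exact h (leadingCoeff_eq_zero.1 (taylor_injective a h2))

lemma dep_rows {τ P : Type*} [DecidableEq τ] (T : Finset τ) (M : τ → P → ℝ)
    (h : ∀ e : T → P, (Matrix.of fun (r s : T) => M r (e s)).det = 0) :
    ∃ f : τ → ℝ, (∃ r ∈ T, f r ≠ 0) ∧ ∀ p, ∑ r ∈ T, f r * M r p = 0 := by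
  have hn : ¬ LinearIndependent ℝ (fun r : T => M r) := by
    intro hli
    obtain ⟨e, he⟩ := lemmaR (fun r : T => M r) hli
    exact he (h e)
  rw [Fintype.not_linearIndependent_iff] at hn
  obtain ⟨f, hf, r, hr⟩ := hn
  refine ⟨fun t => if ht : t ∈ T then f ⟨t, ht⟩ else 0, ⟨r, r.2, by simpa using hr⟩, fun p => ?_⟩
  have := congrFun hf p
  rw [← Finset.sum_coe_sort]
  simpa using this

lemma step (p : (ℕ × ℕ × ℕ) →+ ℝ × ℝ) (θ : ℕ × ℕ × ℕ → ℝ) (hθ0 : ∀ s, θ s ≠ 0)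
    (hθ : ∀ s s', θ (s + s') = θ s * θ s') (K D : ℕ) (X0 : ℝ) (T : Finset (ℕ × ℕ × ℕ))
    (hT : ∀ r ∈ T, r.1 + r.2.1 ≤ D ∧ r.2.2 < K) (S H B : Finset (ℕ × ℕ × ℕ))
    (hSH : ∀ s ∈ S, ∀ h ∈ H, s + h ∈ B)
    (hH : Set.InjOn θ (H : Set (ℕ × ℕ × ℕ))) (hK : K ≤ H.card)
    (hdet : ∀ e : T → B, (Matrix.of fun (r s : T) =>
      ((p (e s)).1 - X0) ^ r.1.1 * (p (e s)).2 ^ r.1.2.1 * θ (e s) ^ r.1.2.2).det = 0) :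
    ∃ Δ : ℝ[X][X], Δ ≠ 0 ∧ td Δ ≤ D * K ∧ (∀ s ∈ S, evalEval (p s).1 (p s).2 Δ = 0) ∧
      ((∀ r ∈ T, r.2.1 = 0) → Δ.natDegree = 0) := by
  classical
  obtain ⟨f, ⟨r0, hr0, hf0⟩, hf⟩ := dep_rows T (fun r (b : B) =>
    ((p b).1 - X0) ^ r.1 * (p b).2 ^ r.2.1 * θ b ^ r.2.2) hdet
  let q0 : ℕ → ℝ[X][X] := fun c => ∑ r ∈ T with r.2.2 = c, monomial r.2.1 (monomial r.1 (f r))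
  have hco : ∀ c i j, ((q0 c).coeff j).coeff i = if (i, j, c) ∈ T then f (i, j, c) else 0 := by
    intro c i j
    simp only [q0, finsetSum_coeff, coeff_monomial]
    have : ∀ r ∈ T.filter (fun r => r.2.2 = c), (if r.2.1 = j then monomial r.1 (f r) else 0 : ℝ[X]).coeff i =
        if r = (i, j, c) then f (i, j, c) else 0 := by
      rintro ⟨i', j', c'⟩ hr
      simp only [mem_filter] at hr
      obtain ⟨_, rfl⟩ := hr
      by_cases hj : j' = j
      · subst hj
        by_cases hi : i' = i
        · subst hi; simp
        · simp [hi, coeff_monomial]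
      · simp [hj]
    rw [sum_congr rfl this, sum_ite_eq']
    simp
  obtain ⟨Δ, h1, h2, h3, h4⟩ := elim_lemma p θ hθ0 hθ K D (fun c => trl (-X0) 0 (q0 c))
    ⟨r0.2.2, (hT r0 hr0).2, trl_ne _ _ _ (by
      intro h0
      have := hco r0.2.2 r0.1 r0.2.1
      rw [h0] at this
      simp only [coeff_zero, Prod.mk.eta, if_pos hr0] at this
      exact hf0 this.symm)⟩
    (by
      intro c hc
      refine (td_trans _ _ _).trans (td_le ?_)
      intro i j hij
      rw [hco] at hij
      by_cases hm : (i, j, c) ∈ T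
      · exact (hT _ hm).1
      · simp [hm] at hij) S H hH hK (by
      intro s hs h hh
      have := hf ⟨s + h, hSH s hs h hh⟩
      refine Eq.trans ?_ this
      rw [← sum_fiberwise_of_maps_to (s := T) (g := fun r : ℕ × ℕ × ℕ => r.2.2) (t := range K)
        (fun r hr => mem_range.2 (hT r hr).2)]
      refine sum_congr rfl fun c _ => ?_
      simp only [evalEval_trans, q0]
      rw [← coe_evalEvalRingHom, map_sum, sum_mul]
      refine sum_congr rfl fun r hr => ?_
      rw [mem_filter] at hr
      rw [← hr.2]
      simp [evalEval, sub_eq_add_neg]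
      ring)
  refine ⟨Δ, h1, h2, h3, fun hz => h4 fun c hc => ?_⟩
  apply Nat.eq_zero_of_le_zero
  refine (natDegree_trans_le _ _ _).trans ?_
  refine natDegree_sum_le_of_forall_le _ _ fun r hr => ?_
  rw [mem_filter] at hr
  rw [hz r hr.1]
  exact (natDegree_monomial_le _)

lemma detzero {ι : Type*} [Fintype ι] [DecidableEq ι] (g u1 u2 : ℕ) (hg : 2 ≤ g) (hu1 : 1 ≤ u1) (hu2 : 1 ≤ u2)
    (υ : ℝ) (hυ : υ * u1 = (3 * αr - 2) * u2) (K S2 S3 : ℕ) (Ba : ℝ) (hBa : 1 ≤ Ba)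
    (J n D : ℕ) (hn : 1 ≤ n) (hcard : Fintype.card ι = J * n) (hJ0 : 1 ≤ J) (ri rj rc : ι → ℕ) (hD : ∀ r, ri r + rj r ≤ D)
    (hK : ∀ r, rc r ≤ K)
    (pt : ι → ℕ × ℕ × ℕ) (h2 : ∀ j, (pt j).2.1 ≤ S2) (h3 : ∀ j, (pt j).2.2 ≤ S3)
    (xI yI : ι → ℤ) (ha : ∀ r j, |((xI j : ℝ)) ^ ri r * (yI j:ℝ) ^ rj r| ≤ Ba)
    (A B ρ w0 : ℝ) (hJ : (∀ r, ri r + rj r < J) ∨ (B = 0 ∧ 1 ≤ J ∧ J = 1 ∧ ∀ r, rj r = 0))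
    (y z δ : ι → ℝ) (hyI : (∀ j, y j = yI j) ∨ ((∀ r, rj r = 0) ∧ ∀ j, y j = 0))
    (hx : ∀ s, (xI s : ℝ) = A * z s + B * y s)
    (hθ : ∀ s, theta g υ (pt s) = Real.exp (ρ * z s + w0 + δ s))
    (Zb Yb maj Wt : ℝ) (hz : ∀ s, |z s| ≤ Zb) (hy : ∀ s, |y s| ≤ Yb)
    (hmaj1 : 1 ≤ maj) (hmajY : Yb ≤ maj) (hmaj : |A| * (Real.exp 2 * Zb) + |B| * Yb ≤ maj)
    (hWt : Real.exp 2 * |ρ| * Zb + |w0| ≤ Wt) (hδ : ∀ s, 2 * (K * |δ s|) ≤ Real.exp (-2 * n))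
    (hlog : 3 * Real.log (J * n) + Real.log 4 + D * Real.log maj + K * Wt + 3 * (K * S3) * Real.log u1 +
      2 * Real.log Ba + 2 * (K * S2) * Real.log g + 2 * (K * S3) * Real.log (4.5 * u2) < n - 1) :
    (Matrix.of fun r j => (xI j : ℝ) ^ ri r * (yI j : ℝ) ^ rj r * theta g υ (pt j) ^ rc r : Matrix ι ι ℝ).det = 0 := by
  by_contra hne
  have har := arith g u1 u2 hg hu1 hu2 υ hυ K S2 S3 Ba hBa (fun r j => xI j ^ ri r * yI j ^ rj r)
    (by intro r j; push_cast; exact ha r j) rc hK pt h2 h3 (by push_cast; exact hne)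
  push_cast at har
  have hE1 : (1:ℝ) ≤ Real.exp 2 := Real.one_le_exp (by norm_num)
  have han := analytic J n D K hcard ri rj rc hD hK A B ρ w0 hJ (fun s => (xI s : ℝ)) y z (fun s => theta g υ (pt s)) δ hx hθ
    (Real.exp 2) hE1 Zb Yb maj Wt hz hy hmaj1 hmajY hmaj hWt (by
      intro s
      refine (hδ s).trans (le_of_eq ?_)
      rw [one_div, ← Real.exp_neg, ← Real.exp_nat_mul]; ring_nf)
  have hyy : (Matrix.of fun r s => (xI s:ℝ) ^ ri r * y s ^ rj r * theta g υ (pt s) ^ rc r : Matrix ι ι ℝ) =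
      (Matrix.of fun r j => (xI j : ℝ) ^ ri r * (yI j : ℝ) ^ rj r * theta g υ (pt j) ^ rc r : Matrix ι ι ℝ) := by
    ext r s
    simp only [Matrix.of_apply]
    rcases hyI with h | ⟨h, _⟩
    · rw [h]
    · rw [h]; simp
  rw [hyy] at han
  set dd := |(Matrix.of fun r j => (xI j : ℝ) ^ ri r * (yI j : ℝ) ^ rj r * theta g υ (pt j) ^ rc r : Matrix ι ι ℝ).det|
  set N := Fintype.card ι with hN
  have hNpos : 0 < N := by rw [hcard]; positivity
  have hu1' : (0:ℝ) < u1 := by exact_mod_cast hu1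
  have hu2' : (0:ℝ) < u2 := by exact_mod_cast hu2
  have hg' : (0:ℝ) < g := by exact_mod_cast (by omega : 0 < g)
  have hfac : ((N.factorial : ℕ):ℝ) ≤ (N:ℝ) ^ N := by exact_mod_cast Nat.factorial_le_pow N
  set F2 := (u1:ℝ) ^ (3 * (K * S3)) * Ba ^ 2 * (g:ℝ) ^ (2 * (K * S2)) * (4.5 * u2) ^ (2 * (K * S3)) with hF2
  have hF2pos : 0 < F2 := by positivity
  set F1 := 4 * (maj ^ D * Real.exp (K * Wt)) with hF1
  have hF1pos : 0 < F1 := by positivity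
  have hEE : (1 / Real.exp 2) ^ (J * (n * (n - 1) / 2)) = (Real.exp (-(n - 1))) ^ N := by
    rw [one_div, ← Real.exp_neg, ← Real.exp_nat_mul, ← Real.exp_nat_mul]
    congr 1
    have hdiv : 2 * (n * (n - 1) / 2) = n * (n - 1) := Nat.mul_div_cancel' (by
      rcases Nat.even_or_odd n with h | h
      · exact (h.mul_right _).two_dvd
      · exact ((Nat.Odd.sub_odd h odd_one).mul_left _).two_dvd)
    have hdiv' : 2 * ((n * (n - 1) / 2 : ℕ):ℝ) = n * (n - 1) := by
      have := congrArg (Nat.cast (R := ℝ)) hdiv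
      push_cast [Nat.cast_sub hn] at this ⊢
      exact this
    rw [hcard]
    push_cast
    linear_combination (-(J:ℝ)) * hdiv'
  have hbase : (N:ℝ) ^ 3 * (Real.exp (-(n - 1)) * F1) * F2 < 1 := by
    rw [← Real.log_neg_iff (by positivity)]
    rw [Real.log_mul (by positivity) (by positivity), Real.log_mul (by positivity) (by positivity),
      Real.log_mul (by positivity) (by positivity), Real.log_exp, hF1, hF2,
      Real.log_mul (by positivity) (by positivity), Real.log_mul (by positivity) (by positivity), Real.log_exp,
      Real.log_mul (by positivity) (by positivity), Real.log_mul (by positivity) (by positivity),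
      Real.log_mul (by positivity) (by positivity), Real.log_pow, Real.log_pow, Real.log_pow, Real.log_pow,
      Real.log_pow, Real.log_pow, hcard]
    push_cast
    linarith
  have hfin : dd * ((N.factorial:ℝ) ^ 2 * F2 ^ N) ≤ ((N:ℝ) ^ 3 * (Real.exp (-(n - 1)) * F1) * F2) ^ N := by
    calc _ ≤ (N.factorial * ((1 / Real.exp 2) ^ (J * (n * (n - 1) / 2)) * F1 ^ N)) * ((N.factorial:ℝ) ^ 2 * F2 ^ N) := by
          gcongr
      _ = (N.factorial : ℝ) ^ 3 * ((Real.exp (-(n - 1)) * F1) * F2) ^ N := by rw [hEE]; ring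
      _ ≤ ((N:ℝ) ^ N) ^ 3 * ((Real.exp (-(n - 1)) * F1) * F2) ^ N := by gcongr
      _ = _ := by rw [← pow_mul, mul_comm N 3, pow_mul, ← mul_pow]; ring
  have : ((N:ℝ) ^ 3 * (Real.exp (-(n - 1)) * F1) * F2) ^ N < 1 := pow_lt_one₀ (by positivity) hbase hNpos.ne'
  linarith
end

section
open Finset Polynomial

def yZ (b : ℕ) (s : ℕ × ℕ × ℕ) : ℤ := (s.2.1 : ℤ) - s.2.2 * b
def xZ (T k b : ℕ) (s : ℕ × ℕ × ℕ) : ℤ := T * ((s.1 : ℤ) + s.2.2 * k) + yZ b s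

def pHom (T k b : ℕ) : (ℕ × ℕ × ℕ) →+ ℝ × ℝ where
  toFun s := ((xZ T k b s : ℝ), (yZ b s : ℝ))
  map_zero' := by simp [xZ, yZ]
  map_add' s s' := by
    simp only [xZ, yZ, Prod.fst_add, Prod.snd_add, Prod.mk_add_mk, Prod.mk.injEq]
    constructor <;> push_cast <;> ring

lemma pHom_fst (T k b : ℕ) (s : ℕ × ℕ × ℕ) : (pHom T k b s).1 = xZ T k b s := rfl
lemma pHom_snd (T k b : ℕ) (s : ℕ × ℕ × ℕ) : (pHom T k b s).2 = yZ b s := rfl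

lemma theta_exp (g : ℕ) (hg : 2 ≤ g) (υ : ℝ) (hυ : 0 < υ) (s : ℕ × ℕ × ℕ) :
    theta g υ s = Real.exp (s.1 * Real.log αr + s.2.1 * Real.log g + s.2.2 * Real.log υ) := by
  have : (0:ℝ) < g := by exact_mod_cast (by omega : 0 < g)
  rw [Real.exp_add, Real.exp_add, Real.exp_nat_mul, Real.exp_nat_mul, Real.exp_nat_mul, Real.exp_log αr_pos,
    Real.exp_log this, Real.exp_log hυ]
  rfl

/-- the linear functional w -/
noncomputable def wf (g k b : ℕ) (s : ℕ × ℕ × ℕ) : ℝ :=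
  Real.log αr * ((s.1:ℝ) + s.2.2 * k) + Real.log g * (s.2.1 - s.2.2 * b)

lemma log_αr_pos : 0 < Real.log αr := Real.log_pos (by linarith [αr_gt])

lemma log_g_pos (g : ℕ) (hg : 2 ≤ g) : 0 < Real.log g := Real.log_pos (by exact_mod_cast (by omega : 1 < g))

lemma theta_wf (g k b : ℕ) (hg : 2 ≤ g) (υ : ℝ) (hυ : 0 < υ) (Λ : ℝ)
    (hΛ : Λ = k * Real.log αr - b * Real.log g - Real.log υ) (s : ℕ × ℕ × ℕ) :
    theta g υ s = Real.exp (wf g k b s - s.2.2 * Λ) := by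
  rw [theta_exp g hg υ hυ, hΛ, wf]; congr 1; ring

lemma wf_range (g k b : ℕ) (hg : 2 ≤ g) (υ : ℝ) (Λ : ℝ)
    (hΛ : Λ = k * Real.log αr - b * Real.log g - Real.log υ) (S1 S2 S3 : ℕ) (s : ℕ × ℕ × ℕ)
    (h1 : s.1 ≤ S1) (h2 : s.2.1 ≤ S2) (h3 : s.2.2 ≤ S3) :
    |wf g k b s| ≤ S1 * Real.log αr + S2 * Real.log g + S3 * |Real.log υ| + S3 * |Λ| := by
  have e : wf g k b s = s.1 * Real.log αr + s.2.1 * Real.log g + s.2.2 * Real.log υ + s.2.2 * Λ := by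
    rw [hΛ, wf]; ring
  have hl := log_αr_pos
  have hm := log_g_pos g hg
  rw [e]
  refine (abs_add_le _ _).trans (add_le_add ((abs_add_le _ _).trans (add_le_add ((abs_add_le _ _).trans (add_le_add ?_ ?_)) ?_)) ?_)
  · rw [abs_of_nonneg (by positivity)]; gcongr
  · rw [abs_of_nonneg (by positivity)]; gcongr
  · rw [abs_mul, Nat.abs_cast]; gcongr
  · rw [abs_mul, Nat.abs_cast]; gcongr

lemma wf_diff (g k b : ℕ) (hg : 2 ≤ g) (υ : ℝ) (Λ : ℝ)
    (hΛ : Λ = k * Real.log αr - b * Real.log g - Real.log υ) (S1 S2 S3 : ℕ) (s s' : ℕ × ℕ × ℕ)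
    (h1 : s.1 ≤ S1) (h2 : s.2.1 ≤ S2) (h3 : s.2.2 ≤ S3) (h1' : s'.1 ≤ S1) (h2' : s'.2.1 ≤ S2) (h3' : s'.2.2 ≤ S3) :
    |wf g k b s - wf g k b s'| ≤ S1 * Real.log αr + S2 * Real.log g + S3 * |Real.log υ| + S3 * |Λ| := by
  have e : wf g k b s - wf g k b s' = ((s.1:ℝ) - s'.1) * Real.log αr + ((s.2.1:ℝ) - s'.2.1) * Real.log g
    + ((s.2.2:ℝ) - s'.2.2) * Real.log υ + ((s.2.2:ℝ) - s'.2.2) * Λ := by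
    rw [hΛ, wf, wf]; ring
  have hl := log_αr_pos
  have hm := log_g_pos g hg
  have key : ∀ a a' S : ℕ, a ≤ S → a' ≤ S → |(a:ℝ) - a'| ≤ S := by
    intro a a' S h h'
    have : (a:ℝ) ≤ S := by exact_mod_cast h
    have : (a':ℝ) ≤ S := by exact_mod_cast h'
    have : (0:ℝ) ≤ a := by positivity
    have : (0:ℝ) ≤ a' := by positivity
    rw [abs_le]; constructor <;> linarith
  rw [e]
  refine (abs_add_le _ _).trans (add_le_add ((abs_add_le _ _).trans (add_le_add ((abs_add_le _ _).trans (add_le_add ?_ ?_)) ?_)) ?_)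
  · rw [abs_mul, abs_of_pos hl]; gcongr; exact key _ _ _ h1 h1'
  · rw [abs_mul, abs_of_pos hm]; gcongr; exact key _ _ _ h2 h2'
  · rw [abs_mul]; gcongr; exact key _ _ _ h3 h3'
  · rw [abs_mul]; gcongr; exact key _ _ _ h3 h3'

lemma xyZ_bound (T k b S1 S2 S3 : ℕ) (hT : 1 ≤ T) (s : ℕ × ℕ × ℕ) (h1 : s.1 ≤ S1) (h2 : s.2.1 ≤ S2) (h3 : s.2.2 ≤ S3) :
    |(yZ b s : ℝ)| ≤ S2 + S3 * b ∧ |(xZ T k b s : ℝ)| ≤ T * (S1 + S3 * k) + S2 + S3 * b := by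
  have h1' : (s.1:ℝ) ≤ S1 := by exact_mod_cast h1
  have h2' : (s.2.1:ℝ) ≤ S2 := by exact_mod_cast h2
  have h3' : (s.2.2:ℝ) ≤ S3 := by exact_mod_cast h3
  have hy : |(yZ b s : ℝ)| ≤ S2 + S3 * b := by
    simp only [yZ]; push_cast
    refine (abs_sub _ _).trans ?_
    rw [abs_of_nonneg (by positivity), abs_of_nonneg (by positivity)]
    gcongr
  refine ⟨hy, ?_⟩
  simp only [xZ]; push_cast
  refine (abs_add_le _ _).trans ?_
  rw [add_assoc]
  refine add_le_add ?_ hy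
  rw [abs_of_nonneg (by positivity)]
  gcongr

def rowsT (D K : ℕ) : Finset (ℕ × ℕ × ℕ) := (range D).biUnion (fun i => ({i} ×ˢ range (D-i) ×ˢ range K))

lemma mem_rowsT (D K : ℕ) (r : ℕ × ℕ × ℕ) : r ∈ rowsT D K → r.1 + r.2.1 < D ∧ r.2.2 < K := by
  simp only [rowsT, mem_biUnion, mem_product, mem_range, mem_singleton]
  rintro ⟨i, hi, h1, h2, h3⟩
  omega

lemma card_rowsT (D κ : ℕ) : (rowsT D (2 * κ)).card = D * ((D + 1) * κ) := by
  rw [rowsT, card_biUnion]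
  · simp only [card_product, card_singleton, card_range, one_mul]
    rw [← sum_mul]
    have h1 : ∑ i ∈ range D, (D - i) = ∑ i ∈ range D, (i + 1) := by
      rw [← sum_range_reflect]
      refine sum_congr rfl fun i hi => ?_
      rw [mem_range] at hi; omega
    have h2 : (∑ i ∈ range D, (i + 1)) * 2 = D * (D + 1) := by
      clear h1
      induction D with
      | zero => simp
      | succ d ih => rw [sum_range_succ, add_mul, ih]; ring
    rw [h1]
    calc _ = (∑ i ∈ range D, (i + 1)) * 2 * κ := by ring
      _ = _ := by rw [h2]; ring
  · intro i _ j _ hij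
    rw [Function.onFun, disjoint_left]
    rintro a ha hb
    simp only [mem_product, mem_singleton] at ha hb
    exact hij (ha.1.symm.trans hb.1)

lemma T3core (g u1 u2 : ℕ) (hg : 2 ≤ g) (hu1 : 1 ≤ u1) (hu2 : 1 ≤ u2) (υ : ℝ) (hυ0 : 0 < υ)
    (hυ : υ * u1 = (3 * αr - 2) * u2) (k b T S1 S2 S3 D κ : ℕ) (hT : 1 ≤ T) (hD : 1 ≤ D) (hκ : 1 ≤ κ)
    (Λ : ℝ) (hΛ : Λ = k * Real.log αr - b * Real.log g - Real.log υ) (lv W : ℝ) (hlv : 0 ≤ lv)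
    (hW : W = (S1 + (2 * κ : ℕ)) * Real.log αr + S2 * Real.log g + S3 * |Real.log υ| + 1)
    (hV1 : T * ((S1 + (2 * κ : ℕ)) + S3 * k) + S2 + S3 * b ≤ Real.exp lv)
    (hV2 : T / Real.log αr * (Real.exp 2 * W) + (1 + T * Real.log g / Real.log αr) * (S2 + S3 * b) ≤ Real.exp lv)
    (hδ : 2 * ((2 * κ : ℕ) * (S3 * |Λ|)) ≤ Real.exp (-2 * (((D + 1) * κ : ℕ) : ℝ)))
    (hlog : 3 * Real.log (D * ((D + 1) * κ : ℕ)) + Real.log 4 + D * lv + (2 * κ : ℕ) * (Real.exp 2 * W) +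
      3 * ((2 * κ : ℕ) * S3) * Real.log u1 + 2 * (D * lv) + 2 * ((2 * κ : ℕ) * S2) * Real.log g +
      2 * ((2 * κ : ℕ) * S3) * Real.log (4.5 * u2) < ((D + 1) * κ : ℕ) - 1) :
    ∃ Δ : ℝ[X][X], Δ ≠ 0 ∧ td Δ ≤ (D - 1) * (2 * κ) ∧
      (∀ s ∈ range S1 ×ˢ range S2 ×ˢ range S3, evalEval (pHom T k b s).1 (pHom T k b s).2 Δ = 0) := by
  classical
  have hl := log_αr_pos
  have hm := log_g_pos g hg
  have hb3 : (S3:ℝ) * |Λ| ≤ 1 := by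
    have h1 : Real.exp (-2 * (((D + 1) * κ : ℕ) : ℝ)) ≤ 1 := Real.exp_le_one_iff.2 (by
      have : (0:ℝ) ≤ (((D + 1) * κ : ℕ) : ℝ) := by positivity
      linarith)
    have h2 : (1:ℝ) ≤ (2 * κ : ℕ) := by exact_mod_cast (by omega : 1 ≤ 2 * κ)
    have h3 : 0 ≤ (S3:ℝ) * |Λ| := by positivity
    nlinarith
  obtain ⟨Δ, h1, h2, h3, _⟩ := step (pHom T k b) (theta g υ) (fun s => (theta_pos g hg υ hυ0 s).ne') (theta_add g υ)
    (2 * κ) (D - 1) 0 (rowsT D (2 * κ)) (fun r hr => by have := mem_rowsT _ _ _ hr; omega)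
    (range S1 ×ˢ range S2 ×ˢ range S3) (range (2 * κ) ×ˢ {0} ×ˢ {0})
    (range (S1 + 2 * κ) ×ˢ range S2 ×ˢ range S3)
    (by
      rintro ⟨s1, s2, s3⟩ hs ⟨a1, a2, a3⟩ ha
      simp only [mem_product, mem_range, mem_singleton, Prod.mk_add_mk] at hs ha ⊢
      omega)
    (by
      rintro ⟨s1, s2, s3⟩ hs ⟨a1, a2, a3⟩ ha he
      simp only [coe_product, coe_range, coe_singleton, Set.mem_prod, Set.mem_Iio, Set.mem_singleton_iff] at hs ha
      obtain ⟨_, rfl, rfl⟩ := hs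
      obtain ⟨_, rfl, rfl⟩ := ha
      simp only [theta, pow_zero, mul_one] at he
      have := pow_right_injective₀ αr_pos (by linarith [αr_gt] : αr ≠ 1) he
      simp_all)
    (by simp)
    (by
      intro e
      have hmem : ∀ j, (e j).1.1 ≤ S1 + 2 * κ ∧ (e j).1.2.1 ≤ S2 ∧ (e j).1.2.2 ≤ S3 := by
        intro j
        have := (e j).2
        simp only [mem_product, mem_range] at this
        omega
      have hxy := fun j => xyZ_bound T k b (S1 + 2 * κ) S2 S3 hT (e j).1 (hmem j).1 (hmem j).2.1 (hmem j).2.2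
      have hV0 : 1 ≤ Real.exp lv := Real.one_le_exp hlv
      have hYV : (S2:ℝ) + S3 * b ≤ Real.exp lv := by
        refine le_trans ?_ hV1
        have : (0:ℝ) ≤ T * ((S1 + (2 * κ : ℕ)) + S3 * k) := by positivity
        linarith
      have := detzero (ι := rowsT D (2 * κ)) g u1 u2 hg hu1 hu2 υ hυ (2 * κ) S2 S3 (Real.exp lv ^ D) (one_le_pow₀ hV0)
        D ((D + 1) * κ) D (Nat.mul_pos (by omega) hκ) (by rw [Fintype.card_coe, card_rowsT]) hD
        (fun r => r.1.1) (fun r => r.1.2.1) (fun r => r.1.2.2) (fun r => (mem_rowsT _ _ _ r.2).1.le)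
        (fun r => (mem_rowsT _ _ _ r.2).2.le) (fun j => (e j).1) (fun j => (hmem j).2.1) (fun j => (hmem j).2.2)
        (fun j => xZ T k b (e j).1) (fun j => yZ b (e j).1)
        (by
          intro r j
          rw [abs_mul, abs_pow, abs_pow]
          calc _ ≤ Real.exp lv ^ r.1.1 * Real.exp lv ^ r.1.2.1 := by
                gcongr
                · refine (hxy j).2.trans (le_trans (le_of_eq ?_) hV1); push_cast; ring
                · exact (hxy j).1.trans hYV
            _ = Real.exp lv ^ (r.1.1 + r.1.2.1) := by rw [pow_add]
            _ ≤ _ := pow_le_pow_right₀ hV0 (mem_rowsT _ _ _ r.2).1.le)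
        (T / Real.log αr) (1 - T * Real.log g / Real.log αr) 1 0 (Or.inl fun r => (mem_rowsT _ _ _ r.2).1)
        (fun j => (yZ b (e j).1 : ℝ)) (fun j => wf g k b (e j).1) (fun j => - ((e j).1.2.2 * Λ))
        (Or.inl fun j => rfl)
        (by
          intro j
          simp only [xZ, yZ, wf]
          push_cast
          field_simp
          ring)
        (by
          intro j
          rw [theta_wf g k b hg υ hυ0 Λ hΛ]; congr 1; ring)
        W (S2 + S3 * b) (Real.exp lv) (Real.exp 2 * W)
        (by
          intro j
          refine (wf_range g k b hg υ Λ hΛ (S1 + 2 * κ) S2 S3 (e j).1 (hmem j).1 (hmem j).2.1 (hmem j).2.2).trans ?_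
          rw [hW]; push_cast; push_cast at hb3; linarith)
        (fun j => (hxy j).1) hV0 hYV
        (by
          refine le_trans ?_ hV2
          rw [abs_of_nonneg (by positivity)]
          gcongr
          refine (abs_sub _ _).trans ?_
          rw [abs_one, abs_of_nonneg (by positivity)])
        (by simp)
        (by
          intro j
          refine le_trans ?_ hδ
          rw [abs_neg, abs_mul, Nat.abs_cast]
          have : ((e j).1.2.2 : ℝ) ≤ S3 := by exact_mod_cast (hmem j).2.2
          gcongr)
        (by
          rw [Real.log_exp, Real.log_pow, Real.log_exp]
          exact hlog)
      simpa only [pHom_fst, pHom_snd, sub_zero] using this)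
  exact ⟨Δ, h1, h2, h3⟩
end

section
open Finset Polynomial

lemma theta_inj (g : ℕ) (hg : 2 ≤ g) (υ : ℝ) (hυ0 : 0 < υ) (s s' : ℕ × ℕ × ℕ) (h3 : s.2.2 = s'.2.2)
    (h : theta g υ s = theta g υ s') : s = s' := by
  have hg0 : (0:ℝ) < g := by exact_mod_cast (by omega : 0 < g)
  have hα := αr_pos
  have hα1 : (1:ℝ) < αr := by linarith [αr_gt]
  have hg1 : (1:ℝ) < g := by exact_mod_cast (by omega : 1 < g)
  obtain ⟨a, c, e⟩ := s
  obtain ⟨a', c', e'⟩ := s'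
  simp only at h3
  subst h3
  simp only [theta] at h
  have h := mul_right_cancel₀ (by positivity) h
  -- wlog
  have key : ∀ a a' c c' : ℕ, a ≤ a' → αr ^ a * (g:ℝ) ^ c = αr ^ a' * (g:ℝ) ^ c' → a = a' ∧ c = c' := by
    intro a a' c c' haa h
    obtain ⟨d, rfl⟩ := Nat.exists_eq_add_of_le haa
    have h1 : (g:ℝ) ^ c = αr ^ d * (g:ℝ) ^ c' := by
      rw [pow_add, mul_assoc] at h
      exact mul_left_cancel₀ (by positivity) h
    rcases le_total c' c with hc | hc
    · obtain ⟨f, rfl⟩ := Nat.exists_eq_add_of_le hc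
      have h2 : αr ^ d = (g:ℝ) ^ f := by
        rw [pow_add, mul_comm] at h1
        exact (mul_right_cancel₀ (by positivity) h1).symm
      have := alpha_indep d f g hg h2
      omega
    · obtain ⟨f, rfl⟩ := Nat.exists_eq_add_of_le hc
      have h2 : (1:ℝ) = αr ^ d * (g:ℝ) ^ f := by
        have : (g:ℝ) ^ c * 1 = (g:ℝ) ^ c * (αr ^ d * (g:ℝ) ^ f) := by rw [pow_add] at h1; linear_combination h1
        exact mul_left_cancel₀ (by positivity) this
      have p1 : 1 ≤ αr ^ d := one_le_pow₀ hα1.le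
      have p2 : 1 ≤ (g:ℝ) ^ f := one_le_pow₀ hg1.le
      have q1 : αr ^ d = 1 := by nlinarith
      have q2 : (g:ℝ) ^ f = 1 := by nlinarith
      have r1 : d = 0 := by
        by_contra hd; exact absurd q1 (one_lt_pow₀ hα1 hd).ne'
      have r2 : f = 0 := by
        by_contra hd; exact absurd q2 (one_lt_pow₀ hg1 hd).ne'
      omega
  rcases le_total a a' with ha | ha
  · obtain ⟨rfl, rfl⟩ := key _ _ _ _ ha h; rfl
  · obtain ⟨rfl, rfl⟩ := key _ _ _ _ ha h.symm; rfl

lemma exists_H (g : ℕ) (hg : 2 ≤ g) (υ : ℝ) (hυ0 : 0 < υ) (S3 K : ℕ) (hS3 : 1 ≤ S3) (Z : Finset (ℕ × ℕ × ℕ))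
    (hZ : ∀ s ∈ Z, s.2.2 < S3) (hc : S3 * K ≤ Z.card) : ∃ H ⊆ Z, Set.InjOn (theta g υ) (H : Set (ℕ × ℕ × ℕ)) ∧ K ≤ H.card := by
  classical
  obtain ⟨H, hH, hinj, himg⟩ := Finset.exists_subset_injOn_image_eq_of_surjOn (f := theta g υ) Z (Z.image (theta g υ)) (by
    intro y hy; simpa using hy)
  refine ⟨H, by exact_mod_cast hH, ?_, ?_⟩
  · exact hinj
  · have h1 : H.card = (Z.image (theta g υ)).card := by
      rw [← himg, card_image_of_injOn hinj]
    rw [h1]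
    have h2 := card_le_mul_card_image (f := theta g υ) Z S3 (by
      intro y _
      rw [← card_range S3]
      apply card_le_card_of_injOn (fun s => s.2.2)
      · intro s hs; simp only [mem_coe, mem_filter] at hs; simpa using hZ s hs.1
      · intro s hs s' hs' he
        simp only [mem_coe, mem_filter] at hs hs'
        exact theta_inj g hg υ hυ0 s s' he (hs.2.trans hs'.2.symm))
    exact Nat.le_of_mul_le_mul_left (hc.trans h2) hS3

lemma T2core (g u1 u2 : ℕ) (hg : 2 ≤ g) (hu1 : 1 ≤ u1) (hu2 : 1 ≤ u2) (υ : ℝ) (hυ0 : 0 < υ)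
    (hυ : υ * u1 = (3 * αr - 2) * u2) (k b T S1 S2 S3 D K : ℕ) (hT : 1 ≤ T) (hD : 1 ≤ D) (hK : 1 ≤ K) (hS3 : 1 ≤ S3)
    (Λ : ℝ) (hΛ : Λ = k * Real.log αr - b * Real.log g - Real.log υ) (lv W : ℝ) (hlv : 0 ≤ lv)
    (hW : W = S1 * Real.log αr + S2 * Real.log g + S3 * |Real.log υ| + 1)
    (hbT : b ≤ T * k)
    (hV1 : 2 * (T * (S1 + S3 * k) + S2 + S3 * b) ≤ Real.exp lv)
    (hδ : 2 * ((K : ℕ) * (2 * S3 * |Λ|)) ≤ Real.exp (-2 * ((D * K : ℕ) : ℝ)))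
    (hlog : 3 * Real.log (D * K : ℕ) + Real.log 4 + D * (lv + 2) + K * (2 * (Real.exp 2 + 1) * W) +
      3 * (K * (2 * S3)) * Real.log u1 + 2 * (D * lv) + 2 * (K * (2 * S2)) * Real.log g +
      2 * (K * (2 * S3)) * Real.log (4.5 * u2) < (D * K : ℕ) - 1)
    (Z : Finset (ℕ × ℕ × ℕ)) (hZ : Z ⊆ range S1 ×ˢ range S2 ×ˢ range S3) (ρ σ : ℝ)
    (hline : ∀ s ∈ Z, (yZ b s : ℝ) = ρ * xZ T k b s + σ)
    (hinj : Set.InjOn (fun s => (xZ T k b s : ℝ)) (Z : Set (ℕ × ℕ × ℕ)))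
    (hc1 : D * K ≤ Z.card) (hc2 : S3 * K ≤ Z.card) : False := by
  classical
  have hl := log_αr_pos
  have hm := log_g_pos g hg
  have hT0 : (0:ℝ) < T := by exact_mod_cast hT
  have hb3 : (S3:ℝ) * |Λ| ≤ 1 := by
    have h1 : Real.exp (-2 * ((D * K : ℕ) : ℝ)) ≤ 1 := Real.exp_le_one_iff.2 (by
      have : (0:ℝ) ≤ ((D * K : ℕ) : ℝ) := by positivity
      linarith)
    have h2 : (1:ℝ) ≤ K := by exact_mod_cast hK
    have h3 : 0 ≤ (S3:ℝ) * |Λ| := by positivity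
    nlinarith
  have hZne : Z.Nonempty := by
    rw [← card_pos]; exact lt_of_lt_of_le (Nat.mul_pos hD hK) hc1
  have hZm : ∀ s ∈ Z, s.1 < S1 ∧ s.2.1 < S2 ∧ s.2.2 < S3 := by
    intro s hs; simpa only [mem_product, mem_range] using hZ hs
  obtain ⟨H, hHZ, hHinj, hHK⟩ := exists_H g hg υ hυ0 S3 K hS3 Z (fun s hs => (hZm s hs).2.2) hc2
  obtain ⟨z0, hz0, hz0min⟩ := exists_min_image Z (xZ T k b) hZne
  obtain ⟨z1, hz1, hz1max⟩ := exists_max_image Z (xZ T k b) hZne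
  set X0 : ℤ := 2 * xZ T k b z0 with hX0
  set ρ' := Real.log αr / T * (1 - ρ) + Real.log g * ρ with hρ'
  set σ' := -(Real.log αr / T * σ) + Real.log g * σ with hσ'
  have hwl : ∀ s ∈ Z, wf g k b s = ρ' * xZ T k b s + σ' := by
    intro s hs
    have h1 := hline s hs
    have h2 : wf g k b s = Real.log αr / T * (xZ T k b s - yZ b s) + Real.log g * yZ b s := by
      simp only [wf, xZ, yZ]; push_cast; field_simp; ring
    rw [h2, h1, hρ', hσ']; ring
  have hwadd : ∀ s s', wf g k b (s + s') = wf g k b s + wf g k b s' := by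
    intro s s'; simp only [wf, Prod.fst_add, Prod.snd_add]; push_cast; ring
  have hxadd : ∀ s s', xZ T k b (s + s') = xZ T k b s + xZ T k b s' := by
    intro s s'; simp only [xZ, yZ, Prod.fst_add, Prod.snd_add]; push_cast; ring
  set V : ℝ := 2 * (xZ T k b z1 - xZ T k b z0 : ℝ) with hV
  have hV0 : 0 ≤ V := by
    have : (xZ T k b z0 : ℝ) ≤ xZ T k b z1 := by exact_mod_cast hz0min z1 hz1
    rw [hV]; linarith
  have hVlv : V ≤ Real.exp lv := by
    refine le_trans ?_ hV1
    have h1 := (xyZ_bound T k b S1 S2 S3 hT z1 (hZm z1 hz1).1.le (hZm z1 hz1).2.1.le (hZm z1 hz1).2.2.le).2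
    have h2 : 0 ≤ xZ T k b z0 := by
      have : (b:ℤ) ≤ T * k := by exact_mod_cast hbT
      have h3 : xZ T k b z0 = T * z0.1 + z0.2.1 + z0.2.2 * (T * k - b) := by simp only [xZ, yZ]; ring
      rw [h3]
      have : (0:ℤ) ≤ (T * k - b) := by linarith
      positivity
    have h2' : (0:ℝ) ≤ xZ T k b z0 := by exact_mod_cast h2
    have := le_abs_self (xZ T k b z1 : ℝ)
    rw [hV]; linarith
  have hρV : |ρ'| * V ≤ 2 * W := by
    have h1 := wf_diff g k b hg υ Λ hΛ S1 S2 S3 z1 z0 (hZm z1 hz1).1.le (hZm z1 hz1).2.1.le (hZm z1 hz1).2.2.le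
      (hZm z0 hz0).1.le (hZm z0 hz0).2.1.le (hZm z0 hz0).2.2.le
    rw [hwl z1 hz1, hwl z0 hz0] at h1
    have h2 : |ρ'| * V = 2 * |ρ' * xZ T k b z1 + σ' - (ρ' * xZ T k b z0 + σ')| := by
      rw [show ρ' * xZ T k b z1 + σ' - (ρ' * xZ T k b z0 + σ') = ρ' * (V / 2) by rw [hV]; ring, abs_mul,
        abs_of_nonneg (by positivity : 0 ≤ V / 2)]; ring
    rw [h2]; linarith
  have hw0 : |2 * wf g k b z0| ≤ 2 * W := by
    have h1 := wf_range g k b hg υ Λ hΛ S1 S2 S3 z0 (hZm z0 hz0).1.le (hZm z0 hz0).2.1.le (hZm z0 hz0).2.2.le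
    rw [abs_mul, abs_of_pos (by norm_num : (0:ℝ) < 2)]; linarith
  obtain ⟨Δ, h1, h2, h3, h4⟩ := step (pHom T k b) (theta g υ) (fun s => (theta_pos g hg υ hυ0 s).ne') (theta_add g υ)
    K (D - 1) X0 (range D ×ˢ {0} ×ˢ range K) (fun r hr => by
      simp only [mem_product, mem_range, mem_singleton] at hr; omega)
    Z H ((Z ×ˢ Z).image fun q => q.1 + q.2)
    (fun s hs h hh => mem_image.2 ⟨(s, h), mem_product.2 ⟨hs, hHZ hh⟩, rfl⟩) hHinj hHK
    (by
      intro e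
      have hE : ∀ j, ∃ s ∈ Z, ∃ h ∈ Z, (e j).1 = s + h := by
        intro j
        obtain ⟨⟨s, h⟩, hq, he⟩ := mem_image.1 (e j).2
        exact ⟨s, (mem_product.1 hq).1, h, (mem_product.1 hq).2, he.symm⟩
      have hr : ∀ r : (range D ×ˢ {0} ×ˢ range K : Finset (ℕ × ℕ × ℕ)), r.1.1 < D ∧ r.1.2.1 = 0 ∧ r.1.2.2 < K := by
        intro r; simpa only [mem_product, mem_range, mem_singleton] using r.2
      have hmem : ∀ j, (e j).1.2.1 ≤ 2 * S2 ∧ (e j).1.2.2 ≤ 2 * S3 := by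
        intro j
        obtain ⟨s, hs, h, hh, he⟩ := hE j
        rw [he]
        have := hZm s hs
        have := hZm h hh
        simp only [Prod.snd_add, Prod.fst_add]; omega
      have hv : ∀ j, |((xZ T k b (e j).1 - X0 : ℤ) : ℝ)| ≤ V := by
        intro j
        obtain ⟨s, hs, h, hh, he⟩ := hE j
        rw [he, hxadd, hX0]
        have a1 : (xZ T k b z0 : ℝ) ≤ xZ T k b s := by exact_mod_cast hz0min s hs
        have a2 : (xZ T k b z0 : ℝ) ≤ xZ T k b h := by exact_mod_cast hz0min h hh
        have a3 : (xZ T k b s : ℝ) ≤ xZ T k b z1 := by exact_mod_cast hz1max s hs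
        have a4 : (xZ T k b h : ℝ) ≤ xZ T k b z1 := by exact_mod_cast hz1max h hh
        push_cast
        rw [abs_of_nonneg (by linarith), hV]; linarith
      have hV1 : 1 ≤ Real.exp lv := Real.one_le_exp hlv
      have hmajp : Real.exp lv ≤ Real.exp (lv + 2) := Real.exp_le_exp.2 (by linarith)
      have := detzero (ι := (range D ×ˢ {0} ×ˢ range K : Finset (ℕ × ℕ × ℕ))) g u1 u2 hg hu1 hu2 υ hυ K (2 * S2) (2 * S3)
        (Real.exp lv ^ D) (one_le_pow₀ hV1)
        1 (D * K) D (Nat.mul_pos hD hK) (by rw [Fintype.card_coe]; simp) le_rfl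
        (fun r => r.1.1) (fun r => r.1.2.1) (fun r => r.1.2.2) (fun r => by have := hr r; omega)
        (fun r => (hr r).2.2.le) (fun j => (e j).1) (fun j => (hmem j).1) (fun j => (hmem j).2)
        (fun j => xZ T k b (e j).1 - X0) (fun j => yZ b (e j).1)
        (by
          intro r j
          rw [(hr r).2.1, pow_zero, mul_one, abs_pow]
          calc _ ≤ Real.exp lv ^ r.1.1 := by
                gcongr; exact (hv j).trans hVlv
            _ ≤ _ := pow_le_pow_right₀ hV1 (hr r).1.le)
        1 0 ρ' (2 * wf g k b z0) (Or.inr ⟨rfl, le_rfl, rfl, fun r => (hr r).2.1⟩)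
        (fun j => 0) (fun j => ((xZ T k b (e j).1 - X0 : ℤ) : ℝ)) (fun j => - ((e j).1.2.2 * Λ))
        (Or.inr ⟨fun r => (hr r).2.1, fun j => rfl⟩)
        (by intro j; ring)
        (by
          intro j
          rw [theta_wf g k b hg υ hυ0 Λ hΛ]; congr 1
          obtain ⟨s, hs, h, hh, he⟩ := hE j
          rw [he, hwadd, hxadd, hwl s hs, hwl h hh, hwl z0 hz0, hX0]
          push_cast
          ring)
        V 0 (Real.exp (lv + 2)) (2 * (Real.exp 2 + 1) * W)
        hv (by intro j; simp) (hV1.trans hmajp) (by positivity)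
        (by
          rw [Real.exp_add, abs_one, one_mul, abs_zero, zero_mul, add_zero, mul_comm]
          gcongr)
        (by
          have : (0:ℝ) < Real.exp 2 := Real.exp_pos 2
          rw [mul_assoc]
          nlinarith)
        (by
          intro j
          refine le_trans ?_ hδ
          rw [abs_neg, abs_mul, Nat.abs_cast]
          have : ((e j).1.2.2 : ℝ) ≤ 2 * S3 := by exact_mod_cast (hmem j).2
          gcongr)
        (by
          rw [Real.log_exp, Real.log_pow, Real.log_exp]
          push_cast
          push_cast at hlog
          rw [one_mul]
          exact hlog)
      simpa only [pHom_fst, pHom_snd, Int.cast_sub] using this)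
  have hdeg := h4 (fun r hr => by simp only [mem_product, mem_range, mem_singleton] at hr; exact hr.2.1)
  obtain ⟨δ, rfl⟩ : ∃ δ, Δ = C δ := ⟨_, eq_C_of_natDegree_eq_zero hdeg⟩
  have hδ0 : δ ≠ 0 := by rintro rfl; simp at h1
  have hδdeg : δ.natDegree ≤ (D - 1) * K := by
    refine le_trans ?_ h2
    have := td_natDegree (C δ) 0 (by simpa using hδ0)
    simpa using this
  have hroots : (Z.image fun s => (xZ T k b s : ℝ)) ⊆ δ.roots.toFinset := by
    intro x hx
    obtain ⟨s, hs, rfl⟩ := mem_image.1 hx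
    rw [Multiset.mem_toFinset, mem_roots hδ0]
    have := h3 s hs
    simpa [evalEval, pHom_fst] using this
  have hcard := card_le_card hroots
  rw [card_image_of_injOn hinj] at hcard
  have := hcard.trans ((Multiset.toFinset_card_le _).trans (card_roots' δ))
  have h5 : (D - 1) * K < D * K := Nat.mul_lt_mul_of_pos_right (by omega) hK
  omega
end

section
open Finset Polynomial

lemma exp2_gt : (7.389:ℝ) < Real.exp 2 := by
  have h := Real.exp_one_gt_d9
  have : Real.exp 2 = Real.exp 1 * Real.exp 1 := by rw [← Real.exp_add]; norm_num
  rw [this]; nlinarith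
lemma exp2_lt : Real.exp 2 < (7.3891:ℝ) := by
  have h := Real.exp_one_lt_d9
  have h' := Real.exp_one_gt_d9
  have : Real.exp 2 = Real.exp 1 * Real.exp 1 := by rw [← Real.exp_add]; norm_num
  rw [this]; nlinarith

lemma lam_lt : Real.log αr < 23 / 60 := by
  have h1 : Real.log (αr ^ 60) < 23 := by
    rw [Real.log_lt_iff_lt_exp (by have := αr_pos; positivity)]
    calc αr ^ 60 ≤ (1.466:ℝ) ^ 60 := pow_le_pow_left₀ αr_pos.le αr_lt.le 60
      _ < (2.7182:ℝ) ^ 23 := by norm_num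
      _ ≤ (Real.exp 1) ^ 23 := pow_le_pow_left₀ (by norm_num) (by linarith [Real.exp_one_gt_d9]) 23
      _ = Real.exp 23 := by rw [← Real.exp_nat_mul]; norm_num
  rw [Real.log_pow] at h1
  push_cast at h1; linarith

lemma lam_gt : (0.38:ℝ) < Real.log αr := by
  have h1 : 19 < Real.log (αr ^ 50) := by
    rw [Real.lt_log_iff_exp_lt (by have := αr_pos; positivity)]
    calc Real.exp 19 = (Real.exp 1) ^ 19 := by rw [← Real.exp_nat_mul]; norm_num
      _ ≤ (2.7183:ℝ) ^ 19 := pow_le_pow_left₀ (Real.exp_pos 1).le (by linarith [Real.exp_one_lt_d9]) 19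
      _ < (1.465:ℝ) ^ 50 := by norm_num
      _ ≤ αr ^ 50 := pow_le_pow_left₀ (by norm_num) αr_gt.le 50
  rw [Real.log_pow] at h1
  push_cast at h1; linarith

lemma log_le_eighth (x : ℝ) (hx : 0 < x) : Real.log x ≤ x / 8 + 2 := by
  have h1 := Real.log_le_sub_one_of_pos (show 0 < x / 8 by positivity)
  rw [Real.log_div hx.ne' (by norm_num)] at h1
  have h2 : Real.log 8 = 3 * Real.log 2 := by
    rw [show (8:ℝ) = 2 ^ 3 by norm_num, Real.log_pow]; norm_num
  have := Real.log_two_lt_d9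
  linarith

lemma log4_lt : Real.log 4 < 1.4 := by
  have h2 : Real.log 4 = 2 * Real.log 2 := by
    rw [show (4:ℝ) = 2 ^ 2 by norm_num, Real.log_pow]; norm_num
  have := Real.log_two_lt_d9
  linarith

lemma xZ_inj (T k b S1 S3 : ℕ) (h : b + T * S1 ≤ T * k) :
    Set.InjOn (fun s => (xZ T k b s : ℝ)) (↑(range S1 ×ˢ range T ×ˢ range S3) : Set (ℕ × ℕ × ℕ)) := by
  rintro ⟨a1, a2, a3⟩ ha ⟨c1, c2, c3⟩ hc he
  simp only [mem_coe, mem_product, mem_range] at ha hc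
  have he : xZ T k b (a1, a2, a3) = xZ T k b (c1, c2, c3) := by
    simp only at he; exact_mod_cast he
  simp only [xZ, yZ] at he
  obtain ⟨w, hw⟩ := Nat.exists_eq_add_of_le h
  have hw' : (T:ℤ) * k - b = T * S1 + w := by
    have : ((T * k : ℕ):ℤ) = ((b + T * S1 + w : ℕ) : ℤ) := by rw [hw]
    push_cast at this; linarith
  have he2 : (T:ℤ) * a1 + a2 + a3 * (T * S1 + w) = T * c1 + c2 + c3 * (T * S1 + w) := by
    rw [← hw']; linear_combination he
  have he3 : T * a1 + a2 + a3 * (T * S1 + w) = T * c1 + c2 + c3 * (T * S1 + w) := by exact_mod_cast he2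
  have key : ∀ x1 x2 : ℕ, x1 < S1 → x2 < T → T * x1 + x2 < T * S1 + w := by
    intro x1 x2 h1 h2
    nlinarith
  have e3 : a3 = c3 := by
    have h1 : (T * a1 + a2 + (T * S1 + w) * a3) / (T * S1 + w) = a3 := by
      rw [Nat.add_mul_div_left _ _ (lt_of_le_of_lt (Nat.zero_le _) (key a1 a2 ha.1 ha.2.1)),
        Nat.div_eq_of_lt (key a1 a2 ha.1 ha.2.1), zero_add]
    have h2 : (T * c1 + c2 + (T * S1 + w) * c3) / (T * S1 + w) = c3 := by
      rw [Nat.add_mul_div_left _ _ (lt_of_le_of_lt (Nat.zero_le _) (key a1 a2 ha.1 ha.2.1)),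
        Nat.div_eq_of_lt (key c1 c2 hc.1 hc.2.1), zero_add]
    rw [← h1, ← h2, mul_comm _ a3, mul_comm _ c3, he3]
  subst e3
  have he4 : T * a1 + a2 = T * c1 + c2 := by omega
  have e1 : a1 = c1 := by
    have h1 : (a2 + T * a1) / T = a1 := by
      rw [Nat.add_mul_div_left _ _ (by omega), Nat.div_eq_of_lt ha.2.1, zero_add]
    have h2 : (c2 + T * c1) / T = c1 := by
      rw [Nat.add_mul_div_left _ _ (by omega), Nat.div_eq_of_lt hc.2.1, zero_add]
    rw [← h1, ← h2, add_comm, he4, add_comm]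
  subst e1
  have : a2 = c2 := by omega
  rw [this]

lemma line_num (m2 m3 n : ℕ) (hm2 : 50 ≤ m2) (hm3 : 30 ≤ m3) (hn : 10 ≤ n) (z e : ℕ) (he : 1 ≤ e)
    (h : (m2 * m3 * (159 * n ^ 2)) * (34 * m3 * (159 * n ^ 2)) * (34 * m2 * (159 * n ^ 2)) * e ≤
      z * ((34 * (m2 * m3 * (159 * n ^ 2))) * (2 * (6 * n)))) :
    ((m2 * m3 * (159 * n ^ 2)) + m2 * m3 * n ^ 2) * ((34 * m3 * (159 * n ^ 2)) + 34 * m3 * n ^ 2) *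
      ((34 * m2 * (159 * n ^ 2)) + 34 * m2 * n ^ 2) * (z + (m2 * m3 * n ^ 2) * (34 * m3 * n ^ 2) * (34 * m2 * n ^ 2) * e ^ 2) <
      z ^ 2 * ((m2 * m3 * n ^ 2) * (34 * m3 * n ^ 2) * (34 * m2 * n ^ 2)) := by
  obtain ⟨G, hG⟩ : ∃ G, G = (m2 * m3 * n ^ 2) * (34 * m3 * n ^ 2) * (34 * m2 * n ^ 2) := ⟨_, rfl⟩
  obtain ⟨P, hP⟩ : ∃ P, P = m2 * m3 * n ^ 3 := ⟨_, rfl⟩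
  have hPpos : 1500000 ≤ P := by
    rw [hP]; calc 1500000 = 50 * 30 * 10 ^ 3 := by norm_num
      _ ≤ _ := by gcongr
  have hGP : G = 1156 * P ^ 2 := by rw [hG, hP]; ring
  have h1 : 159 ^ 3 * 1156 * P ^ 2 * e ≤ z * (64872 * P) := by
    calc _ = _ := by rw [hP]; ring
      _ ≤ _ := h
      _ = _ := by rw [hP]; ring
  have h2 : 71628 * P * e ≤ z := by
    have : (71628 * P * e) * (64872 * P) ≤ z * (64872 * P) := by
      refine le_trans ?_ h1
      have : 0 ≤ P ^ 2 * e := Nat.zero_le _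
      nlinarith
    exact Nat.le_of_mul_le_mul_right this (by positivity)
  have hgoal : 160 ^ 3 * G * (z + G * e ^ 2) < z ^ 2 * G := by
    have hGpos : 0 < G := by rw [hGP]; positivity
    have : 160 ^ 3 * (z + G * e ^ 2) < z ^ 2 := by
      rw [hGP]
      have h3 : 160 ^ 3 * 1156 * P ^ 2 * e ^ 2 * 1000 ≤ 923 * z ^ 2 := by
        have : (71628 * P * e) ^ 2 ≤ z ^ 2 := Nat.pow_le_pow_left h2 2
        nlinarith [Nat.zero_le (P ^ 2 * e ^ 2)]
      have h4 : 160 ^ 3 * 1000 < 77 * z := by nlinarith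
      nlinarith
    calc 160 ^ 3 * G * (z + G * e ^ 2) = (160 ^ 3 * (z + G * e ^ 2)) * G := by ring
      _ < z ^ 2 * G := Nat.mul_lt_mul_of_pos_right this hGpos
  calc _ = 160 ^ 3 * G * (z + G * e ^ 2) := by rw [hG]; ring
    _ < z ^ 2 * G := hgoal
    _ = _ := by rw [hG]
end

section
open Finset Polynomial

lemma delta_num (m2 m3 n c : ℝ) (hm2 : 50 ≤ m2) (hm3 : 30 ≤ m3) (hn : 10 ≤ n) (Λ : ℝ)
    (hΛ : |Λ| ≤ Real.exp (-75000 * (m2 * m3 * n ^ 3)))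
    (hc : c ≤ 74412 * (m2 * m3 * n ^ 3)) :
    129744 * (m2 * n ^ 3) * |Λ| ≤ Real.exp (-c) := by
  set P := m2 * m3 * n ^ 3 with hP
  have hP0 : 30 * (m2 * n ^ 3) ≤ P := by
    have : 0 ≤ m2 * n ^ 3 := by positivity
    rw [hP]; nlinarith
  have hP1 : 1 ≤ P := by
    have h1 : (1:ℝ) ≤ n ^ 3 := one_le_pow₀ (by linarith)
    nlinarith
  have h2 : 129744 * (m2 * n ^ 3) ≤ Real.exp (588 * P) := by
    have := Real.quadratic_le_exp_of_nonneg (show 0 ≤ 588 * P by positivity)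
    nlinarith
  calc 129744 * (m2 * n ^ 3) * |Λ| ≤ Real.exp (588 * P) * Real.exp (-75000 * P) := by gcongr
    _ = Real.exp (- (74412 * P)) := by rw [← Real.exp_add]; congr 1; ring
    _ ≤ _ := Real.exp_le_exp.2 (by linarith)

set_option maxHeartbeats 6000000 in
theorem bakerT (g u1 u2 : ℕ) (hg : 2 ≤ g) (hu1 : 1 ≤ u1) (hu2 : 1 ≤ u2) (υ : ℝ) (hυ0 : 0 < υ)
    (hυ : υ * u1 = (3 * αr - 2) * u2) (k b n m2 m3 : ℕ) (hn : 10 ≤ n)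
    (hm2 : 12 * (Real.exp 2 + 2) * Real.log g ≤ m2)
    (hm3 : 12 * (Real.exp 2 * |Real.log υ| + 3 * Real.log u1 + 2 * Real.log (4.5 * u2)) ≤ m3)
    (S1 S2 S3 : ℕ) (hS1 : S1 = m2 * m3 * (159 * n ^ 2)) (hS2 : S2 = 34 * m3 * (159 * n ^ 2))
    (hS3 : S3 = 34 * m2 * (159 * n ^ 2))
    (hinj : b + S2 * S1 ≤ S2 * k)
    (hV1 : 2 * (S2 * ((S1 + 12 * n) + S3 * k) + S2 + S3 * b) ≤ Real.exp (n - 1))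
    (hV2 : S2 / Real.log αr * (9 * S1) + (1 + S2 * Real.log g / Real.log αr) * (S2 + S3 * b) ≤ Real.exp (n - 1))
    (Λ : ℝ) (hΛ : Λ = k * Real.log αr - b * Real.log g - Real.log υ)
    (hsmall : |Λ| ≤ Real.exp (-75000 * (m2 * m3 * n ^ 3))) : False := by
  have hl := log_αr_pos
  have hm := log_g_pos g hg
  have hE1 := exp2_gt
  have hE2 := exp2_lt
  have hl1 := lam_lt
  have hl2 := lam_gt
  have hnR : (10:ℝ) ≤ n := by exact_mod_cast hn
  have hmu : 0.693 < Real.log g := by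
    have h1 : Real.log 2 ≤ Real.log g := Real.log_le_log (by norm_num) (by exact_mod_cast hg)
    linarith [Real.log_two_gt_d9]
  have hlu1 : 0 ≤ Real.log u1 := Real.log_nonneg (by exact_mod_cast hu1)
  have hu2R : (1:ℝ) ≤ u2 := by exact_mod_cast hu2
  have hlu2 : 1.386 ≤ Real.log (4.5 * u2) := by
    have h1 : Real.log 4 ≤ Real.log (4.5 * u2) := Real.log_le_log (by norm_num) (by linarith)
    have h2 : Real.log 4 = 2 * Real.log 2 := by
      rw [show (4:ℝ) = 2 ^ 2 by norm_num, Real.log_pow]; norm_num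
    linarith [Real.log_two_gt_d9]
  have hm2R : (50:ℝ) ≤ m2 := by
    refine le_trans ?_ hm2
    nlinarith only [hE1, hmu]
  have hm3R : (30:ℝ) ≤ m3 := by
    refine le_trans ?_ hm3
    have : 0 ≤ Real.exp 2 * |Real.log υ| := by positivity
    linarith
  have hm2N : 50 ≤ m2 := by exact_mod_cast hm2R
  have hm3N : 30 ≤ m3 := by exact_mod_cast hm3R
  -- real versions
  have rS1 : (S1:ℝ) = m2 * m3 * (159 * n ^ 2) := by rw [hS1]; push_cast; ring
  have rS2 : (S2:ℝ) = 34 * m3 * (159 * n ^ 2) := by rw [hS2]; push_cast; ring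
  have rS3 : (S3:ℝ) = 34 * m2 * (159 * n ^ 2) := by rw [hS3]; push_cast; ring
  have hS1pos : 1 ≤ S1 := by rw [hS1]; exact Nat.mul_pos (Nat.mul_pos (by omega) (by omega)) (by positivity)
  have hS2pos : 1 ≤ S2 := by rw [hS2]; exact Nat.mul_pos (by omega) (by positivity)
  have hS3pos : 1 ≤ S3 := by rw [hS3]; exact Nat.mul_pos (by omega) (by positivity)
  -- S1 is big
  have hS1big : 2000000 * (n:ℝ) ≤ S1 := by
    rw [rS1]
    have h1 : (1500:ℝ) ≤ m2 * m3 := by nlinarith only [hm2R, hm3R]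
    have h2 : 1590 * (n:ℝ) ≤ 159 * n ^ 2 := by nlinarith only [hnR]
    calc 2000000 * (n:ℝ) ≤ 1500 * (1590 * n) := by linarith
      _ ≤ _ := by gcongr
  have hX2 : 12 * ((Real.exp 2 + 2) * (S2 * Real.log g)) ≤ 34 * S1 := by
    have : (0:ℝ) ≤ 34 * m3 * (159 * n ^ 2) := by positivity
    have := mul_le_mul_of_nonneg_left hm2 this
    rw [rS1, rS2]; linarith
  have hX3 : 12 * (Real.exp 2 * (S3 * |Real.log υ|) + S3 * (3 * Real.log u1 + 2 * Real.log (4.5 * u2))) ≤ 34 * S1 := by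
    have : (0:ℝ) ≤ 34 * m2 * (159 * n ^ 2) := by positivity
    have := mul_le_mul_of_nonneg_left hm3 this
    rw [rS1, rS3]; linarith
  obtain ⟨X2, hX2e⟩ : ∃ X2, X2 = S2 * Real.log g := ⟨_, rfl⟩
  obtain ⟨A3, hA3e⟩ : ∃ X2, X2 = S3 * |Real.log υ| := ⟨_, rfl⟩
  obtain ⟨B3, hB3e⟩ : ∃ X2, X2 = S3 * (3 * Real.log u1 + 2 * Real.log (4.5 * u2)) := ⟨_, rfl⟩
  have hX20 : 0 ≤ X2 := by rw [hX2e]; positivity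
  have hA30 : 0 ≤ A3 := by rw [hA3e]; positivity
  have hB30 : 0 ≤ B3 := by
    rw [hB3e]; exact mul_nonneg (by positivity) (by linarith)
  rw [← hX2e] at hX2
  rw [← hA3e, ← hB3e] at hX3
  have hS1l : Real.exp 2 * (S1 * Real.log αr) ≤ 2.8325 * S1 := by
    have : Real.exp 2 * Real.log αr ≤ 2.8325 := by nlinarith only [hE1, hE2, hl1, hl2]
    have h0 : (0:ℝ) ≤ S1 := by positivity
    nlinarith only [this, h0]
  have hS1l' : S1 * Real.log αr ≤ 0.38334 * S1 := by
    have h0 : (0:ℝ) ≤ S1 := by positivity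
    nlinarith only [h0, hl1]
  have hX2b : X2 ≤ 0.3019 * S1 := by nlinarith only [hX2, hX20, hE1]
  have hA3b : A3 ≤ 0.3836 * S1 := by nlinarith only [hX3, hA30, hB30, hE1]
  have hlv : (0:ℝ) ≤ (n:ℝ) - 1 := by linarith
  -- T3
  have hnl : (n:ℝ) * Real.log αr ≤ 0.3834 * n := by nlinarith only [hnR, hl1]
  have hEnl : Real.exp 2 * (12 * (n:ℝ) * Real.log αr) ≤ 34.1 * n := by
    have h1 : Real.exp 2 * Real.log αr ≤ 2.8325 := by nlinarith only [hE1, hE2, hl1, hl2]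
    nlinarith only [h1, hnR]
  set W3 : ℝ := (S1 + (2 * (6 * n) : ℕ)) * Real.log αr + S2 * Real.log g + S3 * |Real.log υ| + 1 with hW3
  have hEW : Real.exp 2 * W3 + B3 + 2 * X2 ≤ 8.5 * S1 := by
    have : Real.exp 2 * W3 = Real.exp 2 * (S1 * Real.log αr) + Real.exp 2 * (12 * (n:ℝ) * Real.log αr) + Real.exp 2 * X2 +
        Real.exp 2 * A3 + Real.exp 2 := by
      rw [hW3, ← hX2e, ← hA3e]; push_cast; ring
    rw [this]
    linarith
  have hEW9 : Real.exp 2 * W3 ≤ 9 * S1 := by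
    have : (0:ℝ) ≤ S1 := by positivity
    linarith
  obtain ⟨Δ, hΔ, htd, hv⟩ := T3core g u1 u2 hg hu1 hu2 υ hυ0 hυ k b S2 S1 S2 S3 (34 * S1) (6 * n) hS2pos (by omega)
    (by omega) Λ hΛ (n - 1) W3 hlv hW3
    (by
      refine le_trans ?_ hV1
      push_cast
      have : (0:ℝ) ≤ S2 * ((S1 + 12 * n) + S3 * k) + S2 + S3 * b := by positivity
      linarith)
    (by
      refine le_trans ?_ hV2
      gcongr)
    (by
      have := delta_num m2 m3 n (2 * (((34 * S1 + 1) * (6 * n) : ℕ) : ℝ)) hm2R hm3R hnR Λ hsmall (by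
        push_cast; rw [rS1]
        have h1 : (1:ℝ) ≤ m2 * m3 := by nlinarith only [hm2R, hm3R]
        have h2 : (n:ℝ) ≤ n ^ 3 := by nlinarith only [hnR, sq_nonneg ((n:ℝ))]
        have h3 : (n:ℝ) ≤ m2 * m3 * n ^ 3 := by
          have : (0:ℝ) ≤ (n:ℝ)^3 := by positivity
          nlinarith only [this, h1, h2]
        linarith)
      rw [neg_mul]
      refine le_trans (le_of_eq ?_) this
      rw [rS3]; push_cast; ring)
    (by
      have hlog1 : Real.log (((34 * S1 : ℕ):ℝ) * (((34 * S1 + 1) * (6 * n) : ℕ) : ℝ)) ≤ 9 * S1 + n + 6 := by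
        have p1 : (0:ℝ) < S1 := by exact_mod_cast hS1pos
        push_cast
        rw [Real.log_mul (x := 34 * (S1:ℝ)) (by positivity) (by positivity),
          Real.log_mul (x := 34 * (S1:ℝ) + 1) (by positivity) (by positivity)]
        have l1 := log_le_eighth (34 * S1) (by positivity)
        have l2 := log_le_eighth (34 * S1 + 1) (by positivity)
        have l3 := log_le_eighth (6 * n) (by positivity)
        linarith
      have h4 := log4_lt
      have hBB : 3 * (((2 * (6 * n) : ℕ):ℝ) * S3) * Real.log u1 + 2 * (((2 * (6 * n) : ℕ):ℝ) * S2) * Real.log g +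
        2 * (((2 * (6 * n) : ℕ):ℝ) * S3) * Real.log (4.5 * u2) = 12 * n * (B3 + 2 * X2) := by
        rw [hB3e, hX2e]; push_cast; ring
      have hmain := mul_le_mul_of_nonneg_left hEW (show (0:ℝ) ≤ 12 * n by positivity)
      push_cast at hBB hlog1 ⊢
      linarith)
  have hinj' := xZ_inj S2 k b S1 S3 hinj
  obtain ⟨ρ, σ, Z, hZ, hline, hcard⟩ := line_lemma (pHom S2 k b) S1 S2 S3 (m2 * m3 * n ^ 2) (34 * m3 * n ^ 2) (34 * m2 * n ^ 2)
    ((34 * S1) * (2 * (6 * n))) hinj' (by rw [hS1]; exact Nat.mul_le_mul_left _ (by omega)) (by rw [hS2]; exact Nat.mul_le_mul_left _ (by omega))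
    (by rw [hS3]; exact Nat.mul_le_mul_left _ (by omega)) (by positivity) Δ hΔ
    (lt_of_le_of_lt htd (Nat.mul_lt_mul_of_pos_right (by omega) (by omega))) hv
    (by
      intro z e he h
      rw [hS1, hS2, hS3] at h ⊢
      exact line_num m2 m3 n hm2N hm3N hn z e he h)
  -- card of Z
  have hZc : 450 * S1 * n ≤ Z.card := by
    have h1 : (450 * S1 * n) * (34 * S1 * (2 * (6 * n))) ≤ Z.card * (34 * S1 * (2 * (6 * n))) := by
      refine le_trans ?_ hcard
      calc _ = 183600 * (S1 * S1) * n ^ 2 := by ring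
        _ ≤ 183804 * (S1 * S1) * n ^ 2 := by gcongr; norm_num
        _ = S1 * S2 * S3 := by rw [hS1, hS2, hS3]; ring
    exact Nat.le_of_mul_le_mul_right h1 (by positivity)
  set W2 : ℝ := S1 * Real.log αr + S2 * Real.log g + S3 * |Real.log υ| + 1 with hW2
  have hEW2 : 2 * (Real.exp 2 + 1) * W2 + 2 * B3 + 4 * X2 ≤ 19.5 * S1 := by
    have : 2 * (Real.exp 2 + 1) * W2 = 2 * (Real.exp 2 * (S1 * Real.log αr) + S1 * Real.log αr + Real.exp 2 * X2 + X2 +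
        Real.exp 2 * A3 + A3 + Real.exp 2 + 1) := by
      rw [hW2, ← hX2e, ← hA3e]; ring
    rw [this]
    linarith
  refine T2core g u1 u2 hg hu1 hu2 υ hυ0 hυ k b S2 S1 S2 S3 (39 * S1) (6 * n) hS2pos (by omega)
    (by omega) hS3pos Λ hΛ (n - 1) W2 hlv hW2 (le_trans (Nat.le_add_right _ _) hinj) ?_ ?_ ?_ Z hZ ρ σ hline 
    (hinj'.mono (by exact_mod_cast hZ)) ?_ ?_
  · refine le_trans ?_ hV1
    have : (0:ℝ) ≤ S2 * (12 * n) := by positivity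
    linarith
  · have := delta_num m2 m3 n (2 * (((39 * S1) * (6 * n) : ℕ) : ℝ)) hm2R hm3R hnR Λ hsmall (by
        push_cast; rw [rS1]
        linarith)
    rw [neg_mul]
    refine le_trans (le_of_eq ?_) this
    rw [rS3]; push_cast; ring
  · have hlog1 : Real.log ((((39 * S1) * (6 * n) : ℕ) : ℝ)) ≤ 5 * S1 + n + 4 := by
      have p1 : (0:ℝ) < S1 := by exact_mod_cast hS1pos
      push_cast
      rw [Real.log_mul (x := 39 * (S1:ℝ)) (by positivity) (by positivity)]
      have l1 := log_le_eighth (39 * S1) (by positivity)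
      have l3 := log_le_eighth (6 * n) (by positivity)
      linarith
    have h4 := log4_lt
    have hBB : 3 * (((6 * n : ℕ):ℝ) * (2 * S3)) * Real.log u1 + 2 * (((6 * n : ℕ):ℝ) * (2 * S2)) * Real.log g +
        2 * (((6 * n : ℕ):ℝ) * (2 * S3)) * Real.log (4.5 * u2) = 6 * n * (2 * B3 + 4 * X2) := by
        rw [hB3e, hX2e]; push_cast; ring
    have hmain := mul_le_mul_of_nonneg_left hEW2 (show (0:ℝ) ≤ 6 * n by positivity)
    push_cast at hBB hlog1 ⊢
    linarith
  · refine le_trans ?_ hZc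
    calc 39 * S1 * (6 * n) = 234 * S1 * n := by ring
      _ ≤ _ := by gcongr; norm_num
  · refine le_trans ?_ hZc
    have : S3 ≤ 2 * S1 := by
      rw [hS3, hS1]
      have : 34 * m2 ≤ 2 * (m2 * m3) := by nlinarith only [hm2N, hm3N]
      calc 34 * m2 * (159 * n ^ 2) ≤ 2 * (m2 * m3) * (159 * n ^ 2) := by gcongr
        _ = _ := by ring
    calc S3 * (6 * n) ≤ (2 * S1) * (6 * n) := by gcongr
      _ = 12 * S1 * n := by ring
      _ ≤ _ := by gcongr; norm_num
end

section
open Finset Polynomial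

lemma nar_rec (k : ℕ) : (narayana (k+3) : ℝ) = narayana (k+2) + narayana k := by
  rw [narayana]; push_cast; ring

lemma nar_rec2 (k : ℕ) : ((3 * αr - 2) * narayana (k+2) - αr ^ (k+2)) + (αr - 1) * ((3 * αr - 2) * narayana (k+1) - αr ^ (k+1))
    + (αr ^ 2 - αr) * ((3 * αr - 2) * narayana k - αr ^ k) = 0 := by
  induction k with
  | zero =>
    simp [narayana]
    linear_combination 0 * αr_eq
  | succ k ih =>
    rw [show k + 1 + 2 = k + 3 by ring, nar_rec]
    have h := αr_eq
    have h2 : αr ^ (k+3) = αr ^ (k+2) + αr ^ k := by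
      rw [pow_add, h]; ring
    rw [show k + 1 + 1 = k + 2 by ring, h2]
    linear_combination αr * ih - ((3 * αr - 2) * narayana k - αr ^ k) * h

lemma nar_V (k : ℕ) : ((3 * αr - 2) * narayana (k+1) - αr ^ (k+1)) ^ 2 + (αr - 1) * ((3 * αr - 2) * narayana (k+1) - αr ^ (k+1))
    * ((3 * αr - 2) * narayana k - αr ^ k) + (αr ^ 2 - αr) * ((3 * αr - 2) * narayana k - αr ^ k) ^ 2 ≤ 1.2 := by
  have h := αr_eq
  have h1 := αr_gt
  have h2 := αr_lt
  induction k with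
  | zero =>
    simp [narayana]
    nlinarith
  | succ k ih =>
    have hr := nar_rec2 k
    rw [show k + 1 + 1 = k + 2 by ring]
    set e0 := (3 * αr - 2) * narayana k - αr ^ k
    set e1 := (3 * αr - 2) * narayana (k+1) - αr ^ (k+1)
    set e2 := (3 * αr - 2) * narayana (k+2) - αr ^ (k+2)
    have he : e2 = -(αr - 1) * e1 - (αr ^ 2 - αr) * e0 := by linarith
    have hV : e2 ^ 2 + (αr - 1) * e2 * e1 + (αr ^ 2 - αr) * e1 ^ 2 = (αr ^ 2 - αr) * (e1 ^ 2 + (αr - 1) * e1 * e0 + (αr ^ 2 - αr) * e0 ^ 2) := by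
      rw [he]; ring
    rw [hV]
    have : αr ^ 2 - αr ≤ 1 := by nlinarith
    have : 0 ≤ αr ^ 2 - αr := by nlinarith
    nlinarith

lemma nar_close (k : ℕ) : |αr ^ k - (3 * αr - 2) * narayana k| ≤ 1.4 := by
  have h := nar_V k
  have h1 := αr_gt
  have h2 := αr_lt
  set e0 := (3 * αr - 2) * narayana k - αr ^ k with he0
  set e1 := (3 * αr - 2) * narayana (k+1) - αr ^ (k+1)
  rw [abs_sub_comm, ← he0]
  apply abs_le_of_sq_le_sq _ (by norm_num)
  have : 0.62 ≤ (αr ^ 2 - αr) - (αr - 1) ^ 2 / 4 := by nlinarith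
  nlinarith [sq_nonneg (e1 + (αr - 1) / 2 * e0), sq_nonneg e0]

lemma Lam_bound (g k b : ℕ) (hg : 2 ≤ g) (υ N ε Q : ℝ) (hυ0 : 0 < υ) (hα : |αr ^ k - (3 * αr - 2) * N| ≤ 1.4)
    (hN : (3 * αr - 2) * N = υ * g ^ b * Q) (hQ1 : 1 - 4 * ε ≤ Q) (hQ2 : Q ≤ 1) (hε : 0 < ε) (hε2 : ε ≤ 1 / 20)
    (hεN : 1 / ε ≤ N) : |k * Real.log αr - b * Real.log g - Real.log υ| ≤ 10 * ε := by
  have hg0 : (0:ℝ) < g := by exact_mod_cast (by omega : 0 < g)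
  have ha := αr_pos
  have h1 := αr_gt
  set Y := υ * (g:ℝ) ^ b with hY
  have hY0 : 0 < Y := by positivity
  have hN1 : 1 ≤ N * ε := by rwa [div_le_iff₀ hε] at hεN
  have hN0 : 0 < N := by
    by_contra hh; push Not at hh; nlinarith
  have hYN : 2.39 * N ≤ Y := by nlinarith
  have hYε : 2.39 ≤ Y * ε := by nlinarith
  set r := αr ^ k / Y with hr
  have hr0 : 0 < r := by positivity
  have hrY : r * Y = αr ^ k := by rw [hr]; field_simp
  have e1 : |r - Q| ≤ 0.6 * ε := by
    have : |r - Q| * Y ≤ 1.4 := by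
      have h9 : |r - Q| * Y = |(r - Q) * Y| := by rw [abs_mul, abs_of_pos hY0]
      rw [h9]
      have : (r - Q) * Y = αr ^ k - (3 * αr - 2) * N := by rw [hN, ← hrY]; ring
      rw [this]; exact hα
    nlinarith [abs_nonneg (r - Q)]
  have e2 : |Q - 1| ≤ 4 * ε := by rw [abs_le]; constructor <;> linarith
  have e3 : |r - 1| ≤ 4.6 * ε := by
    calc |r - 1| = |(r - Q) + (Q - 1)| := by ring_nf
      _ ≤ _ := abs_add_le _ _
      _ ≤ _ := by linarith
  have hlog : k * Real.log αr - b * Real.log g - Real.log υ = Real.log r := by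
    rw [hr, Real.log_div (by positivity) (by positivity), Real.log_pow, hY, Real.log_mul (by positivity) (by positivity), Real.log_pow]
    ring
  rw [hlog]
  have ⟨e4, e5⟩ := abs_le.1 e3
  have u1 := Real.log_le_sub_one_of_pos hr0
  have u2 := Real.one_sub_inv_le_log_of_pos hr0
  have u3 : -(10 * ε) ≤ 1 - r⁻¹ := by
    have : r⁻¹ ≤ 1 + 10 * ε := by
      rw [inv_le_iff_one_le_mul₀ hr0]
      nlinarith
    linarith
  rw [abs_le]; constructor <;> linarith
end

section
open Finset Polynomial

lemma mu_ge (g : ℕ) (hg : 2 ≤ g) : 0.693 ≤ Real.log g := by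
  have : Real.log 2 ≤ Real.log g := Real.log_le_log (by norm_num) (by exact_mod_cast hg)
  linarith [Real.log_two_gt_d9]

lemma Hprime (g u2 s : ℕ) (hg : 2 ≤ g) (hu : 1 ≤ u2) (hu2 : u2 ≤ (g - 1) ^ 4 * g ^ s) (υ : ℝ)
    (hυ : υ = (3 * αr - 2) * u2 / ((g - 1) ^ 4 : ℕ)) :
    12 * (Real.exp 2 * |Real.log υ| + 3 * Real.log ((g - 1) ^ 4 : ℕ) + 2 * Real.log (4.5 * u2))
      ≤ (600 + 112.7 * s) * Real.log g := by
  have hμ := mu_ge g hg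
  have hE := exp2_lt
  have hE1 := exp2_gt
  have hg1 : (1:ℝ) ≤ (g - 1 : ℕ) := by exact_mod_cast (by omega : 1 ≤ g - 1)
  have hu1 : (1:ℝ) ≤ u2 := by exact_mod_cast hu
  set μ := Real.log g
  set ν := Real.log (g - 1 : ℕ) with hν
  have hν0 : 0 ≤ ν := Real.log_nonneg hg1
  have hνμ : ν ≤ μ := Real.log_le_log (by linarith) (by exact_mod_cast (by omega : g - 1 ≤ g))
  have hw0 : 0 ≤ Real.log u2 := Real.log_nonneg hu1
  have hgpos : (0:ℝ) < g := by exact_mod_cast (by omega : 0 < g)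
  have hw : Real.log u2 ≤ 4 * ν + s * μ := by
    have h : (u2:ℝ) ≤ ((g - 1 : ℕ):ℝ) ^ 4 * (g:ℝ) ^ s := by exact_mod_cast hu2
    have := Real.log_le_log (by linarith) h
    rw [Real.log_mul (by positivity) (by positivity), Real.log_pow, Real.log_pow] at this
    push_cast at this
    linarith
  have hc0 : 0 ≤ Real.log (3 * αr - 2) := Real.log_nonneg (by linarith [αr_gt])
  have hc1 : Real.log (3 * αr - 2) ≤ 1 := by
    rw [Real.log_le_iff_le_exp (by linarith [αr_gt])]
    linarith [αr_lt, Real.exp_one_gt_d9]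
  have hlu : Real.log ((g - 1) ^ 4 : ℕ) = 4 * ν := by
    rw [Nat.cast_pow, Real.log_pow]; norm_num [hν]
  have h45 : Real.log (4.5 * u2) ≤ 1.7 + Real.log u2 := by
    rw [Real.log_mul (by norm_num) (by linarith)]
    have : Real.log 4.5 ≤ 1.7 := by
      have h4 := Real.log_two_lt_d9
      have : Real.log 4.5 ≤ Real.log (2 * 2 * 1.125) := by norm_num
      rw [Real.log_mul (by norm_num) (by norm_num), Real.log_mul (by norm_num) (by norm_num)] at this
      have := Real.log_le_sub_one_of_pos (show (0:ℝ) < 1.125 by norm_num)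
      linarith
    linarith
  have hlυ : Real.log υ = Real.log (3 * αr - 2) + Real.log u2 - 4 * ν := by
    rw [hυ, Real.log_div (mul_pos (by linarith [αr_gt]) (by linarith)).ne' (by exact_mod_cast (Nat.pow_pos (by omega : 0 < g - 1) : 0 < (g - 1) ^ 4).ne'), hlu,
      Real.log_mul (by linarith [αr_gt]) (by linarith)]
  have hs : 0 ≤ s * μ := by positivity
  rw [hlu]
  rcases abs_cases (Real.log υ) with ⟨h, h'⟩ | ⟨h, h'⟩
  · have : |Real.log υ| ≤ 1 + s * μ := by rw [h, hlυ]; linarith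
    have : Real.exp 2 * |Real.log υ| ≤ 7.3891 * (1 + s * μ) := by
      apply mul_le_mul hE.le this (abs_nonneg _) (by norm_num)
    nlinarith
  · have h3 : |Real.log υ| ≤ 4 * ν - Real.log u2 := by rw [h, hlυ]; linarith
    have : Real.exp 2 * |Real.log υ| ≤ 7.3891 * (4 * ν - Real.log u2) := by
      apply mul_le_mul hE.le h3 (abs_nonneg _) (by norm_num)
    nlinarith

lemma stage_num1 (S1 S2 S3 k b n t T μ F : ℝ) (hμ : 0.693 ≤ μ) (hT : T = t * μ) (ht0 : 0 < t)
    (hn : 10 ≤ n) (hS1 : S1 ≤ T) (hS10 : 0 ≤ S1) (h2 : 500000 ≤ S2) (h3 : 30000000 ≤ S3) (h3n : 1000 * n ≤ S3) (hk : k ≤ 10.6 * T) (hb : b ≤ 4 * t)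
    (hT51 : 51 ≤ T)
    (hF : 21.5 * (S2 * S3 * T) ≤ F) : 2 * (S2 * ((S1 + 12 * n) + S3 * k) + S2 + S3 * b) ≤ F := by
  have ht : t ≤ 1.5 * T := by rw [hT]; nlinarith
  have a1 : S3 * k ≤ 10.6 * (S3 * T) := by nlinarith
  have a2 : S1 ≤ 0.01 * (S3 * T) := by nlinarith
  have a3 : 1 + 12 * n ≤ 0.01 * (S3 * T) := by nlinarith
  have a4 : S2 * (1 + (S1 + 12 * n) + S3 * k) ≤ S2 * (10.62 * (S3 * T)) := by
    apply mul_le_mul_of_nonneg_left _ (by linarith)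
    linarith
  have a5 : S3 * b ≤ 0.1 * (S2 * S3 * T) := by
    have h : 0 ≤ S3 * T := by nlinarith
    have : S3 * b ≤ 6 * (S3 * T) := by nlinarith
    nlinarith
  have : 0 ≤ S2 * S3 * T := by
    have : 0 ≤ S3 * T := by nlinarith
    nlinarith
  nlinarith

lemma stage_num2 (S1 S2 S3 b t T μ l F : ℝ) (hμ : 0.693 ≤ μ) (hT : T = t * μ) (ht0 : 0 < t) (hl : 0.38 < l)
    (hS1 : S1 ≤ T) (hS10 : 0 ≤ S1) (h2 : 500000 ≤ S2) (h3 : 30000000 ≤ S3) (h3μ : 1000 * μ ≤ S3) (h2T : S2 ≤ T) (hb : b ≤ 4 * t) (hb0 : 0 ≤ b)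
    (hF : 21.5 * (S2 * S3 * T) ≤ F) : S2 / l * (9 * S1) + (1 + S2 * μ / l) * (S2 + S3 * b) ≤ F := by
  have ht : t ≤ 1.5 * T := by rw [hT]; nlinarith
  have hT0 : 0 < T := by rw [hT]; positivity
  have e1 : S2 / l ≤ 3 * S2 := by rw [div_le_iff₀ (by linarith)]; nlinarith
  have e2 : S2 * μ / l ≤ 2.7 * (S2 * μ) := by
    rw [div_le_iff₀ (by linarith)]
    have : 0 < S2 * μ := by nlinarith
    nlinarith
  have hS2μ : 0 < S2 * μ := by nlinarith
  have b1 : S2 / l * (9 * S1) ≤ 3 * S2 * (9 * T) := by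
    apply mul_le_mul e1 (by linarith) (by linarith) (by linarith)
  have hb2 : S3 * b ≤ S3 * (4 * t) := by nlinarith
  have b2 : (1 + S2 * μ / l) * (S2 + S3 * b) ≤ (1 + 2.7 * (S2 * μ)) * (S2 + S3 * (4 * t)) := by
    apply mul_le_mul (by linarith) (by linarith) (by nlinarith) (by nlinarith)
  have c1 : 3 * S2 * (9 * T) ≤ 0.1 * (S2 * S3 * T) := by
    have : 0 ≤ S2 * T := by nlinarith
    nlinarith
  have c2 : S2 ≤ 0.1 * (S2 * S3 * T) := by
    have : S2 ≤ S2 * S2 := by nlinarith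
    have : S2 * S2 ≤ S2 * T := by nlinarith
    nlinarith
  have c3 : S3 * (4 * t) ≤ 0.1 * (S2 * S3 * T) := by
    have h : 0 ≤ S3 * T := by nlinarith
    have : S3 * (4 * t) ≤ 6 * (S3 * T) := by nlinarith
    nlinarith
  have c4 : 2.7 * (S2 * μ) * S2 ≤ 0.1 * (S2 * S3 * T) := by
    have h : μ * S2 ≤ (S3 / 1000) * T := mul_le_mul (by linarith) h2T (by linarith) (by linarith)
    nlinarith
  have c5 : 2.7 * (S2 * μ) * (S3 * (4 * t)) = 10.8 * (S2 * S3 * T) := by rw [hT]; ring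
  have : 0 ≤ S2 * S3 * T := by positivity
  nlinarith

lemma stage_numS (m2 m3 n μ T S1 S2 S3 F : ℝ) (hm2 : 78 ≤ m2) (hm2μ : 112.67 * μ ≤ m2) (hm3 : 400 ≤ m3) (hn : 10 ≤ n)
    (hT : 0 ≤ T) (hS1 : S1 = m2 * m3 * (159 * n ^ 2)) (hS2 : S2 = 34 * m3 * (159 * n ^ 2)) (hS3 : S3 = 34 * m2 * (159 * n ^ 2))
    (hF : 6.3e8 * (m2 * m3 * n ^ 4 * T) ≤ F) :
    500000 ≤ S2 ∧ 30000000 ≤ S3 ∧ 1000 * n ≤ S3 ∧ 1000 * μ ≤ S3 ∧ S2 ≤ S1 ∧ 21.5 * (S2 * S3 * T) ≤ F ∧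
    S1 ≤ m2 * m3 * n ^ 3 * 20 ∧ 30000 ≤ m2 * m3 * n ^ 3 := by
  have hn2 : 100 ≤ n ^ 2 := by nlinarith only [hn]
  have hn3 : 10 * n ^ 2 ≤ n ^ 3 := by
    have : n ^ 3 = n * n ^ 2 := by ring
    rw [this]; exact mul_le_mul_of_nonneg_right hn (by linarith)
  have hmm : 30000 ≤ m2 * m3 := by nlinarith only [hm2, hm3]
  have h3 : m3 * 100 ≤ m3 * n ^ 2 := mul_le_mul_of_nonneg_left hn2 (by linarith)
  have h2 : m2 * 100 ≤ m2 * n ^ 2 := mul_le_mul_of_nonneg_left hn2 (by linarith)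
  have h2n : 78 * n ^ 2 ≤ m2 * n ^ 2 := mul_le_mul_of_nonneg_right hm2 (by linarith)
  have hnn : n ≤ n ^ 2 := by nlinarith only [hn]
  have e2 : S2 = 5406 * (m3 * n ^ 2) := by rw [hS2]; ring
  have e3 : S3 = 5406 * (m2 * n ^ 2) := by rw [hS3]; ring
  have e1 : S1 = 159 * (m2 * (m3 * n ^ 2)) := by rw [hS1]; ring
  have h23 : 78 * (m3 * n ^ 2) ≤ m2 * (m3 * n ^ 2) := mul_le_mul_of_nonneg_right hm2 (by linarith)
  have h33 : m2 * m3 * (10 * n ^ 2) ≤ m2 * m3 * n ^ 3 := mul_le_mul_of_nonneg_left hn3 (by linarith)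
  have h34 : 30000 * n ^ 2 ≤ m2 * m3 * n ^ 2 := mul_le_mul_of_nonneg_right hmm (by linarith)
  refine ⟨by linarith, by linarith, by linarith, by linarith, by linarith, ?_, by linarith, by linarith⟩
  have : 0 ≤ m2 * m3 * n ^ 4 * T := by
    have : 0 ≤ m2 * m3 := by linarith
    positivity
  rw [e2, e3]
  calc _ = 628333974 * (m2 * m3 * n ^ 4 * T) := by ring
    _ ≤ _ := by linarith

set_option maxHeartbeats 1000000 in
theorem stage (g k u2 b s t lj n m2 m3 : ℕ) (Q : ℝ) (hg : 2 ≤ g) (hu : 1 ≤ u2) (hu2 : u2 ≤ (g - 1) ^ 4 * g ^ s)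
    (hN : (narayana k : ℝ) * ((g - 1) ^ 4 : ℕ) = u2 * g ^ b * Q)
    (hQ1 : 1 - 4 * ((g:ℝ) ^ lj)⁻¹ ≤ Q) (hQ2 : Q ≤ 1) (hb : b ≤ 4 * t) (hlj : lj ≤ t) (h20 : 20 ≤ g ^ lj)
    (hN1 : g ^ t ≤ narayana k) (hN2 : narayana k ≤ g ^ (4 * t)) (ht : 100 ≤ t) (hn : 10 ≤ n)
    (hm2 : 112.67 * Real.log g ≤ m2) (hm3 : (600 + 112.7 * s) * Real.log g ≤ m3)
    (hVV : 6.3e8 * (m2 * m3 * n ^ 4 * (t * Real.log g)) ≤ Real.exp (n - 1)) :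
    lj * Real.log g ≤ 75001 * (m2 * m3 * n ^ 3) := by
  have hμ := mu_ge g hg
  have hg0 : (0:ℝ) < g := by exact_mod_cast (by omega : 0 < g)
  have hα1 := αr_gt
  have hα2 := αr_lt
  have hαp := αr_pos
  have hl1 := lam_gt
  have hl2 := lam_lt
  have hu1N : 1 ≤ (g - 1) ^ 4 := Nat.one_le_pow _ _ (by omega)
  have hu1 : (1:ℝ) ≤ ((g - 1) ^ 4 : ℕ) := by exact_mod_cast hu1N
  have huR : (1:ℝ) ≤ u2 := by exact_mod_cast hu
  have hnar := nar_close k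
  have hN1R : (g:ℝ) ^ t ≤ narayana k := by exact_mod_cast hN1
  have hN2R : (narayana k : ℝ) ≤ (g:ℝ) ^ (4 * t) := by exact_mod_cast hN2
  have hljt : (g:ℝ) ^ lj ≤ (g:ℝ) ^ t := pow_le_pow_right₀ (by exact_mod_cast (by omega : 1 ≤ g)) hlj
  have h20R : (20:ℝ) ≤ (g:ℝ) ^ lj := by exact_mod_cast h20
  obtain ⟨υ, hυ⟩ : ∃ υ : ℝ, υ = (3 * αr - 2) * u2 / ((g - 1) ^ 4 : ℕ) := ⟨_, rfl⟩
  have hυ0 : 0 < υ := by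
    rw [hυ]; apply div_pos (mul_pos (by linarith) (by linarith)) (by linarith)
  have hυ1 : υ * ((g - 1) ^ 4 : ℕ) = (3 * αr - 2) * u2 := by
    rw [hυ]; exact div_mul_cancel₀ _ (by linarith)
  have hH := Hprime g u2 s hg hu hu2 υ hυ
  have hNυ : (3 * αr - 2) * (narayana k : ℝ) = υ * g ^ b * Q := by
    have : ((3 * αr - 2) * (narayana k : ℝ)) * ((g - 1) ^ 4 : ℕ) = (υ * g ^ b * Q) * ((g - 1) ^ 4 : ℕ) := by
      linear_combination (3 * αr - 2) * hN - (g:ℝ) ^ b * Q * hυ1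
    exact mul_right_cancel₀ (by linarith) this
  have hLam := Lam_bound g k b hg υ (narayana k) (((g:ℝ) ^ lj)⁻¹) Q hυ0 hnar hNυ hQ1 hQ2 (by positivity)
    (by rw [one_div]; exact inv_anti₀ (by norm_num) h20R) (by rw [one_div, inv_inv]; linarith)
  set μ := Real.log g with hμd
  have hnR : (10:ℝ) ≤ n := by exact_mod_cast hn
  have htR : (100:ℝ) ≤ t := by exact_mod_cast ht
  have hm2R : (78:ℝ) ≤ m2 := by linarith
  have hs0 : (0:ℝ) ≤ s := by positivity
  have hm3R : (400:ℝ) ≤ m3 := by nlinarith only [hm3, hs0, hμ]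
  have hkU : (k:ℝ) ≤ 10.6 * (t * μ) := by
    have e1 : αr ^ k ≤ 4 * (g:ℝ) ^ (4 * t) := by
      have h9 := (abs_le.1 hnar).2
      have hN3 : (1:ℝ) ≤ narayana k := by linarith
      nlinarith only [h9, hN2R, hN3, hα2]
    have e2 := Real.log_le_log (by positivity) e1
    rw [Real.log_mul (by norm_num) (by positivity), Real.log_pow, Real.log_pow] at e2
    push_cast at e2
    have h9 := log4_lt
    nlinarith only [h9, e2, hl1, htR, hμ, (Nat.cast_nonneg k : (0:ℝ) ≤ k)]
  have hkL : 2.6 * (t * μ) ≤ (k:ℝ) := by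
    have e1 : (g:ℝ) ^ t ≤ αr ^ k := by
      have h9 := (abs_le.1 hnar).1
      have hN3 : (20:ℝ) ≤ narayana k := by linarith
      nlinarith only [h9, hN1R, hN3, hα1]
    have e2 := Real.log_le_log (by positivity) e1
    rw [Real.log_pow, Real.log_pow] at e2
    have h9 : (0:ℝ) ≤ k := by positivity
    have h8 : k * Real.log αr ≤ k * (23 / 60) := mul_le_mul_of_nonneg_left hl2.le h9
    linarith [show 0 ≤ t * μ by positivity]
  obtain ⟨S1, hS1⟩ : ∃ S1 : ℕ, S1 = m2 * m3 * (159 * n ^ 2) := ⟨_, rfl⟩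
  obtain ⟨S2, hS2⟩ : ∃ S2 : ℕ, S2 = 34 * m3 * (159 * n ^ 2) := ⟨_, rfl⟩
  obtain ⟨S3, hS3⟩ : ∃ S3 : ℕ, S3 = 34 * m2 * (159 * n ^ 2) := ⟨_, rfl⟩
  have hS1R : (S1:ℝ) = m2 * m3 * (159 * n ^ 2) := by rw [hS1]; push_cast; ring
  have hS2R : (S2:ℝ) = 34 * m3 * (159 * n ^ 2) := by rw [hS2]; push_cast; ring
  have hS3R : (S3:ℝ) = 34 * m2 * (159 * n ^ 2) := by rw [hS3]; push_cast; ring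
  have hljR : (lj:ℝ) ≤ t := by exact_mod_cast hlj
  have hT0 : 0 ≤ t * μ := by positivity
  obtain ⟨hS2l, hS3l, hS3n, hS3μ, hS21, hF, hS1b, hmmn⟩ := stage_numS m2 m3 n μ (t * μ) S1 S2 S3 _ hm2R hm2 hm3R hnR hT0 hS1R hS2R hS3R hVV
  by_cases hST : (S1:ℝ) ≤ t * μ
  swap
  · push Not at hST
    have : lj * μ ≤ t * μ := mul_le_mul_of_nonneg_right hljR (by linarith)
    linarith
  have hbR : (b:ℝ) ≤ 4 * t := by exact_mod_cast hb
  have hS2T : (S2:ℝ) ≤ t * μ := hS21.trans hST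
  have hT51 : 51 ≤ t * μ := by nlinarith only [htR, hμ]
  have hinjR : (b + S2 * S1 : ℝ) ≤ S2 * k := by
    have h1 : (S2:ℝ) * S1 ≤ S2 * (t * μ) := by apply mul_le_mul_of_nonneg_left hST (by linarith)
    have h2 : (S2:ℝ) * (2.6 * (t * μ)) ≤ S2 * k := by apply mul_le_mul_of_nonneg_left hkL (by linarith)
    have h3 : (t:ℝ) ≤ 1.5 * (t * μ) := by nlinarith only [htR, hμ]
    have h4 : 500000 * (t * μ) ≤ S2 * (t * μ) := mul_le_mul_of_nonneg_right hS2l hT0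
    linarith
  have hV1 := stage_num1 S1 S2 S3 k b n t (t * μ) μ (Real.exp (n - 1)) hμ rfl (by linarith) hnR hST (by positivity)
    hS2l hS3l hS3n hkU hbR hT51 hF
  have hV2 := stage_num2 S1 S2 S3 b t (t * μ) μ (Real.log αr) (Real.exp (n - 1)) hμ rfl (by linarith) hl1 hST (by positivity)
    hS2l hS3l hS3μ hS2T hbR (by positivity) hF
  by_contra hcon
  push Not at hcon
  refine bakerT g ((g - 1) ^ 4) u2 hg hu1N hu υ hυ0 hυ1 k b n m2 m3 hn ?_ (hH.trans hm3) S1 S2 S3 hS1 hS2 hS3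
    (by exact_mod_cast hinjR) hV1 hV2 _ rfl ?_
  · refine le_trans ?_ hm2
    apply mul_le_mul_of_nonneg_right _ (by linarith)
    linarith [exp2_lt]
  · refine hLam.trans ?_
    have e1 : ((g:ℝ) ^ lj)⁻¹ = Real.exp (-(lj * μ)) := by
      rw [Real.exp_neg, hμd, ← Real.log_pow, Real.exp_log (by positivity)]
    have e2 : (10:ℝ) ≤ Real.exp 4 := by
      have : Real.exp 4 = Real.exp 2 * Real.exp 2 := by rw [← Real.exp_add]; norm_num
      nlinarith only [exp2_gt, this]
    rw [e1]
    calc 10 * Real.exp (-(lj * μ)) ≤ Real.exp 4 * Real.exp (-(lj * μ)) := by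
          apply mul_le_mul_of_nonneg_right e2 (Real.exp_pos _).le
      _ = Real.exp (4 - lj * μ) := by rw [← Real.exp_add]; ring_nf
      _ ≤ _ := by
        apply Real.exp_le_exp.2
        linarith
end

section
open Finset Polynomial

theorem stage' (g k u2 b s t lj n : ℕ) (Q : ℝ) (hg : 2 ≤ g) (hu : 1 ≤ u2) (hu2 : u2 ≤ (g - 1) ^ 4 * g ^ s)
    (hN : (narayana k : ℝ) * ((g - 1) ^ 4 : ℕ) = u2 * g ^ b * Q)
    (hQ1 : 1 - 4 * ((g:ℝ) ^ lj)⁻¹ ≤ Q) (hQ2 : Q ≤ 1) (hb : b ≤ 4 * t) (hlj : lj ≤ t) (h20 : 20 ≤ g ^ lj)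
    (hN1 : g ^ t ≤ narayana k) (hN2 : narayana k ≤ g ^ (4 * t)) (ht : 100 ≤ t) (hn : 10 ≤ n)
    (hVV : 7.195e10 * ((601.5 + 112.7 * s) * n ^ 4 * t * Real.log g ^ 3) ≤ Real.exp (n - 1)) :
    lj ≤ 8565200 * ((601.5 + 112.7 * s) * Real.log g * n ^ 3) := by
  have hμ := mu_ge g hg
  set μ := Real.log g with hμd
  have hs0 : (0:ℝ) ≤ s := by positivity
  have hm2 : (⌈112.67 * μ⌉₊ : ℝ) ≤ 114.2 * μ := by
    have := (Nat.ceil_lt_add_one (show 0 ≤ 112.67 * μ by positivity)).le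
    linarith
  have hm3 : (⌈(600 + 112.7 * s) * μ⌉₊ : ℝ) ≤ (601.5 + 112.7 * s) * μ := by
    have := (Nat.ceil_lt_add_one (show 0 ≤ (600 + 112.7 * s) * μ by positivity)).le
    linarith
  have hmm : (⌈112.67 * μ⌉₊ : ℝ) * ⌈(600 + 112.7 * s) * μ⌉₊ ≤ 114.2 * μ * ((601.5 + 112.7 * s) * μ) :=
    mul_le_mul hm2 hm3 (by positivity) (by positivity)
  have key := stage g k u2 b s t lj n ⌈112.67 * μ⌉₊ ⌈(600 + 112.7 * s) * μ⌉₊ Q hg hu hu2 hN hQ1 hQ2 hb hlj h20 hN1 hN2 ht hn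
    (Nat.le_ceil _) (Nat.le_ceil _) (by
      refine le_trans ?_ hVV
      rw [← hμd]
      calc _ ≤ 6.3e8 * (114.2 * μ * ((601.5 + 112.7 * s) * μ) * n ^ 4 * (t * μ)) := by gcongr
        _ = 7.1946e10 * ((601.5 + 112.7 * s) * n ^ 4 * t * μ ^ 3) := by ring
        _ ≤ _ := by
          apply mul_le_mul_of_nonneg_right (by norm_num) (by positivity))
  rw [← hμd] at key
  have k2 : lj * μ ≤ 8565200 * ((601.5 + 112.7 * s) * μ * n ^ 3) * μ := by
    calc _ ≤ _ := key
      _ ≤ 75001 * (114.2 * μ * ((601.5 + 112.7 * s) * μ) * n ^ 3) := by gcongr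
      _ = 8565114.2 * ((601.5 + 112.7 * s) * μ * n ^ 3 * μ) := by ring
      _ ≤ 8565200 * ((601.5 + 112.7 * s) * μ * n ^ 3 * μ) := by
        apply mul_le_mul_of_nonneg_right (by norm_num) (by positivity)
      _ = _ := by ring
  exact le_of_mul_le_mul_right k2 (by linarith)

lemma Q_one (x c a y : ℝ) (hx : 0 ≤ x) (hx1 : x ≤ 1) (hc : 0 ≤ c) (h1 : 1 - c * x ≤ a) (h2 : a ≤ 1) (hy : 0 ≤ y) (hyx : y ≤ x) :
    1 - (c + 1) * x ≤ a * (1 - y) ∧ a * (1 - y) ≤ 1 := by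
  constructor
  · have : (1 - a) * y ≥ 0 := by apply mul_nonneg <;> linarith
    nlinarith
  · nlinarith

set_option maxHeartbeats 2000000 in
theorem four (g k d₁ d₂ d₃ d₄ ℓ m n t : ℕ) (hg : 2 ≤ g)
    (hd₁ : 1 ≤ d₁) (hd₁g : d₁ ≤ g - 1) (hd₂ : 1 ≤ d₂) (hd₂g : d₂ ≤ g - 1)
    (hd₃ : 1 ≤ d₃) (hd₃g : d₃ ≤ g - 1) (hd₄ : 1 ≤ d₄) (hd₄g : d₄ ≤ g - 1)
    (hℓ : 100000 ≤ ℓ) (hℓm : ℓ ≤ m) (hmn : m ≤ n) (hnt : n ≤ t)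
    (heq : narayana k * (g - 1) ^ 4 =
      d₁ * d₂ * d₃ * d₄ * (g ^ ℓ - 1) * (g ^ m - 1) * (g ^ n - 1) * (g ^ t - 1)) (r : ℕ) (hr : 10 ≤ r) :
    (4.328e13 * (r ^ 4 * t * Real.log g ^ 3) ≤ Real.exp (r - 1) → ℓ ≤ 5.152e9 * (Real.log g * r ^ 3)) ∧
    (2.435e13 * (r ^ 4 * t ^ 2 * Real.log g ^ 3) ≤ Real.exp (r - 1) →
      m ≤ 9.67e8 * (ℓ * Real.log g * r ^ 3) ∧ n ≤ 9.67e8 * (2 * m * Real.log g * r ^ 3) ∧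
      t ≤ 9.67e8 * (3 * n * Real.log g * r ^ 3)) := by
  have hμ := mu_ge g hg
  set μ := Real.log g with hμd
  have hgR : (2:ℝ) ≤ g := by exact_mod_cast hg
  have hg0 : (0:ℝ) < g := by linarith
  have hx1 : ∀ l : ℕ, 1 ≤ g ^ l := fun l => Nat.one_le_pow _ _ (by omega)
  have hxl : ∀ l : ℕ, ((g ^ l - 1 : ℕ):ℝ) = g ^ l * (1 - ((g:ℝ) ^ l)⁻¹) := by
    intro l
    rw [Nat.cast_sub (hx1 l)]
    have : (g:ℝ) ^ l ≠ 0 := by positivity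
    push_cast
    field_simp
  have hpos : ∀ l : ℕ, 1 ≤ l → 1 ≤ g ^ l - 1 := by
    intro l hl
    have : 2 ^ 1 ≤ g ^ l := (Nat.pow_le_pow_left hg 1).trans (Nat.pow_le_pow_right (by omega) hl)
    omega
  have hu1N : 1 ≤ (g - 1) ^ 4 := Nat.one_le_pow _ _ (by omega)
  have hd : d₁ * d₂ * d₃ * d₄ ≤ (g - 1) ^ 4 := by
    calc d₁ * d₂ * d₃ * d₄ ≤ (g-1) * (g-1) * (g-1) * (g-1) := by gcongr
      _ = _ := by ring
  have hd1 : 1 ≤ d₁ * d₂ * d₃ * d₄ := Nat.mul_pos (Nat.mul_pos (Nat.mul_pos hd₁ hd₂) hd₃) hd₄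
  have hN2 : narayana k ≤ g ^ (4 * t) := by
    have : narayana k * (g - 1) ^ 4 ≤ g ^ (4 * t) * (g - 1) ^ 4 := by
      rw [heq]
      calc _ ≤ (g - 1) ^ 4 * g ^ t * g ^ t * g ^ t * g ^ t := by
            have hh : ∀ l, l ≤ t → g ^ l - 1 ≤ g ^ t := fun l hl =>
              (Nat.sub_le _ _).trans (Nat.pow_le_pow_right (by omega) hl)
            gcongr <;> apply hh <;> omega
        _ = _ := by ring
    exact Nat.le_of_mul_le_mul_right this hu1N
  have hlow : ∀ l : ℕ, 1 ≤ l → (g - 1) * g ^ (l - 1) ≤ g ^ l - 1 := by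
    intro l hl
    obtain ⟨l, rfl⟩ : ∃ q, l = q + 1 := ⟨l - 1, by omega⟩
    have h1 := hx1 l
    obtain ⟨h, rfl⟩ : ∃ q, g = q + 1 := ⟨g - 1, by omega⟩
    simp only [Nat.add_sub_cancel]
    rw [pow_succ]
    apply Nat.le_sub_of_add_le
    nlinarith
  have hN1 : g ^ t ≤ narayana k := by
    have : g ^ t * (g - 1) ^ 4 ≤ narayana k * (g - 1) ^ 4 := by
      rw [heq]
      calc g ^ t * (g - 1) ^ 4 ≤ g ^ ((ℓ - 1) + (m - 1) + (n - 1) + (t - 1)) * (g - 1) ^ 4 := by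
            apply Nat.mul_le_mul_right
            apply Nat.pow_le_pow_right (by omega)
            omega
        _ = 1 * ((g - 1) * g ^ (ℓ - 1)) * ((g - 1) * g ^ (m - 1)) * ((g - 1) * g ^ (n - 1)) * ((g - 1) * g ^ (t - 1)) := by
            rw [pow_add, pow_add, pow_add]; ring
        _ ≤ _ := by
            gcongr <;> apply hlow <;> omega
    exact Nat.le_of_mul_le_mul_right this hu1N
  have h20 : ∀ l : ℕ, 5 ≤ l → 20 ≤ g ^ l := by
    intro l hl
    have : 2 ^ 5 ≤ g ^ l := (Nat.pow_le_pow_left hg 5).trans (Nat.pow_le_pow_right (by omega) hl)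
    omega
  have hinv : ∀ l : ℕ, 0 ≤ ((g:ℝ) ^ l)⁻¹ := fun l => by positivity
  have hinv1 : ∀ l : ℕ, ((g:ℝ) ^ l)⁻¹ ≤ 1 := fun l => inv_le_one_of_one_le₀ (by exact_mod_cast hx1 l)
  have hinva : ∀ a b : ℕ, a ≤ b → ((g:ℝ) ^ b)⁻¹ ≤ ((g:ℝ) ^ a)⁻¹ := fun a b h =>
    inv_anti₀ (by positivity) (pow_le_pow_right₀ (by linarith) h)
  have heqR : (narayana k : ℝ) * ((g - 1) ^ 4 : ℕ) = ((d₁ * d₂ * d₃ * d₄ : ℕ):ℝ) * ((g ^ ℓ - 1 : ℕ):ℝ) *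
      ((g ^ m - 1 : ℕ):ℝ) * ((g ^ n - 1 : ℕ):ℝ) * ((g ^ t - 1 : ℕ):ℝ) := by
    rw [← Nat.cast_mul, heq]; push_cast; ring
  have hℓR : (100000:ℝ) ≤ ℓ := by exact_mod_cast hℓ
  have hℓmR : (ℓ:ℝ) ≤ m := by exact_mod_cast hℓm
  have hmnR : (m:ℝ) ≤ n := by exact_mod_cast hmn
  have hntR : (n:ℝ) ≤ t := by exact_mod_cast hnt
  have hrR : (10:ℝ) ≤ r := by exact_mod_cast hr
  refine ⟨fun hE => ?_, fun hE => ?_⟩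
  · have q1 := Q_one ((g:ℝ) ^ ℓ)⁻¹ 0 1 ((g:ℝ) ^ ℓ)⁻¹ (hinv _) (hinv1 _) le_rfl (by simp) le_rfl (hinv _) le_rfl
    have q2 := Q_one ((g:ℝ) ^ ℓ)⁻¹ _ _ ((g:ℝ) ^ m)⁻¹ (hinv _) (hinv1 _) (by norm_num) q1.1 q1.2 (hinv _) (hinva _ _ (by omega))
    have q3 := Q_one ((g:ℝ) ^ ℓ)⁻¹ _ _ ((g:ℝ) ^ n)⁻¹ (hinv _) (hinv1 _) (by norm_num) q2.1 q2.2 (hinv _) (hinva _ _ (by omega))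
    have q4 := Q_one ((g:ℝ) ^ ℓ)⁻¹ _ _ ((g:ℝ) ^ t)⁻¹ (hinv _) (hinv1 _) (by norm_num) q3.1 q3.2 (hinv _) (hinva _ _ (by omega))
    have key := stage' g k (d₁ * d₂ * d₃ * d₄) (ℓ + m + n + t) 0 t ℓ r _ hg hd1 (by simpa using hd)
      (by rw [heqR, hxl, hxl, hxl, hxl, pow_add, pow_add, pow_add]; ring) (by linarith [q4.1]) q4.2 (by omega) (by omega) (h20 _ (by omega))
      hN1 hN2 (by omega) hr (by
        refine le_trans ?_ hE
        rw [← hμd]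
        have : 0 ≤ (r:ℝ) ^ 4 * t * μ ^ 3 := by positivity
        push_cast; nlinarith)
    rw [← hμd] at key
    have : 0 ≤ μ * (r:ℝ) ^ 3 := by positivity
    push_cast at key; nlinarith
  have hgen : ∀ s : ℕ, 100000 ≤ s → s ≤ 3 * t → 7.195e10 * ((601.5 + 112.7 * s) * r ^ 4 * t * μ ^ 3) ≤ Real.exp (r - 1) := by
    intro s hs hs2
    refine le_trans ?_ hE
    have hs2R : (s:ℝ) ≤ 3 * t := by exact_mod_cast hs2
    have hb : (601.5 + 112.7 * s : ℝ) ≤ 112.8 * (3 * t) := by linarith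
    calc _ ≤ 7.195e10 * ((112.8 * (3 * t)) * r ^ 4 * t * μ ^ 3) := by gcongr
      _ = 2.434788e13 * (r ^ 4 * t ^ 2 * μ ^ 3) := by ring
      _ ≤ _ := by
        apply mul_le_mul_of_nonneg_right (by norm_num) (by positivity)
  have hfin : ∀ (l s : ℕ) (S : ℝ), 100000 ≤ s → (s:ℝ) ≤ S → (l:ℝ) ≤ 8565200 * ((601.5 + 112.7 * s) * μ * r ^ 3) → l ≤ 9.67e8 * (S * μ * r ^ 3) := by
    intro l s S hs hsS h
    refine h.trans ?_
    have hsR : (100000:ℝ) ≤ s := by exact_mod_cast hs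
    have hb : (601.5 + 112.7 * s : ℝ) ≤ 112.8 * S := by linarith
    have hS0 : 0 ≤ S := by linarith
    calc _ ≤ 8565200 * ((112.8 * S) * μ * r ^ 3) := by gcongr
      _ = 8565200 * 112.8 * (S * μ * r ^ 3) := by ring
      _ ≤ _ := by
        apply mul_le_mul_of_nonneg_right (by norm_num) (by positivity)
  refine ⟨?_, ?_, ?_⟩
  · have q2 := Q_one ((g:ℝ) ^ m)⁻¹ 0 1 ((g:ℝ) ^ m)⁻¹ (hinv _) (hinv1 _) le_rfl (by simp) le_rfl (hinv _) le_rfl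
    have q3 := Q_one ((g:ℝ) ^ m)⁻¹ _ _ ((g:ℝ) ^ n)⁻¹ (hinv _) (hinv1 _) (by norm_num) q2.1 q2.2 (hinv _) (hinva _ _ (by omega))
    have q4 := Q_one ((g:ℝ) ^ m)⁻¹ _ _ ((g:ℝ) ^ t)⁻¹ (hinv _) (hinv1 _) (by norm_num) q3.1 q3.2 (hinv _) (hinva _ _ (by omega))
    have key := stage' g k (d₁ * d₂ * d₃ * d₄ * (g ^ ℓ - 1)) (m + n + t) ℓ t m r _ hg
      (Nat.mul_pos hd1 (hpos _ (by omega))) (Nat.mul_le_mul hd (Nat.sub_le _ _))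
      (by rw [heqR, hxl m, hxl n, hxl t, pow_add, pow_add, Nat.cast_mul _ (g ^ ℓ - 1)]; ring) (by linarith [q4.1, hinv m]) q4.2 (by omega) (by omega) (h20 _ (by omega))
      hN1 hN2 (by omega) hr (hgen _ (by omega) (by omega))
    exact hfin _ _ _ (by omega) le_rfl key
  · have q3 := Q_one ((g:ℝ) ^ n)⁻¹ 0 1 ((g:ℝ) ^ n)⁻¹ (hinv _) (hinv1 _) le_rfl (by simp) le_rfl (hinv _) le_rfl
    have q4 := Q_one ((g:ℝ) ^ n)⁻¹ _ _ ((g:ℝ) ^ t)⁻¹ (hinv _) (hinv1 _) (by norm_num) q3.1 q3.2 (hinv _) (hinva _ _ (by omega))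
    have key := stage' g k (d₁ * d₂ * d₃ * d₄ * (g ^ ℓ - 1) * (g ^ m - 1)) (n + t) (ℓ + m) t n r _ hg
      (Nat.mul_pos (Nat.mul_pos hd1 (hpos _ (by omega))) (hpos _ (by omega)))
      (by rw [pow_add, ← mul_assoc]; exact Nat.mul_le_mul (Nat.mul_le_mul hd (Nat.sub_le _ _)) (Nat.sub_le _ _))
      (by rw [heqR, hxl n, hxl t, pow_add, Nat.cast_mul _ (g ^ m - 1), Nat.cast_mul _ (g ^ ℓ - 1)]; ring) (by linarith [q4.1, hinv n]) q4.2 (by omega) (by omega) (h20 _ (by omega))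
      hN1 hN2 (by omega) hr (hgen _ (by omega) (by omega))
    exact hfin _ _ _ (by omega) (by push_cast; linarith) key
  · have q4 := Q_one ((g:ℝ) ^ t)⁻¹ 0 1 ((g:ℝ) ^ t)⁻¹ (hinv _) (hinv1 _) le_rfl (by simp) le_rfl (hinv _) le_rfl
    have key := stage' g k (d₁ * d₂ * d₃ * d₄ * (g ^ ℓ - 1) * (g ^ m - 1) * (g ^ n - 1)) t (ℓ + m + n) t t r _ hg
      (Nat.mul_pos (Nat.mul_pos (Nat.mul_pos hd1 (hpos _ (by omega))) (hpos _ (by omega))) (hpos _ (by omega)))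
      (by rw [pow_add, pow_add, ← mul_assoc, ← mul_assoc]; exact Nat.mul_le_mul (Nat.mul_le_mul (Nat.mul_le_mul hd (Nat.sub_le _ _)) (Nat.sub_le _ _)) (Nat.sub_le _ _))
      (by rw [heqR, hxl t, Nat.cast_mul _ (g ^ n - 1), Nat.cast_mul _ (g ^ m - 1), Nat.cast_mul _ (g ^ ℓ - 1)]; ring) (by linarith [q4.1, hinv t]) q4.2 (by omega) (by omega) (h20 _ (by omega))
      hN1 hN2 (by omega) hr (hgen _ (by omega) (by omega))
    exact hfin _ _ _ (by omega) (by push_cast; linarith) key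
end

section
open Finset Polynomial

lemma exp_nat2 (c : ℕ) : (7.389:ℝ) ^ c ≤ Real.exp (2 * c) := by
  have : Real.exp (2 * c) = Real.exp 2 ^ c := by rw [← Real.exp_nat_mul]; ring_nf
  rw [this]
  exact pow_le_pow_left₀ (by norm_num) exp2_gt.le c

lemma log_le_400 (x : ℝ) (hx : 0 < x) : Real.log x ≤ x / 400 + 5 := by
  have h1 := Real.log_le_sub_one_of_pos (show 0 < x / 400 by positivity)
  rw [Real.log_div hx.ne' (by norm_num)] at h1
  have h2 : Real.log 400 ≤ 6 := by
    rw [Real.log_le_iff_le_exp (by norm_num)]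
    have := exp_nat2 3
    norm_num at this
    linarith
  linarith

lemma exp_choice (A X : ℝ) (r : ℕ) (hX : 0 < X) (hr : 10 ≤ r) (h : 53 + A ≤ 0.99 * r) (hA : Real.log X = A) :
    4.328e13 * (r ^ 4 * X) ≤ Real.exp (r - 1) := by
  have hr0 : (0:ℝ) < r := by exact_mod_cast (by omega : 0 < r)
  rw [← Real.log_le_iff_le_exp (by positivity), Real.log_mul (by norm_num) (by positivity), Real.log_mul (by positivity) hX.ne',
    Real.log_pow, hA]
  have h1 := log_le_400 r hr0
  have h2 : Real.log 4.328e13 ≤ 32 := by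
    rw [Real.log_le_iff_le_exp (by norm_num)]
    have := exp_nat2 16
    norm_num at this
    linarith
  push_cast
  linarith

lemma cubic_num (y : ℝ) (h1 : 6 ≤ y) (h2 : y ≤ 160) : (1.0102 * y + 54) ^ 3 < 90000 * y := by
  have h3 : 0 ≤ (y - 6) * (160 - y) := mul_nonneg (by linarith) (by linarith)
  have h4 : 0 ≤ y * ((y - 6) * (160 - y)) := mul_nonneg (by linarith) h3
  nlinarith only [h1, h2, h3, h4]

lemma final_num (q L n E : ℝ) (hq : 0 ≤ q) (hn0 : 0 ≤ n) (hn : n ≤ 53.4 + 3.04 * q + 1.0102 * L) (hL : 6 + 2 * q ≤ L)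
    (hL2 : L ≤ 158 + 4.4 * q) (hE : E = Real.exp q) : n ^ 3 < 90000 * E * L := by
  have hE1 : (1 + q / 3) ^ 3 ≤ E := by
    have : E = Real.exp (q / 3) ^ 3 := by rw [hE, ← Real.exp_nat_mul]; congr 1; push_cast; ring
    rw [this]
    apply pow_le_pow_left₀ (by positivity)
    linarith [Real.add_one_le_exp (q / 3)]
  obtain ⟨p, hp⟩ : ∃ p, p = 1 + q / 3 := ⟨_, rfl⟩
  have hp0 : 1 ≤ p := by linarith
  obtain ⟨y, hy⟩ : ∃ y, y = L / p := ⟨_, rfl⟩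
  have hLy : L = p * y := by rw [hy]; field_simp
  have hy6 : 6 ≤ y := by rw [hy, le_div_iff₀ (by linarith)]; linarith
  have hy160 : y ≤ 160 := by rw [hy, div_le_iff₀ (by linarith)]; linarith
  have h := cubic_num y hy6 hy160
  have hnp : n ≤ p * (1.0102 * y + 54) := by
    have : p * (1.0102 * y + 54) = 1.0102 * L + 54 * p := by rw [hLy]; ring
    rw [this]; linarith
  rw [← hp] at hE1
  calc n ^ 3 ≤ (p * (1.0102 * y + 54)) ^ 3 := pow_le_pow_left₀ hn0 hnp 3
    _ = p ^ 3 * (1.0102 * y + 54) ^ 3 := by ring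
    _ < p ^ 3 * (90000 * y) := by
        apply mul_lt_mul_of_pos_left h (by positivity)
    _ ≤ p ^ 3 * (90000 * L) := by
        apply mul_le_mul_of_nonneg_left _ (by positivity)
        have : y ≤ L := by rw [hLy]; nlinarith only [hy6, hp0]
        linarith
    _ ≤ E * (90000 * L) := by
        apply mul_le_mul_of_nonneg_right hE1 (by linarith)
    _ = _ := by ring

set_option maxHeartbeats 2000000 in
theorem ell_bound (g k d₁ d₂ d₃ d₄ ℓ m n t : ℕ) (hg : 2 ≤ g) (hk : 1 ≤ k)
    (hd₁ : 1 ≤ d₁) (hd₁g : d₁ ≤ g - 1) (hd₂ : 1 ≤ d₂) (hd₂g : d₂ ≤ g - 1)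
    (hd₃ : 1 ≤ d₃) (hd₃g : d₃ ≤ g - 1) (hd₄ : 1 ≤ d₄) (hd₄g : d₄ ≤ g - 1)
    (hℓ : 1 ≤ ℓ) (hℓm : ℓ ≤ m) (hmn : m ≤ n) (hnt : n ≤ t) (ht : 2 ≤ t)
    (heq : narayana k * (g - 1) ^ 4 =
      d₁ * d₂ * d₃ * d₄ * (g ^ ℓ - 1) * (g ^ m - 1) * (g ^ n - 1) * (g ^ t - 1)) :
    (ℓ : ℝ) < 7.8e14 * Real.log t * Real.log g ^ 2 := by
  by_contra hcon
  push Not at hcon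
  have hμ := mu_ge g hg
  have hL0 := mu_ge t ht
  set μ := Real.log g with hμd
  set L := Real.log t with hLd
  have htR : (2:ℝ) ≤ t := by exact_mod_cast ht
  have hℓt : (ℓ:ℝ) ≤ t := by exact_mod_cast (by omega : ℓ ≤ t)
  have hμ2 : 0.48 ≤ μ ^ 2 := by nlinarith only [hμ]
  have hbig : 5e14 * μ ^ 2 ≤ ℓ := by
    refine le_trans ?_ hcon
    apply mul_le_mul_of_nonneg_right _ (by positivity)
    linarith
  have hℓ5 : 100000 ≤ ℓ := by
    have : (100000:ℝ) ≤ ℓ := by linarith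
    exact_mod_cast this
  obtain ⟨q, hq⟩ : ∃ q, q = Real.log μ + 0.4 := ⟨_, rfl⟩
  have hq0 : 0 ≤ q := by
    have h : Real.exp (-0.4) ≤ μ := by
      rw [Real.exp_neg]
      have := Real.quadratic_le_exp_of_nonneg (show (0:ℝ) ≤ 0.4 by norm_num)
      have h2 : (Real.exp 0.4)⁻¹ ≤ (1.48:ℝ)⁻¹ := inv_anti₀ (by norm_num) (by linarith)
      refine h2.trans (le_trans ?_ hμ)
      norm_num
    have := (Real.le_log_iff_exp_le (by linarith)).2 h
    linarith
  have hμq : 0.6 * Real.exp q ≤ μ := by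
    have h : μ = Real.exp q * Real.exp (-0.4) := by
      rw [← Real.exp_add, hq, show Real.log μ + 0.4 + -0.4 = Real.log μ by ring, Real.exp_log (by linarith)]
    have h2 := Real.add_one_le_exp (-0.4)
    have h3 := Real.exp_pos q
    calc 0.6 * Real.exp q ≤ Real.exp (-0.4) * Real.exp q := by
          apply mul_le_mul_of_nonneg_right _ h3.le
          linarith
      _ = μ := by rw [h]; ring
  have hLlow : 6 + 2 * q ≤ L := by
    rw [hLd, Real.le_log_iff_exp_le (by linarith)]
    have h1 : Real.exp (6 + 2 * q) ≤ Real.exp (8 + 2 * Real.log μ) := Real.exp_le_exp.2 (by linarith)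
    have h2 : Real.exp (8 + 2 * Real.log μ) = Real.exp 2 ^ 4 * μ ^ 2 := by
      rw [Real.exp_add, ← Real.exp_nat_mul]
      have : Real.exp (2 * Real.log μ) = μ ^ 2 := by
        rw [← Real.exp_log (show 0 < μ ^ 2 by positivity), Real.log_pow]; norm_num
      rw [this]; norm_num
    have h3 : Real.exp 2 ^ 4 ≤ 8 ^ 4 := pow_le_pow_left₀ (Real.exp_pos _).le (by linarith [exp2_lt]) 4
    have h4 : Real.exp 2 ^ 4 * μ ^ 2 ≤ 8 ^ 4 * μ ^ 2 := mul_le_mul_of_nonneg_right h3 (by positivity)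
    linarith
  have hF := four g k d₁ d₂ d₃ d₄ ℓ m n t hg hd₁ hd₁g hd₂ hd₂g hd₃ hd₃g hd₄ hd₄g hℓ5 hℓm hmn hnt heq
  rw [← hμd] at hF
  have ht0 : (0:ℝ) < t := by linarith
  have hμ0 : 0 < μ := by linarith
  -- bootstrapping
  have hLhigh : L ≤ 158 + 4.4 * q := by
    obtain ⟨A, hA⟩ : ∃ A, A = 3 * Real.log μ + 2 * L := ⟨_, rfl⟩
    obtain ⟨r, hr⟩ : ∃ r, r = ⌈(53 + A) / 0.99⌉₊ := ⟨_, rfl⟩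
    have hA0 : 0 ≤ A := by linarith
    have hr1 : (53 + A) / 0.99 ≤ r := by rw [hr]; exact Nat.le_ceil _
    have hr2 : (r:ℝ) ≤ (53 + A) / 0.99 + 1 := by
      rw [hr]; exact (Nat.ceil_lt_add_one (by positivity)).le
    rw [div_le_iff₀ (by norm_num)] at hr1
    have hr3 : (r:ℝ) ≤ 54.6 + 1.0102 * A := by
      have : (53 + A) / 0.99 ≤ 53.6 + 1.0102 * A := by rw [div_le_iff₀ (by norm_num)]; linarith
      linarith
    have hr10 : 10 ≤ r := by
      have : (10:ℝ) ≤ r := by linarith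
      exact_mod_cast this
    have hlog : Real.log ((t:ℝ) ^ 2 * μ ^ 3) = A := by
      rw [Real.log_mul (by positivity) (by positivity), Real.log_pow, Real.log_pow, hA]; push_cast; ring
    have hch := exp_choice A ((t:ℝ) ^ 2 * μ ^ 3) r (by positivity) hr10 (by linarith) hlog
    have hr0 : (0:ℝ) < r := by exact_mod_cast (by omega : 0 < r)
    obtain ⟨f1, f2⟩ := hF r hr10
    have f1 := f1 (by
      refine le_trans ?_ hch
      apply mul_le_mul_of_nonneg_left _ (by norm_num)
      have : (t:ℝ) ≤ t ^ 2 := by nlinarith only [htR]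
      calc (r:ℝ) ^ 4 * t * μ ^ 3 ≤ (r:ℝ) ^ 4 * t ^ 2 * μ ^ 3 := by gcongr
        _ = _ := by ring)
    obtain ⟨f2, f3, f4⟩ := f2 (by
      refine le_trans ?_ hch
      rw [← mul_assoc ((r:ℝ) ^ 4)]
      apply mul_le_mul_of_nonneg_right (by norm_num) (by positivity))
    have hprod : (t:ℝ) ≤ 2.8e37 * (μ * r ^ 3) ^ 4 := by
      calc (t:ℝ) ≤ 9.67e8 * (3 * n * μ * r ^ 3) := f4
        _ ≤ 9.67e8 * (3 * (9.67e8 * (2 * m * μ * r ^ 3)) * μ * r ^ 3) := by gcongr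
        _ ≤ 9.67e8 * (3 * (9.67e8 * (2 * (9.67e8 * (ℓ * μ * r ^ 3)) * μ * r ^ 3)) * μ * r ^ 3) := by gcongr
        _ ≤ 9.67e8 * (3 * (9.67e8 * (2 * (9.67e8 * ((5.152e9 * (μ * r ^ 3)) * μ * r ^ 3)) * μ * r ^ 3)) * μ * r ^ 3) := by gcongr
        _ = (9.67e8 * 3 * 9.67e8 * 2 * 9.67e8 * 5.152e9) * (μ * r ^ 3) ^ 4 := by ring
        _ ≤ _ := by
          apply mul_le_mul_of_nonneg_right (by norm_num) (by positivity)
    have hl := Real.log_le_log ht0 hprod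
    rw [Real.log_mul (by norm_num) (by positivity), Real.log_pow, Real.log_mul (by positivity) (by positivity), Real.log_pow, ← hLd] at hl
    have h2 : Real.log 2.8e37 ≤ 88 := by
      rw [Real.log_le_iff_le_exp (by norm_num)]
      have := exp_nat2 44
      norm_num at this
      linarith
    have h3 := log_le_400 r hr0
    push_cast at hl
    linarith
  -- final step
  obtain ⟨A, hA⟩ : ∃ A, A = 3 * Real.log μ + L := ⟨_, rfl⟩
  obtain ⟨r, hr⟩ : ∃ r, r = ⌈(53 + A) / 0.99⌉₊ := ⟨_, rfl⟩
  have hA0 : -1.2 ≤ A := by linarith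
  have hr1 : (53 + A) / 0.99 ≤ r := by rw [hr]; exact Nat.le_ceil _
  have hr2 : (r:ℝ) ≤ (53 + A) / 0.99 + 1 := by
    rw [hr]; exact (Nat.ceil_lt_add_one (div_nonneg (by linarith) (by norm_num))).le
  rw [div_le_iff₀ (by norm_num)] at hr1
  have hr10 : 10 ≤ r := by
    have : (10:ℝ) ≤ r := by linarith
    exact_mod_cast this
  have hr3 : (r:ℝ) ≤ 53.4 + 3.04 * q + 1.0102 * L := by
    have : (53 + A) / 0.99 ≤ 52.4 + 3.04 * q + 1.0102 * L := by
      rw [div_le_iff₀ (by norm_num), hA]; linarith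
    linarith
  have hlog : Real.log ((t:ℝ) * μ ^ 3) = A := by
    rw [Real.log_mul (by positivity) (by positivity), Real.log_pow, hA]; push_cast; ring
  have hch := exp_choice A ((t:ℝ) * μ ^ 3) r (by positivity) hr10 (by linarith) hlog
  have f1 := (hF r hr10).1 (by rw [mul_assoc ((r:ℝ) ^ 4)]; exact hch)
  have fin := final_num q L r _ hq0 (by positivity) hr3 hLlow hLhigh rfl
  have h1 : (r:ℝ) ^ 3 < 150000 * (μ * L) := by
    have := mul_le_mul_of_nonneg_right hμq (show 0 ≤ L by linarith)
    linarith
  have h2 : μ * (r:ℝ) ^ 3 < μ * (150000 * (μ * L)) := mul_lt_mul_of_pos_left h1 hμ0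
  have h3 : 0 ≤ L * μ ^ 2 := by positivity
  nlinarith only [h2, h3, f1, hcon]
end
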